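/- Let d, s ≥ 2 be integers with d + s > 5. Then the cone of block positive matrices in Her_d ⊗ Her_s ≅ Her_{ds} (equivalently, under the Choi correspondence, the cone of positive linear maps Mat_d → Mat_s) is not a spectrahedral shadow, although it is a closed convex semialgebraic cone. -/

import Mathlib

open Matrix
open scoped Kronecker ComplexOrder

/-- A set `S` in a real vector space `V` is a spectrahedral shadow if it is the image,
under a linear map, of a spectrahedron `{x ∈ ℝⁿ | A₀ + x₁A₁ + ⋯ + xₙAₙ ⪰ 0}` described
by Hermitian matrices `A₀, A₁, …, Aₙ`. -/
def IsSpectrahedralShadow {V : Type*} [AddCommGroup V] [Module ℝ V] (S : Set V) : Prop :=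
  ∃ (n m : ℕ) (A₀ : Matrix (Fin m) (Fin m) ℂ) (A : Fin n → Matrix (Fin m) (Fin m) ℂ)
    (L : (Fin n → ℝ) →ₗ[ℝ] V),
    A₀.IsHermitian ∧ (∀ i, (A i).IsHermitian) ∧
      S = L '' {x : Fin n → ℝ | (A₀ + ∑ i, x i • A i).PosSemidef}

/-- A subset of `ι → ℝ` is semialgebraic if it is a finite union of basic sets, each cut
out by one polynomial equation and finitely many strict polynomial inequalities. -/
def IsSemialgebraic {ι : Type*} (S : Set (ι → ℝ)) : Prop :=
  ∃ (k m : ℕ) (p : Fin k → MvPolynomial ι ℝ) (q : Fin k → Fin m → MvPolynomial ι ℝ),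
    S = ⋃ i : Fin k, {x : ι → ℝ |
      MvPolynomial.eval x (p i) = 0 ∧ ∀ j : Fin m, 0 < MvPolynomial.eval x (q i j)}

/-- The real coordinates (real and imaginary parts of all entries) of a complex matrix.
This is a real-linear bijection between `Matrix ι ι ℂ` and `ℝ^(ι × ι × Bool)`. -/
def matrixCoords {ι : Type*} (C : Matrix ι ι ℂ) : ι × ι × Bool → ℝ :=
  fun p => if p.2.2 then (C p.1 p.2.1).re else (C p.1 p.2.1).im

/-- The cone of block positive matrices in `Her_d ⊗ Her_s`:
Hermitian matrices `C` with `tr((σ ⊗ τ) C) ≥ 0` for all psd `σ`, `τ`. -/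
def BlockPositive (d s : ℕ) : Set (Matrix (Fin d × Fin s) (Fin d × Fin s) ℂ) :=
  {C | C.IsHermitian ∧ ∀ (σ : Matrix (Fin d) (Fin d) ℂ) (τ : Matrix (Fin s) (Fin s) ℂ),
    σ.PosSemidef → τ.PosSemidef → 0 ≤ ((σ ⊗ₖ τ) * C).trace}

/-- The order automorphism of `ℝ` fixing `(-∞, c]` and scaling by `k > 0` on `[c, ∞)`. -/
noncomputable def bendIso (c k : ℝ) (hk : 0 < k) : ℝ ≃o ℝ where
  toFun y := c + min (y - c) 0 + k * max (y - c) 0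
  invFun y := c + min (y - c) 0 + k⁻¹ * max (y - c) 0
  left_inv y := by
    rcases le_total y c with h | h
    · have h' : y - c ≤ 0 := by linarith
      simp [h']
    · have h' : 0 ≤ y - c := by linarith
      have h2 : 0 ≤ k * (y - c) := by positivity
      simp [h', h2, hk.ne']
  right_inv y := by
    rcases le_total y c with h | h
    · have h' : y - c ≤ 0 := by linarith
      simp [h']
    · have h' : 0 ≤ y - c := by linarith
      have h2 : 0 ≤ k⁻¹ * (y - c) := by positivity
      simp [h', h2, hk.ne']
  map_rel_iff' := by
    have hm : StrictMono fun y : ℝ => c + min (y - c) 0 + k * max (y - c) 0 := by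
      intro a b hab
      rcases le_total a c with ha | ha <;> rcases le_total b c with hb | hb
      · have h1 : a - c ≤ 0 := by linarith
        have h2 : b - c ≤ 0 := by linarith
        simpa [h1, h2] using hab
      · have h1 : a - c ≤ 0 := by linarith
        have h2 : 0 ≤ b - c := by linarith
        simp only [h1, h2, min_eq_left, max_eq_right, min_eq_right, max_eq_left]
        rcases h2.eq_or_lt with h | h
        · rw [← h]; linarith
        · have : 0 < k * (b - c) := by positivity
          linarith
      · linarith
      · have h1 : 0 ≤ a - c := by linarith
        have h2 : 0 ≤ b - c := by linarith
        simp only [h1, h2, min_eq_right, max_eq_left]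
        have := mul_lt_mul_of_pos_left (sub_lt_sub_right hab c) hk
        linarith
    exact fun {a b} => hm.le_iff_le

theorem bendIso_of_le {c k y : ℝ} (hk : 0 < k) (hy : y ≤ c) : bendIso c k hk y = y := by
  have h' : y - c ≤ 0 := by linarith
  change c + min (y - c) 0 + k * max (y - c) 0 = y
  simp [h']

theorem bendIso_of_ge {c k y : ℝ} (hk : 0 < k) (hy : c ≤ y) :
    bendIso c k hk y = c + k * (y - c) := by
  have h' : 0 ≤ y - c := by linarith
  change c + min (y - c) 0 + k * max (y - c) 0 = _
  simp [h']

/-- A strictly increasing map on a finite set of reals extends to an order automorphism. -/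
theorem exists_orderIso_extend (A : Finset ℝ) (θ : ℝ → ℝ) (hθ : StrictMonoOn θ A) :
    ∃ ψ : ℝ ≃o ℝ, ∀ x ∈ A, ψ x = θ x := by
  induction A using Finset.induction_on_max with
  | empty => exact ⟨OrderIso.refl ℝ, by simp⟩
  | insert m A hm ih =>
    obtain ⟨ψ, hψ⟩ := ih (hθ.mono (by simp))
    rcases A.eq_empty_or_nonempty with rfl | hne
    · exact ⟨OrderIso.addRight (θ m - m), by simp⟩
    · set e := A.max' hne with he
      have heA : e ∈ A := A.max'_mem hne
      have hem : e < m := hm e heA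
      have h1 : θ e < θ m := hθ (by simp [heA]) (by simp) hem
      have h2 : θ e < ψ m := by rw [← hψ e heA]; exact ψ.strictMono hem
      have hk : 0 < (θ m - θ e) / (ψ m - θ e) := div_pos (by linarith) (by linarith)
      refine ⟨ψ.trans (bendIso (θ e) _ hk), fun x hx => ?_⟩
      rw [Finset.mem_insert] at hx
      rcases hx with rfl | hx
      · rw [OrderIso.trans_apply, bendIso_of_ge hk h2.le, div_mul_cancel₀ _ (by linarith)]
        ring
      · rw [OrderIso.trans_apply, bendIso_of_le, hψ x hx]
        rw [← hψ e heA]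
        exact ψ.monotone (A.le_max' x hx)

/-- On the gaps of `Z` where `D` is positive, `F` is increasing and, on unbounded gaps, takes
values of the expected sign. -/
structure IncreasingOnGaps (Z : Finset ℝ) (D F : ℝ → ℝ) : Prop where
  lt : ∀ l u x, l < u → x ∈ Set.Icc l u → x ∉ Z → (∀ z ∈ Z, z ∉ Set.Ioo l u) → 0 < D x → F l < F u
  bot : ∀ x, 0 < D x → (∀ z ∈ Z, x < z) → ∃ l < x, F l < 0
  top : ∀ x, 0 < D x → (∀ z ∈ Z, z < x) → ∃ u > x, 0 < F u

namespace IncreasingOnGaps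

variable {Z : Finset ℝ} {D F G : ℝ → ℝ}

theorem exists_neg_left (hF : IncreasingOnGaps Z D F) (hG : IncreasingOnGaps Z D G)
    (hZ : ∀ z ∈ Z, SignType.sign (F z) = SignType.sign (G z)) {x : ℝ} (hx : x ∉ Z)
    (hD : 0 < D x) (hFx : F x ≤ 0) : ∃ l < x, (∀ z ∈ Z, z ∉ Set.Ioo l x) ∧ G l < 0 := by
  by_cases h : ∃ z ∈ Z, z < x
  · have hne : (Z.filter (· < x)).Nonempty := by
      obtain ⟨z, hz, hzx⟩ := h
      exact ⟨z, by simp [hz, hzx]⟩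
    set e := (Z.filter (· < x)).max' hne with he
    have heZ : e ∈ Z.filter (· < x) := Finset.max'_mem _ _
    rw [Finset.mem_filter] at heZ
    have hgap : ∀ z ∈ Z, z ∉ Set.Ioo e x := fun z hz hzi =>
      absurd (Finset.le_max' (Z.filter (· < x)) z (by simp [hz, hzi.2])) (not_le.2 hzi.1)
    refine ⟨e, heZ.2, hgap, ?_⟩
    have := hF.lt e x x heZ.2 ⟨heZ.2.le, le_rfl⟩ hx hgap hD
    have h1 : F e < 0 := by linarith
    rw [← sign_eq_neg_one_iff, ← hZ e heZ.1, sign_eq_neg_one_iff]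
    exact h1
  · push Not at h
    obtain ⟨l, hl, hGl⟩ := hG.bot x hD fun z hz =>
      lt_of_le_of_ne (h z hz) fun h => hx (h ▸ hz)
    exact ⟨l, hl, fun z hz hzi => absurd (h z hz) (not_le.2 hzi.2), hGl⟩

theorem exists_pos_right (hF : IncreasingOnGaps Z D F) (hG : IncreasingOnGaps Z D G)
    (hZ : ∀ z ∈ Z, SignType.sign (F z) = SignType.sign (G z)) {x : ℝ} (hx : x ∉ Z)
    (hD : 0 < D x) (hFx : 0 ≤ F x) : ∃ u > x, (∀ z ∈ Z, z ∉ Set.Ioo x u) ∧ 0 < G u := by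
  by_cases h : ∃ z ∈ Z, x < z
  · have hne : (Z.filter (x < ·)).Nonempty := by
      obtain ⟨z, hz, hzx⟩ := h
      exact ⟨z, by simp [hz, hzx]⟩
    set e := (Z.filter (x < ·)).min' hne with he
    have heZ : e ∈ Z.filter (x < ·) := Finset.min'_mem _ _
    rw [Finset.mem_filter] at heZ
    have hgap : ∀ z ∈ Z, z ∉ Set.Ioo x e := fun z hz hzi =>
      absurd (Finset.min'_le (Z.filter (x < ·)) z (by simp [hz, hzi.1])) (not_le.2 hzi.2)
    refine ⟨e, heZ.2, hgap, ?_⟩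
    have := hF.lt x e x heZ.2 ⟨le_rfl, heZ.2.le⟩ hx hgap hD
    have h1 : 0 < F e := by linarith
    rw [← sign_eq_one_iff, ← hZ e heZ.1, sign_eq_one_iff]
    exact h1
  · push Not at h
    obtain ⟨l, hl, hGl⟩ := hG.top x hD fun z hz =>
      lt_of_le_of_ne (h z hz) fun h => hx (h ▸ hz)
    exact ⟨l, hl, fun z hz hzi => absurd (h z hz) (not_le.2 hzi.1), hGl⟩

/-- If `F` vanishes inside a gap on which `D` is positive, then so does `G`. -/
theorem exists_root (hF : IncreasingOnGaps Z D F) (hG : IncreasingOnGaps Z D G)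
    (hGc : Continuous G)
    (hZ : ∀ z ∈ Z, SignType.sign (F z) = SignType.sign (G z)) {x : ℝ} (hx : x ∉ Z)
    (hD : 0 < D x) (hFx : F x = 0) : ∃ y, G y = 0 ∧ ∀ z ∈ Z, (z < x ↔ z < y) ∧ (x < z ↔ y < z) := by
  obtain ⟨l, hl, hlZ, hGl⟩ := hF.exists_neg_left hG hZ hx hD hFx.le
  obtain ⟨u, hu, huZ, hGu⟩ := hF.exists_pos_right hG hZ hx hD hFx.ge
  have hu : x < u := hu
  obtain ⟨y, hy, hGy⟩ := intermediate_value_Ioo (hl.trans hu).le hGc.continuousOn ⟨hGl, hGu⟩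
  refine ⟨y, hGy, fun z hz => ?_⟩
  have h1 := hlZ z hz
  have h2 := huZ z hz
  have h3 : z ≠ x := fun h => hx (h ▸ hz)
  simp only [Set.mem_Ioo, not_and, not_lt] at h1 h2 hy
  refine ⟨⟨fun h => ?_, fun h => ?_⟩, ⟨fun h => ?_, fun h => ?_⟩⟩
  · by_contra h4; have := h1 (by linarith); linarith
  · by_contra h4; have := h2 (lt_of_le_of_ne (not_lt.1 h4) h3.symm); linarith
  · by_contra h4; have := h2 (by linarith); linarith
  · by_contra h4; have := h1 (by linarith); exact h3 (le_antisymm (not_lt.1 h4) this)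

end IncreasingOnGaps

namespace IncreasingOnGaps

variable {Z : Finset ℝ} {D F G : ℝ → ℝ}

theorem pos_of_pos (hF : IncreasingOnGaps Z D F) (hG : IncreasingOnGaps Z D G)
    (hFc : Continuous F) (hZ : ∀ z ∈ Z, SignType.sign (F z) = SignType.sign (G z))
    (hDc : ∀ x y, x ∉ Z → (∀ z ∈ Z, (z < x ↔ z < y) ∧ (x < z ↔ y < z)) → 0 < D x → 0 < D y)
    (ψ : ℝ ≃o ℝ) (hψ : ∀ z ∈ Z, ψ z = z) (hψF : ∀ x, x ∉ Z → F x = 0 → G (ψ x) = 0)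
    {x : ℝ} (hx : x ∉ Z) (hD : 0 < D x) (hFx : 0 < F x) : 0 < G (ψ x) := by
  by_contra! hGx
  have hsg : ∀ z ∈ Z, (z < x ↔ z < ψ x) ∧ (x < z ↔ ψ x < z) := fun z hz => by
    conv in (occs := 2) (z < _) => rw [← hψ z hz]
    conv in (occs := 2) (_ < z) => rw [← hψ z hz]
    simp
  have hψx : ψ x ∉ Z := fun h => hx (by rwa [← ψ.injective (hψ _ h)])
  have hDψ := hDc x _ hx hsg hD
  obtain ⟨l, hl, hlZ, hFl⟩ := hG.exists_neg_left hF (fun z hz => (hZ z hz).symm) hψx hDψ hGx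
  have hlx : l < x := by
    by_contra! h
    rcases h.eq_or_lt with rfl | h
    · linarith
    · have := hF.lt x l x h ⟨le_rfl, h.le⟩ hx (fun z hz hzi => by
        have := ((hsg z hz).2.1 hzi.1); linarith [hzi.2]) hD
      linarith
  obtain ⟨t, ht, hFt⟩ := intermediate_value_Ioo hlx.le hFc.continuousOn
    (show (0 : ℝ) ∈ Set.Ioo (F l) (F x) from ⟨hFl, hFx⟩)
  have hlZ' : ∀ z ∈ Z, z ∉ Set.Ioo l x := fun z hz hzi => hlZ z hz ⟨hzi.1, (hsg z hz).1.1 hzi.2⟩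
  have htZ : t ∉ Z := fun h => hlZ' t h ht
  have h1 := hG.lt (ψ t) (ψ x) (ψ x) (ψ.strictMono ht.2) ⟨(ψ.strictMono ht.2).le, le_rfl⟩ hψx
    (fun z hz hzi => by
      rw [← hψ z hz] at hzi
      exact hlZ' z hz ⟨ht.1.trans (ψ.lt_iff_lt.1 hzi.1), ψ.lt_iff_lt.1 hzi.2⟩) hDψ
  rw [hψF t htZ hFt] at h1
  linarith

theorem neg_of_neg (hF : IncreasingOnGaps Z D F) (hG : IncreasingOnGaps Z D G)
    (hFc : Continuous F) (hZ : ∀ z ∈ Z, SignType.sign (F z) = SignType.sign (G z))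
    (hDc : ∀ x y, x ∉ Z → (∀ z ∈ Z, (z < x ↔ z < y) ∧ (x < z ↔ y < z)) → 0 < D x → 0 < D y)
    (ψ : ℝ ≃o ℝ) (hψ : ∀ z ∈ Z, ψ z = z) (hψF : ∀ x, x ∉ Z → F x = 0 → G (ψ x) = 0)
    {x : ℝ} (hx : x ∉ Z) (hD : 0 < D x) (hFx : F x < 0) : G (ψ x) < 0 := by
  by_contra! hGx
  have hsg : ∀ z ∈ Z, (z < x ↔ z < ψ x) ∧ (x < z ↔ ψ x < z) := fun z hz => by
    conv in (occs := 2) (z < _) => rw [← hψ z hz]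
    conv in (occs := 2) (_ < z) => rw [← hψ z hz]
    simp
  have hψx : ψ x ∉ Z := fun h => hx (by rwa [← ψ.injective (hψ _ h)])
  have hDψ := hDc x _ hx hsg hD
  obtain ⟨l, hl, hlZ, hFl⟩ := hG.exists_pos_right hF (fun z hz => (hZ z hz).symm) hψx hDψ hGx
  have hl : ψ x < l := hl
  have hlx : x < l := by
    by_contra! h
    rcases h.eq_or_lt with rfl | h
    · linarith
    · have := hF.lt l x x h ⟨h.le, le_rfl⟩ hx (fun z hz hzi => by
        have := ((hsg z hz).1.1 hzi.2); linarith [hzi.1]) hD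
      linarith
  obtain ⟨t, ht, hFt⟩ := intermediate_value_Ioo hlx.le hFc.continuousOn
    (show (0 : ℝ) ∈ Set.Ioo (F x) (F l) from ⟨hFx, hFl⟩)
  have hlZ' : ∀ z ∈ Z, z ∉ Set.Ioo x l := fun z hz hzi => hlZ z hz ⟨(hsg z hz).2.1 hzi.1, hzi.2⟩
  have htZ : t ∉ Z := fun h => hlZ' t h ht
  have h1 := hG.lt (ψ x) (ψ t) (ψ x) (ψ.strictMono ht.1) ⟨le_rfl, (ψ.strictMono ht.1).le⟩ hψx
    (fun z hz hzi => by
      rw [← hψ z hz] at hzi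
      exact hlZ' z hz ⟨ψ.lt_iff_lt.1 hzi.1, (ψ.lt_iff_lt.1 hzi.2).trans ht.2⟩) hDψ
  rw [hψF t htZ hFt] at h1
  linarith

/-- Two functions with the same monotonicity on the gaps of `Z` and the same signs on `Z` have the
same sign pattern up to an order automorphism fixing `Z`. -/
theorem exists_orderIso (hF : IncreasingOnGaps Z D F) (hG : IncreasingOnGaps Z D G)
    (hF' : IncreasingOnGaps Z (-D) (-F)) (hG' : IncreasingOnGaps Z (-D) (-G))
    (hFc : Continuous F) (hGc : Continuous G)
    (hZ : ∀ z ∈ Z, SignType.sign (F z) = SignType.sign (G z))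
    (hD0 : ∀ x, x ∉ Z → D x ≠ 0)
    (hDc : ∀ x y, x ∉ Z → (∀ z ∈ Z, (z < x ↔ z < y) ∧ (x < z ↔ y < z)) → 0 < D x → 0 < D y)
    (hDc' : ∀ x y, x ∉ Z → (∀ z ∈ Z, (z < x ↔ z < y) ∧ (x < z ↔ y < z)) →
      0 < (-D) x → 0 < (-D) y)
    (hfin : {x | F x = 0 ∧ x ∉ Z}.Finite) :
    ∃ ψ : ℝ ≃o ℝ, (∀ z ∈ Z, ψ z = z) ∧
      ∀ x, SignType.sign (F x) = SignType.sign (G (ψ x)) := by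
  have hZ' : ∀ z ∈ Z, SignType.sign ((-F) z) = SignType.sign ((-G) z) := fun z hz => by
    simp [Left.sign_neg, hZ z hz]
  have key : ∀ x, ∃ y, x ∉ Z → F x = 0 →
      G y = 0 ∧ ∀ z ∈ Z, (z < x ↔ z < y) ∧ (x < z ↔ y < z) := by
    intro x
    by_cases hx : x ∉ Z ∧ F x = 0
    · rcases lt_or_gt_of_ne (hD0 x hx.1) with h | h
      · obtain ⟨y, hy, hyZ⟩ := hF'.exists_root hG' hGc.neg hZ' hx.1 (by simpa using h)
          (by simpa using hx.2)
        exact ⟨y, fun _ _ => ⟨by simpa using hy, hyZ⟩⟩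
      · obtain ⟨y, hy⟩ := hF.exists_root hG hGc hZ hx.1 h hx.2
        exact ⟨y, fun _ _ => hy⟩
    · exact ⟨x, fun h1 h2 => absurd ⟨h1, h2⟩ hx⟩
  choose τ hτ using key
  have huniq : ∀ s t, s < t → s ∉ Z → F s = 0 → F t = 0 → ∃ z ∈ Z, s < z ∧ z < t := by
    intro s t hst hs hFs hFt
    by_contra! h
    have hgap : ∀ z ∈ Z, z ∉ Set.Ioo s t := fun z hz hzi => absurd (h z hz hzi.1) (not_le.2 hzi.2)
    rcases lt_or_gt_of_ne (hD0 s hs) with h | h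
    · have := hF'.lt s t s hst ⟨le_rfl, hst.le⟩ hs hgap (by simpa using h)
      simp [hFs, hFt] at this
    · have := hF.lt s t s hst ⟨le_rfl, hst.le⟩ hs hgap h
      simp [hFs, hFt] at this
  set θ : ℝ → ℝ := fun x => if x ∈ Z then x else τ x with hθ
  have hmono : StrictMonoOn θ (Z ∪ hfin.toFinset : Finset ℝ) := by
    intro s hs t ht hst
    simp only [Finset.coe_union, Set.Finite.coe_toFinset, Set.mem_union, Finset.mem_coe,
      Set.mem_ofPred_eq] at hs ht
    by_cases hsZ : s ∈ Z <;> by_cases htZ : t ∈ Z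
    · simpa [hθ, hsZ, htZ]
    · have ht' : F t = 0 := by tauto
      simpa [hθ, hsZ, htZ] using ((hτ t htZ ht').2 s hsZ).1.1 hst
    · have hs' : F s = 0 := by tauto
      simpa [hθ, hsZ, htZ] using ((hτ s hsZ hs').2 t htZ).2.1 hst
    · have ht' : F t = 0 := by tauto
      have hs' : F s = 0 := by tauto
      obtain ⟨z, hz, h1, h2⟩ := huniq s t hst hsZ hs' ht'
      simpa [hθ, hsZ, htZ] using (((hτ s hsZ hs').2 z hz).2.1 h1).trans
        (((hτ t htZ ht').2 z hz).1.1 h2)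
  obtain ⟨ψ, hψ⟩ := exists_orderIso_extend _ θ hmono
  have hψZ : ∀ z ∈ Z, ψ z = z := fun z hz => by
    rw [hψ z (by simp [hz])]
    simp [hθ, hz]
  have hψF : ∀ x, x ∉ Z → F x = 0 → G (ψ x) = 0 := fun x hx hFx => by
    rw [hψ x (by simp [hx, hFx])]
    simpa [hθ, hx] using (hτ x hx hFx).1
  have hψF' : ∀ x, x ∉ Z → (-F) x = 0 → (-G) (ψ x) = 0 := fun x hx hFx => by
    simpa using hψF x hx (by simpa using hFx)
  refine ⟨ψ, hψZ, fun x => ?_⟩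
  by_cases hx : x ∈ Z
  · rw [hψZ x hx, hZ x hx]
  rcases lt_trichotomy (F x) 0 with h | h | h
  · rw [sign_neg h, eq_comm, sign_eq_neg_one_iff]
    rcases lt_or_gt_of_ne (hD0 x hx) with h' | h'
    · simpa using hF'.pos_of_pos hG' hFc.neg hZ' hDc' ψ hψZ hψF' hx (by simpa using h')
        (by simpa using h)
    · exact hF.neg_of_neg hG hFc hZ hDc ψ hψZ hψF hx h' h
  · rw [h, hψF x hx h]
  · rw [sign_pos h, eq_comm, sign_eq_one_iff]
    rcases lt_or_gt_of_ne (hD0 x hx) with h' | h'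
    · simpa using hF'.neg_of_neg hG' hFc.neg hZ' hDc' ψ hψZ hψF' hx (by simpa using h')
        (by simpa using h)
    · exact hF.pos_of_pos hG hFc hZ hDc ψ hψZ hψF hx h' h

end IncreasingOnGaps

open Polynomial in
theorem Polynomial.increasingOnGaps {Z : Finset ℝ} {D : ℝ → ℝ} (g : ℝ[X]) (φ : ℝ ≃o ℝ)
    (hg : 0 < g.natDegree)
    (hD : ∀ x, SignType.sign (D x) = SignType.sign (g.derivative.eval (φ x)))
    (hZ : ∀ x, D x = 0 → x ∈ Z) : IncreasingOnGaps Z D fun x => g.eval (φ x) := by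
  have hroot : ∀ v, g.derivative.eval (φ v) = 0 → v ∈ Z := fun v hv =>
    hZ v (by rw [← sign_eq_zero_iff, hD, hv, sign_zero])
  have hlt : ∀ l u x, l < u → x ∈ Set.Icc l u → x ∉ Z → (∀ z ∈ Z, z ∉ Set.Ioo l u) → 0 < D x →
      g.eval (φ l) < g.eval (φ u) := by
    intro l u x hlu hx hxZ hgap hDx
    have hDx' : 0 < g.derivative.eval (φ x) := by
      rwa [← sign_eq_one_iff, ← hD, sign_eq_one_iff]
    refine strictMonoOn_of_deriv_pos (convex_Icc (φ l) (φ u)) g.continuous.continuousOn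
      (fun y hy => ?_) ⟨le_rfl, φ.monotone hlu.le⟩ ⟨φ.monotone hlu.le, le_rfl⟩ (φ.strictMono hlu)
    rw [interior_Icc] at hy
    rw [Polynomial.deriv]
    by_contra! hneg
    have hivt := intermediate_value_uIcc (a := y) (b := φ x)
      (g.derivative.continuous.continuousOn)
    obtain ⟨v, hv, hv0⟩ := hivt (Set.mem_uIcc.2 (Or.inl ⟨hneg, hDx'.le⟩))
    obtain ⟨w, rfl⟩ := φ.surjective v
    obtain ⟨y, rfl⟩ := φ.surjective y
    have hwZ := hroot w hv0
    have hwx : w ≠ x := fun h => hxZ (h ▸ hwZ)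
    have hyl := φ.lt_iff_lt.1 hy.1
    have hyu := φ.lt_iff_lt.1 hy.2
    refine hgap w hwZ ?_
    rcases Set.mem_uIcc.1 hv with h | h
    · have h1 := φ.le_iff_le.1 h.1
      have h2 := lt_of_le_of_ne (φ.le_iff_le.1 h.2) hwx
      exact ⟨by linarith, by linarith [hx.2]⟩
    · have h1 := lt_of_le_of_ne (φ.le_iff_le.1 h.1) hwx.symm
      have h2 := φ.le_iff_le.1 h.2
      exact ⟨by linarith [hx.1], by linarith⟩
  refine ⟨hlt, fun x hDx hx => ?_, fun x hDx hx => ?_⟩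
  · have hdeg : 0 < (g.comp (-X)).degree := by
      rw [← natDegree_pos_iff_degree_pos, natDegree_comp]; simpa
    have h1 := (((g.comp (-X)).abs_tendsto_atTop hdeg).eventually_gt_atTop
      |g.eval (φ x)|).and (Filter.eventually_gt_atTop (-(φ x)))
    obtain ⟨y, hy1, hy2⟩ := h1.exists
    obtain ⟨l, hl⟩ := φ.surjective (-y)
    have hlx : l < x := by rw [← φ.lt_iff_lt, hl]; linarith
    refine ⟨l, hlx, ?_⟩
    have h2 := hlt l x x hlx ⟨hlx.le, le_rfl⟩ (fun h => lt_irrefl _ (hx x h))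
      (fun z hz hzi => lt_asymm hzi.2 (hx z hz)) hDx
    rw [eval_comp, eval_neg, eval_X, ← hl] at hy1
    by_contra! h3
    rw [abs_of_nonneg h3, abs_of_nonneg (h3.trans h2.le)] at hy1
    linarith
  · have hdeg : 0 < g.degree := natDegree_pos_iff_degree_pos.1 hg
    have h1 := ((g.abs_tendsto_atTop hdeg).eventually_gt_atTop
      |g.eval (φ x)|).and (Filter.eventually_gt_atTop (φ x))
    obtain ⟨y, hy1, hy2⟩ := h1.exists
    obtain ⟨u, rfl⟩ := φ.surjective y
    have hxu : x < u := by rwa [← φ.lt_iff_lt]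
    refine ⟨u, hxu, ?_⟩
    have h2 := hlt x u x hxu ⟨le_rfl, hxu.le⟩ (fun h => lt_irrefl _ (hx x h))
      (fun z hz hzi => lt_asymm hzi.1 (hx z hz)) hDx
    by_contra! h3
    rw [abs_of_nonpos h3, abs_of_nonpos (h2.le.trans h3)] at hy1
    linarith

open Polynomial in
/-- If the derivatives of `f` and `g` have the same sign pattern through `φ`, and so do `f` and `g`
at the points of a finite set `Z` containing the roots of `f'`, then `φ` can be corrected by an
order automorphism fixing `Z` so that `f` and `g` have the same sign pattern. -/
theorem Polynomial.exists_orderIso_sign (f g : ℝ[X]) (φ : ℝ ≃o ℝ) (Z : Finset ℝ)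
    (hf : 0 < f.natDegree) (hg : 0 < g.natDegree)
    (hD : ∀ x, SignType.sign (f.derivative.eval x) = SignType.sign (g.derivative.eval (φ x)))
    (hZD : ∀ x, f.derivative.eval x = 0 → x ∈ Z)
    (hZ : ∀ z ∈ Z, SignType.sign (f.eval z) = SignType.sign (g.eval (φ z))) :
    ∃ ψ : ℝ ≃o ℝ, (∀ z ∈ Z, ψ z = z) ∧
      ∀ x, SignType.sign (f.eval x) = SignType.sign (g.eval (φ (ψ x))) := by
  have hF := Polynomial.increasingOnGaps (Z := Z) (D := fun x => f.derivative.eval x) f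
    (OrderIso.refl ℝ) hf (fun x => rfl) hZD
  have hF' := Polynomial.increasingOnGaps (Z := Z) (D := -fun x => f.derivative.eval x) (-f)
    (OrderIso.refl ℝ) (by simpa) (fun x => by simp) (fun x hx => hZD x (by simpa using hx))
  have hG := Polynomial.increasingOnGaps (Z := Z) (D := fun x => f.derivative.eval x) g
    φ hg hD hZD
  have hG' := Polynomial.increasingOnGaps (Z := Z) (D := -fun x => f.derivative.eval x) (-g)
    φ (by simpa) (fun x => by simp [Left.sign_neg, hD]) (fun x hx => hZD x (by simpa using hx))
  have hconst : ∀ h : ℝ[X], (∀ x, h.eval x = 0 → x ∈ Z) → ∀ x y, x ∉ Z →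
      (∀ z ∈ Z, (z < x ↔ z < y) ∧ (x < z ↔ y < z)) → 0 < h.eval x → 0 < h.eval y := by
    intro h hroots x y hx hxy hpos
    by_contra! hneg
    obtain ⟨v, hv, hv0⟩ := intermediate_value_uIcc (a := y) (b := x) h.continuous.continuousOn
      (Set.mem_uIcc.2 (Or.inl ⟨hneg, hpos.le⟩))
    have hvZ := hroots v hv0
    have hvx : v ≠ x := fun h => hx (h ▸ hvZ)
    rcases Set.mem_uIcc.1 hv with h | h
    · have h2 := (hxy v hvZ).1.1 (lt_of_le_of_ne h.2 hvx)
      linarith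
    · have h2 := (hxy v hvZ).2.1 (lt_of_le_of_ne h.1 hvx.symm)
      linarith
  refine hF.exists_orderIso hG (by convert hF' using 1; ext; simp)
    (by convert hG' using 1; ext; simp) f.continuous (g.continuous.comp φ.continuous) hZ
    (fun x hx h => hx (hZD x h)) (hconst _ hZD)
    (fun x y hx hxy h => by
      have := hconst (-derivative f) (fun x hx => hZD x (by simpa using hx)) x y hx hxy
        (by simpa using h)
      simpa using this) ?_
  refine (f.roots.toFinset.finite_toSet).subset fun x hx => ?_
  have hf0 : f ≠ 0 := by rintro rfl; simp at hf
  simpa [hf0] using hx.1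

section SignMatching

open Polynomial

variable {R : Type*} [CommRing R]

theorem Polynomial.exists_pseudo_remainder (g : R[X]) (hg : 0 < g.natDegree) (f : R[X]) :
    ∃ (k : ℕ) (b r : R[X]), C g.leadingCoeff ^ k * f = b * g + r ∧ r.natDegree < g.natDegree := by
  induction hn : f.natDegree using Nat.strong_induction_on generalizing f with
  | _ n ih =>
    by_cases hlt : f.natDegree < g.natDegree
    · exact ⟨0, 0, f, by simp, hlt⟩
    · push Not at hlt
      set f₁ := C g.leadingCoeff * f - C f.leadingCoeff * X ^ (f.natDegree - g.natDegree) * g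
        with hf₁
      have h1 : f₁.natDegree ≤ f.natDegree := by
        refine (natDegree_sub_le _ _).trans (max_le (natDegree_C_mul_le _ _) ?_)
        refine natDegree_mul_le.trans ?_
        have := natDegree_C_mul_X_pow_le f.leadingCoeff (f.natDegree - g.natDegree)
        omega
      have h2 : f₁.coeff f.natDegree = 0 := by
        rw [hf₁, coeff_sub, coeff_C_mul, mul_assoc, coeff_C_mul, coeff_X_pow_mul',
          if_pos (Nat.sub_le _ _), Nat.sub_sub_self hlt, coeff_natDegree, coeff_natDegree]
        ring
      have h3 : f₁.natDegree < n := by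
        rcases h1.lt_or_eq with h | h
        · omega
        · have : f₁.leadingCoeff = 0 := by rw [leadingCoeff, h, h2]
          rw [leadingCoeff_eq_zero] at this
          rw [this, natDegree_zero]
          omega
      obtain ⟨k, b, r, h, hr⟩ := ih _ h3 f₁ rfl
      refine ⟨k + 1, C g.leadingCoeff ^ k * (C f.leadingCoeff *
        X ^ (f.natDegree - g.natDegree)) + b, r, ?_, hr⟩
      rw [add_mul, add_assoc, ← h, hf₁]
      ring

theorem Polynomial.exists_even_pseudo_remainder (g f : R[X]) :
    ∃ r : R[X], 0 < g.natDegree →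
      r.natDegree < g.natDegree ∧ ∃ (k : ℕ) (b : R[X]),
        C g.leadingCoeff ^ (2 * k) * f = b * g + r := by
  by_cases hg : 0 < g.natDegree
  · obtain ⟨k, b, r, h, hr⟩ := exists_pseudo_remainder g hg f
    refine ⟨C g.leadingCoeff ^ k * r, fun _ => ⟨?_, k, C g.leadingCoeff ^ k * b, ?_⟩⟩
    · rw [← C_pow]
      exact (natDegree_C_mul_le _ _).trans_lt hr
    · rw [two_mul, pow_add, mul_assoc, h]
      ring
  · exact ⟨0, fun h => absurd h hg⟩

/-- A set of polynomials closed under the operations used to determine sign patterns. -/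
structure SignClosed (P : Finset R[X]) : Prop where
  derivative : ∀ f ∈ P, 0 < f.natDegree → derivative f ∈ P
  eraseLead : ∀ f ∈ P, 0 < f.natDegree → f.eraseLead ∈ P
  leadingCoeff : ∀ f ∈ P, C f.leadingCoeff ∈ P
  remainder : ∀ f ∈ P, ∀ g ∈ P, 0 < g.natDegree → g.natDegree ≤ f.natDegree →
    ∃ r ∈ P, r.natDegree < g.natDegree ∧ ∃ (k : ℕ) (b : R[X]),
        C g.leadingCoeff ^ (2 * k) * f = b * g + r

theorem exists_signClosed (P : Finset R[X]) : ∃ Q : Finset R[X], P ⊆ Q ∧ SignClosed Q := by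
  classical
  choose rem hrem using fun g f : R[X] => exists_even_pseudo_remainder g f
  set N := P.sup natDegree with hN
  have key : ∀ j : ℕ, j ≤ N → ∃ Q : Finset R[X], P ⊆ Q ∧
      (∀ f ∈ Q, f.natDegree ≤ N) ∧
      (∀ f ∈ Q, N < f.natDegree + j → Polynomial.derivative f ∈ Q ∧ f.eraseLead ∈ Q) ∧
      ∀ f ∈ Q, ∀ g ∈ Q, N < g.natDegree + j → g.natDegree ≤ f.natDegree → rem g f ∈ Q := by
    intro j
    induction j with
    | zero =>
      intro _
      have h : ∀ f ∈ P, f.natDegree ≤ N := fun f hf => Finset.le_sup (f := natDegree) hf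
      exact ⟨P, subset_rfl, h, fun f hf h' => absurd (h f hf) (by omega),
        fun f _ g hg h' => absurd (h g hg) (by omega)⟩
    | succ j ih =>
      intro hj
      obtain ⟨Q, hPQ, hQN, hQ1, hQ2⟩ := ih (by omega)
      set T := Q.filter fun f => f.natDegree = N - j with hT
      set Q' := Q ∪ (T.image Polynomial.derivative ∪ T.image Polynomial.eraseLead ∪
        (Q ×ˢ T).image fun p => rem p.2 p.1) with hQ'
      have hnew : ∀ f ∈ Q', f ∈ Q ∨ f.natDegree < N - j := by
        intro f hf
        simp only [hQ', Finset.mem_union, Finset.mem_image, Finset.mem_product, Prod.exists, hT,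
          Finset.mem_filter] at hf
        rcases hf with hf | (⟨h, ⟨-, hh⟩, rfl⟩ | ⟨h, ⟨-, hh⟩, rfl⟩) | ⟨f, g, ⟨-, -, hg⟩, rfl⟩
        · exact Or.inl hf
        · right
          exact (natDegree_derivative_lt (by omega)).trans_le hh.le
        · right
          have := eraseLead_natDegree_le h
          omega
        · right
          have := (hrem g f (by omega)).1
          omega
      have hQQ' : Q ⊆ Q' := Finset.subset_union_left
      refine ⟨Q', hPQ.trans hQQ', fun f hf => ?_, fun f hf hfd => ?_, fun f hf g hg hgd hgf => ?_⟩
      · rcases hnew f hf with h | h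
        · exact hQN f h
        · omega
      · have hfQ : f ∈ Q := (hnew f hf).resolve_right (by omega)
        rcases lt_or_eq_of_le (show N - j ≤ f.natDegree by omega) with h | h
        · have := hQ1 f hfQ (by omega)
          exact ⟨hQQ' this.1, hQQ' this.2⟩
        · have hfT : f ∈ T := by simp [hT, hfQ, h]
          constructor <;> refine Finset.mem_union_right _ (Finset.mem_union_left _ ?_)
          · exact Finset.mem_union_left _ (Finset.mem_image_of_mem _ hfT)
          · exact Finset.mem_union_right _ (Finset.mem_image_of_mem _ hfT)
      · have hgQ : g ∈ Q := (hnew g hg).resolve_right (by omega)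
        have hfQ : f ∈ Q := (hnew f hf).resolve_right (by omega)
        rcases lt_or_eq_of_le (show N - j ≤ g.natDegree by omega) with h | h
        · exact hQQ' (hQ2 f hfQ g hgQ (by omega) hgf)
        · have hgT : g ∈ T := by simp [hT, hgQ, h]
          exact Finset.mem_union_right _ (Finset.mem_union_right _
            (Finset.mem_image.2 ⟨(f, g), Finset.mem_product.2 ⟨hfQ, hgT⟩, rfl⟩))
  obtain ⟨Q, hPQ, -, hQ1, hQ2⟩ := key N le_rfl
  set Q' := Q ∪ Q.image fun f => C f.leadingCoeff with hQ'
  have hQQ' : Q ⊆ Q' := Finset.subset_union_left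
  have hnew : ∀ f ∈ Q', 0 < f.natDegree → f ∈ Q := by
    intro f hf hpos
    rcases Finset.mem_union.1 hf with h | h
    · exact h
    · obtain ⟨g, -, rfl⟩ := Finset.mem_image.1 h
      simp at hpos
  refine ⟨Q', hPQ.trans hQQ', fun f hf h => hQQ' (hQ1 f (hnew f hf h) (by omega)).1,
    fun f hf h => hQQ' (hQ1 f (hnew f hf h) (by omega)).2, fun f hf => ?_,
    fun f hf g hg hpos hgf => ⟨rem g f, hQQ' (hQ2 f (hnew f hf (by omega)) g (hnew g hg hpos)
      (by omega) hgf), hrem g f hpos⟩⟩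
  rcases Finset.mem_union.1 hf with h | h
  · exact Finset.mem_union_right _ (Finset.mem_image_of_mem _ h)
  · obtain ⟨g, hg, rfl⟩ := Finset.mem_image.1 h
    rw [leadingCoeff_C]
    exact hf

theorem Polynomial.sign_eval_orderIso (h : ℝ[X]) (ψ : ℝ ≃o ℝ)
    (hψ : ∀ z, h.eval z = 0 → ψ z = z) (x : ℝ) :
    SignType.sign (h.eval (ψ x)) = SignType.sign (h.eval x) := by
  by_contra hne
  have h0 : (0 : ℝ) ∈ Set.uIcc (h.eval x) (h.eval (ψ x)) := by
    rw [Set.mem_uIcc]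
    rcases lt_trichotomy (h.eval x) 0 with h1 | h1 | h1 <;>
      rcases lt_trichotomy (h.eval (ψ x)) 0 with h2 | h2 | h2 <;>
      first
        | (left; constructor <;> linarith)
        | (right; constructor <;> linarith)
        | simp [h1, h2] at hne
  obtain ⟨v, hv, hv0⟩ := intermediate_value_uIcc h.continuous.continuousOn h0
  have hfix := hψ v hv0
  have hvx : v = x := by
    rcases Set.mem_uIcc.1 hv with h | h
    · have h1 := ψ.monotone h.1
      rw [hfix] at h1
      exact ψ.injective (hfix.trans (le_antisymm h.2 h1))
    · have h1 := ψ.monotone h.2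
      rw [hfix] at h1
      exact ψ.injective (hfix.trans (le_antisymm h1 h.1))
  rw [hvx] at hfix
  exact hne (by rw [hfix])

/-- Two specializations for which all constants of a sign-closed family have the same signs give
families of real polynomials with the same sign pattern. -/
theorem SignClosed.exists_orderIso {P : Finset R[X]} (hP : SignClosed P) (a b : R →+* ℝ)
    (hab : ∀ f ∈ P, f.natDegree = 0 →
      SignType.sign (a (f.coeff 0)) = SignType.sign (b (f.coeff 0))) :
    ∃ φ : ℝ ≃o ℝ, ∀ f ∈ P, ∀ x,
      SignType.sign ((f.map a).eval x) = SignType.sign ((f.map b).eval (φ x)) := by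
  classical
  have hlc : ∀ f ∈ P, SignType.sign (a f.leadingCoeff) = SignType.sign (b f.leadingCoeff) :=
    fun f hf => by simpa using hab _ (hP.leadingCoeff f hf) (natDegree_C _)
  have hlc0 : ∀ f ∈ P, a f.leadingCoeff = 0 ↔ b f.leadingCoeff = 0 := fun f hf => by
    rw [← sign_eq_zero_iff, hlc f hf, sign_eq_zero_iff]
  have herase : ∀ (c : R →+* ℝ) (f : R[X]), c f.leadingCoeff = 0 →
      f.eraseLead.map c = f.map c := fun c f hc => by
    have h := congrArg (Polynomial.map c) f.eraseLead_add_monomial_natDegree_leadingCoeff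
    rw [← h, Polynomial.map_add, map_monomial, hc, monomial_zero_right, add_zero]
  suffices h : ∀ M : Finset R[X], M ⊆ P →
      (∀ f ∈ M, ∀ h ∈ P, h.natDegree < f.natDegree → h ∈ M) →
      ∃ φ : ℝ ≃o ℝ, ∀ f ∈ M, ∀ x,
        SignType.sign ((f.map a).eval x) = SignType.sign ((f.map b).eval (φ x)) from
    h P subset_rfl fun f _ h hh _ => hh
  intro M
  induction hM : M.card generalizing M with
  | zero =>
    intro _ _
    rw [Finset.card_eq_zero] at hM
    exact ⟨OrderIso.refl ℝ, by simp [hM]⟩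
  | succ m ih =>
    intro hMP hdown
    have hne : M.Nonempty := by rw [← Finset.card_pos]; omega
    obtain ⟨f, hfM, hfmax⟩ := M.exists_max_image natDegree hne
    obtain ⟨φ, hφ⟩ := ih (M.erase f) (by rw [Finset.card_erase_of_mem hfM]; omega)
      ((M.erase_subset f).trans hMP) (fun h hh k hk hkh => by
        have hhM := Finset.mem_of_mem_erase hh
        refine Finset.mem_erase.2 ⟨?_, hdown h hhM k hk hkh⟩
        rintro rfl
        exact absurd (hfmax h hhM) (by omega))
    have hfP := hMP hfM
    have hlow : ∀ h ∈ P, h.natDegree < f.natDegree → h ∈ M.erase f := fun h hh hd =>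
      Finset.mem_erase.2 ⟨by rintro rfl; omega, hdown f hfM h hh hd⟩
    suffices hs : ∃ ψ : ℝ ≃o ℝ, (∀ h ∈ M.erase f, ∀ z, h.map a ≠ 0 → (h.map a).eval z = 0 → ψ z = z)
        ∧ ∀ x, SignType.sign ((f.map a).eval x) = SignType.sign ((f.map b).eval (φ (ψ x))) by
      obtain ⟨ψ, hψ, hψf⟩ := hs
      refine ⟨ψ.trans φ, fun h hh x => ?_⟩
      by_cases hhf : h = f
      · rw [hhf]
        exact hψf x
      · have hhM : h ∈ M.erase f := Finset.mem_erase.2 ⟨hhf, hh⟩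
        rw [OrderIso.trans_apply, ← hφ h hhM]
        by_cases h0 : h.map a = 0
        · simp [h0]
        · exact (Polynomial.sign_eval_orderIso _ ψ (fun z hz => hψ h hhM z h0 hz) x).symm
    rcases Nat.eq_zero_or_pos f.natDegree with hdeg | hdeg
    · refine ⟨OrderIso.refl ℝ, fun _ _ _ _ _ => rfl, fun x => ?_⟩
      rw [eq_C_of_natDegree_eq_zero hdeg]
      simpa using hab f hfP hdeg
    by_cases hf0 : a f.leadingCoeff = 0
    · refine ⟨OrderIso.refl ℝ, fun _ _ _ _ _ => rfl, fun x => ?_⟩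
      rw [← herase a f hf0, ← herase b f ((hlc0 f hfP).1 hf0)]
      refine hφ _ (hlow _ (hP.eraseLead f hfP hdeg) ?_) x
      have := eraseLead_natDegree_le f
      omega
    have hfb0 : b f.leadingCoeff ≠ 0 := fun h => hf0 ((hlc0 f hfP).2 h)
    have hdega : (f.map a).natDegree = f.natDegree := natDegree_map_of_leadingCoeff_ne_zero a hf0
    have hdegb : (f.map b).natDegree = f.natDegree := natDegree_map_of_leadingCoeff_ne_zero b hfb0
    have hderM : Polynomial.derivative f ∈ M.erase f :=
      hlow _ (hP.derivative f hfP hdeg) (natDegree_derivative_lt hdeg.ne')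
    have hder0 : (Polynomial.derivative f).map a ≠ 0 := by
      rw [← derivative_map]
      intro h
      have := derivative_eq_zero.1 h
      omega
    set Z : Finset ℝ := (M.erase f).biUnion fun h => (h.map a).roots.toFinset with hZ
    have hmemZ : ∀ h ∈ M.erase f, ∀ z, h.map a ≠ 0 → (h.map a).eval z = 0 → z ∈ Z :=
      fun h hh z h0 hz => Finset.mem_biUnion.2 ⟨h, hh, by simp [h0, hz]⟩
    have hsign : ∀ n, ∀ g ∈ M.erase f, g.natDegree = n → ∀ x, g.map a ≠ 0 → (g.map a).eval x = 0 →
        SignType.sign ((f.map a).eval x) = SignType.sign ((f.map b).eval (φ x)) := by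
      intro n
      induction n using Nat.strong_induction_on with
      | _ n ihn =>
        intro g hgM hgn x hg0 hgx
        have hgM' := Finset.mem_of_mem_erase hgM
        have hgP := hMP hgM'
        rcases Nat.eq_zero_or_pos g.natDegree with hgd | hgd
        · rw [eq_C_of_natDegree_eq_zero hgd] at hgx hg0
          simp at hgx
          simp [hgx] at hg0
        have hgf := hfmax g hgM'
        by_cases hga : a g.leadingCoeff = 0
        · have hlt : g.eraseLead.natDegree < g.natDegree := by
            have := eraseLead_natDegree_le g
            omega
          rw [← herase a g hga] at hg0 hgx
          exact ihn _ (by omega) _ (hlow _ (hP.eraseLead g hgP hgd) (by omega)) rfl x hg0 hgx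
        obtain ⟨r, hrP, hrd, k, c, hr⟩ := hP.remainder f hfP g hgP hgd hgf
        have hrM := hlow r hrP (by omega)
        have hgb : b g.leadingCoeff ≠ 0 := fun h => hga ((hlc0 g hgP).2 h)
        have hgx' : (g.map b).eval (φ x) = 0 := by
          rw [← sign_eq_zero_iff, ← hφ g hgM, hgx, sign_zero]
        have h1 : ∀ (e : R →+* ℝ) (y : ℝ), e g.leadingCoeff ≠ 0 → (g.map e).eval y = 0 →
            SignType.sign ((f.map e).eval y) = SignType.sign ((r.map e).eval y) := by
          intro e y he hy
          have h2 := congrArg (fun p => (p.map e).eval y) hr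
          simp only [Polynomial.map_mul, Polynomial.map_pow, map_C, Polynomial.map_add, eval_mul,
            eval_pow, eval_C, eval_add, hy, mul_zero, zero_add] at h2
          have h3 : 0 < e g.leadingCoeff ^ (2 * k) := by
            rw [pow_mul]
            positivity
          rw [← h2, sign_mul, sign_pos h3, one_mul]
        rw [h1 a x hga hgx, h1 b (φ x) hgb hgx', hφ r hrM]
    obtain ⟨ψ, hψ, hψf⟩ := Polynomial.exists_orderIso_sign (f.map a) (f.map b) φ Z
      (by omega) (by omega)
      (fun x => by rw [derivative_map, derivative_map]; exact hφ _ hderM x)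
      (fun x hx => hmemZ _ hderM x hder0 (by rwa [← derivative_map]))
      (fun z hz => by
        obtain ⟨g, hg, hgz⟩ := Finset.mem_biUnion.1 hz
        have hgz' := Multiset.mem_toFinset.1 hgz
        exact hsign _ g hg rfl z (ne_zero_of_mem_roots hgz') (isRoot_of_mem_roots hgz'))
    exact ⟨ψ, fun h hh z h0 hz => hψ z (hmemZ h hh z h0 hz), hψf⟩

end SignMatching

section SemialgebraicSets

/-- A set whose membership depends only on the signs of finitely many polynomials. -/
def IsSignDetermined {ι : Type*} (S : Set (ι → ℝ)) : Prop :=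
  ∃ Q : Finset (MvPolynomial ι ℝ), ∀ a b : ι → ℝ,
    (∀ q ∈ Q, SignType.sign (MvPolynomial.eval a q) = SignType.sign (MvPolynomial.eval b q)) →
    a ∈ S → b ∈ S

namespace IsSignDetermined

variable {ι κ : Type*} {S T : Set (ι → ℝ)}

theorem compl (hS : IsSignDetermined S) : IsSignDetermined Sᶜ := by
  obtain ⟨Q, hQ⟩ := hS
  exact ⟨Q, fun a b h ha hb => ha (hQ b a (fun q hq => (h q hq).symm) hb)⟩

theorem inter (hS : IsSignDetermined S) (hT : IsSignDetermined T) : IsSignDetermined (S ∩ T) := by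
  classical
  obtain ⟨Q, hQ⟩ := hS
  obtain ⟨Q', hQ'⟩ := hT
  exact ⟨Q ∪ Q', fun a b h ha =>
    ⟨hQ a b (fun q hq => h q (Finset.mem_union_left _ hq)) ha.1,
      hQ' a b (fun q hq => h q (Finset.mem_union_right _ hq)) ha.2⟩⟩

theorem iInter {α : Type*} [Finite α] {S : α → Set (ι → ℝ)} (hS : ∀ i, IsSignDetermined (S i)) :
    IsSignDetermined (⋂ i, S i) := by
  classical
  cases nonempty_fintype α
  choose Q hQ using hS
  exact ⟨Finset.univ.biUnion Q, fun a b h ha => Set.mem_iInter.2 fun i =>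
    hQ i a b (fun q hq => h q (Finset.mem_biUnion.2 ⟨i, Finset.mem_univ i, hq⟩))
      (Set.mem_iInter.1 ha i)⟩

theorem eval_nonneg (p : MvPolynomial ι ℝ) :
    IsSignDetermined {a | 0 ≤ MvPolynomial.eval a p} :=
  ⟨{p}, fun a b h ha => by
    have h1 := h p (by simp)
    rw [Set.mem_ofPred_eq] at ha ⊢
    rw [← sign_nonneg_iff] at ha ⊢
    rwa [← h1]⟩

theorem eval_eq_zero (p : MvPolynomial ι ℝ) :
    IsSignDetermined {a | MvPolynomial.eval a p = 0} :=
  ⟨{p}, fun a b h ha => by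
    have h1 := h p (by simp)
    rw [Set.mem_ofPred_eq] at ha ⊢
    rw [← sign_eq_zero_iff] at ha ⊢
    rwa [← h1]⟩

theorem preimage (hS : IsSignDetermined S) (F : ι → MvPolynomial κ ℝ) :
    IsSignDetermined {a : κ → ℝ | (fun i => MvPolynomial.eval a (F i)) ∈ S} := by
  classical
  obtain ⟨Q, hQ⟩ := hS
  refine ⟨Q.image (MvPolynomial.bind₁ F), fun a b h ha => hQ _ _ (fun q hq => ?_) ha⟩
  have key : ∀ c : κ → ℝ, MvPolynomial.eval c (MvPolynomial.bind₁ F q) =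
      MvPolynomial.eval (fun i => MvPolynomial.eval c (F i)) q := fun c => by
    rw [MvPolynomial.eval, MvPolynomial.eval₂Hom_bind₁]
    rfl
  rw [← key, ← key]
  exact h _ (Finset.mem_image_of_mem _ hq)

theorem comp_preimage (hS : IsSignDetermined S) (e : ι → κ) :
    IsSignDetermined {a : κ → ℝ | a ∘ e ∈ S} := by
  simpa [Function.comp_def] using hS.preimage (fun i => MvPolynomial.X (R := ℝ) (e i))

theorem _root_.MvPolynomial.eval_optionElim (p : MvPolynomial (Option ι) ℝ) (a : ι → ℝ) (y : ℝ) :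
    MvPolynomial.eval (fun o : Option ι => o.elim y a) p =
      (((MvPolynomial.optionEquivLeft ℝ ι) p).map (MvPolynomial.eval a)).eval y := by
  induction p using MvPolynomial.induction_on with
  | C r => simp
  | add p q hp hq => simp [hp, hq]
  | mul_X p i hp => cases i <;> simp [hp]

/-- Quantifier elimination for one variable. -/
theorem exists_option {S : Set (Option ι → ℝ)} (hS : IsSignDetermined S) :
    IsSignDetermined {a : ι → ℝ | ∃ y : ℝ, (fun o : Option ι => o.elim y a) ∈ S} := by
  classical
  obtain ⟨Q, hQ⟩ := hS
  obtain ⟨P, hQP, hP⟩ := exists_signClosed (Q.image (MvPolynomial.optionEquivLeft ℝ ι))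
  refine ⟨P.image fun f => f.coeff 0, ?_⟩
  rintro a b hab ⟨y, hy⟩
  obtain ⟨φ, hφ⟩ := hP.exists_orderIso (MvPolynomial.eval a) (MvPolynomial.eval b)
    fun f hf _ => hab _ (Finset.mem_image_of_mem _ hf)
  refine ⟨φ y, hQ _ _ (fun q hq => ?_) hy⟩
  rw [MvPolynomial.eval_optionElim, MvPolynomial.eval_optionElim]
  exact hφ _ (hQP (Finset.mem_image_of_mem _ hq)) y

/-- Quantifier elimination. -/
theorem exists_sum [Finite κ] {S : Set (ι ⊕ κ → ℝ)} (hS : IsSignDetermined S) :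
    IsSignDetermined {a : ι → ℝ | ∃ b : κ → ℝ, Sum.elim a b ∈ S} := by
  induction κ using Finite.induction_empty_option with
  | @of_equiv κ κ' e ih =>
    convert ih (hS.comp_preimage (Sum.map id e.symm)) using 1
    ext a
    simp only [Set.mem_ofPred_eq]
    constructor
    · rintro ⟨b, hb⟩
      refine ⟨b ∘ e, ?_⟩
      have : Sum.elim a (b ∘ e) ∘ Sum.map id e.symm = Sum.elim a b := by
        ext i; cases i <;> simp
      exact this ▸ hb
    · rintro ⟨b, hb⟩
      refine ⟨b ∘ e.symm, ?_⟩
      have : Sum.elim a b ∘ Sum.map id e.symm = Sum.elim a (b ∘ e.symm) := by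
        ext i; cases i <;> simp
      exact this ▸ hb
  | h_empty =>
    convert hS.comp_preimage (κ := ι) (Sum.elim id PEmpty.elim) using 1
    ext a
    simp only [Set.mem_ofPred_eq]
    have h : ∀ b : PEmpty → ℝ, Sum.elim a b = a ∘ Sum.elim id PEmpty.elim := fun b => by
      ext i
      rcases i with i | i
      · rfl
      · exact i.elim
    exact ⟨fun ⟨b, hb⟩ => h b ▸ hb, fun hb => ⟨PEmpty.elim, (h _).symm ▸ hb⟩⟩
  | @h_option κ _ ih =>
    set e : ι ⊕ Option κ → Option (ι ⊕ κ) := Sum.elim (fun i => some (Sum.inl i))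
      (fun o => o.elim none fun k => some (Sum.inr k)) with he
    have h : ∀ (a : ι → ℝ) (b : κ → ℝ) (y : ℝ),
        (fun o : Option (ι ⊕ κ) => o.elim y (Sum.elim a b)) ∘ e =
          Sum.elim a (fun o => o.elim y b) := by
      intro a b y
      ext i
      rcases i with i | _ | i <;> rfl
    convert ih (hS.comp_preimage e).exists_option using 1
    ext a
    simp only [Set.mem_ofPred_eq]
    constructor
    · rintro ⟨b, hb⟩
      refine ⟨b ∘ some, b none, ?_⟩
      rw [h]
      convert hb using 2
      ext o
      cases o <;> rfl
    · rintro ⟨b, y, hy⟩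
      rw [h] at hy
      exact ⟨_, hy⟩

theorem forall_sum [Finite κ] {S : Set (ι ⊕ κ → ℝ)} (hS : IsSignDetermined S) :
    IsSignDetermined {a : ι → ℝ | ∀ b : κ → ℝ, Sum.elim a b ∈ S} := by
  convert hS.compl.exists_sum.compl using 1
  ext a
  simp

theorem isSemialgebraic (hS : IsSignDetermined S) : IsSemialgebraic S := by
  classical
  obtain ⟨Q, hQ⟩ := hS
  let σ : (ι → ℝ) → Q → SignType := fun a q => SignType.sign (MvPolynomial.eval a q.1)
  let A : Type _ := {τ : Q → SignType // ∃ a ∈ S, σ a = τ}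
  let e : A ≃ Fin (Fintype.card A) := Fintype.equivFin A
  let e' : Q ≃ Fin (Fintype.card Q) := Fintype.equivFin Q
  refine ⟨_, _, fun i => ∑ q : Q, if (e.symm i).1 q = 0 then q.1 ^ 2 else 0,
    fun i j => if (e.symm i).1 (e'.symm j) = 0 then 1 else
      if (e.symm i).1 (e'.symm j) = 1 then (e'.symm j).1 else -(e'.symm j).1, ?_⟩
  have key : ∀ (a : ι → ℝ) (τ : Q → SignType), σ a = τ ↔
      (MvPolynomial.eval a (∑ q : Q, if τ q = 0 then q.1 ^ 2 else 0) = 0 ∧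
        ∀ q : Q, 0 < MvPolynomial.eval a
          (if τ q = 0 then 1 else if τ q = 1 then q.1 else -q.1)) := by
    intro a τ
    have h1 : MvPolynomial.eval a (∑ q : Q, if τ q = 0 then q.1 ^ 2 else 0) = 0 ↔
        ∀ q : Q, τ q = 0 → MvPolynomial.eval a q.1 = 0 := by
      rw [map_sum, Finset.sum_eq_zero_iff_of_nonneg]
      · refine ⟨fun h q hq => ?_, fun h q _ => ?_⟩
        · have := h q (Finset.mem_univ q)
          simpa [hq] using this
        · by_cases hq : τ q = 0
          · simp [hq, h q hq]
          · simp [hq]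
      · intro q _
        split_ifs
        · rw [map_pow]; positivity
        · simp
    rw [h1, funext_iff]
    refine ⟨fun h => ⟨fun q hq => ?_, fun q => ?_⟩, fun h q => ?_⟩
    · rw [← sign_eq_zero_iff]
      exact (h q).trans hq
    · have h2 : SignType.sign (MvPolynomial.eval a q.1) = τ q := h q
      rcases h3 : τ q with _ | _ | _
      · simp
      · rw [h3] at h2
        have : SignType.sign (MvPolynomial.eval a q.1) = -1 := h2
        rw [sign_eq_neg_one_iff] at this
        simpa using this
      · rw [h3] at h2
        have : SignType.sign (MvPolynomial.eval a q.1) = 1 := h2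
        rw [sign_eq_one_iff] at this
        simpa using this
    · have h2 := h.1 q
      have h3 := h.2 q
      change SignType.sign (MvPolynomial.eval a q.1) = τ q
      rcases h4 : τ q with _ | _ | _
      · rw [h2 h4]; simp
      · rw [h4] at h3
        exact sign_eq_neg_one_iff.2 (by simpa using h3)
      · rw [h4] at h3
        exact sign_eq_one_iff.2 (by simpa using h3)
  ext a
  simp only [Set.mem_iUnion]
  constructor
  · intro ha
    refine ⟨e ⟨σ a, a, ha, rfl⟩, ?_⟩
    have h := (key a (σ a)).1 rfl
    refine ⟨?_, fun j => ?_⟩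
    · simpa using h.1
    · simpa using h.2 (e'.symm j)
  · rintro ⟨i, h1, h2⟩
    have h := (key a (e.symm i).1).2 ⟨h1, fun q => by simpa using h2 (e' q)⟩
    obtain ⟨b, hb, hbσ⟩ := (e.symm i).2
    refine hQ b a (fun q hq => ?_) hb
    exact congrFun (hbσ.trans h.symm) ⟨q, hq⟩

end IsSignDetermined

end SemialgebraicSets

section PosSemidef

open scoped MatrixOrder in
theorem Matrix.PosSemidef.exists_conjTranspose_mul_self {n 𝕜 : Type*} [Fintype n] [RCLike 𝕜]
    {A : Matrix n n 𝕜} (hA : A.PosSemidef) : ∃ B : Matrix n n 𝕜, A = Bᴴ * B := by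
  classical
  refine ⟨CFC.sqrt A, ?_⟩
  rw [(CFC.sqrt_nonneg A).posSemidef.isHermitian.eq]
  exact (CFC.sqrt_mul_sqrt_self A hA.nonneg).symm

end PosSemidef

section BlockForm

variable {α β : Type*} [Fintype α] [Fintype β]

/-- The Hermitian form of `C` evaluated at the product vector `v ⊗ w`. -/
noncomputable def blockForm (C : Matrix (α × β) (α × β) ℂ) (v : α → ℂ) (w : β → ℂ) : ℝ :=
  (star (fun p : α × β => v p.1 * w p.2) ⬝ᵥ C *ᵥ fun p : α × β => v p.1 * w p.2).re

theorem trace_kronecker_vecMulVec_mul (C : Matrix (α × β) (α × β) ℂ) (v : α → ℂ) (w : β → ℂ) :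
    ((vecMulVec v (star v) ⊗ₖ vecMulVec w (star w)) * C).trace =
      star (fun p : α × β => v p.1 * w p.2) ⬝ᵥ C *ᵥ fun p : α × β => v p.1 * w p.2 := by
  have h : vecMulVec v (star v) ⊗ₖ vecMulVec w (star w) =
      vecMulVec (fun p : α × β => v p.1 * w p.2) (star fun p : α × β => v p.1 * w p.2) := by
    ext p q
    simp [vecMulVec_apply, kroneckerMap_apply]
    ring
  rw [h, trace_mul_comm, mul_vecMulVec, trace_vecMulVec, dotProduct_comm]

theorem mem_blockPositive_iff {d s : ℕ} {C : Matrix (Fin d × Fin s) (Fin d × Fin s) ℂ} :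
    C ∈ BlockPositive d s ↔ C.IsHermitian ∧ ∀ v w, 0 ≤ blockForm C v w := by
  refine and_congr_right fun hC => ⟨fun h v w => ?_, fun h σ τ hσ hτ => ?_⟩
  · have := h _ _ (posSemidef_vecMulVec_self_star v) (posSemidef_vecMulVec_self_star w)
    rw [trace_kronecker_vecMulVec_mul] at this
    exact (Complex.le_def.1 this).1
  · have key : ∀ {n : ℕ} (ρ : Matrix (Fin n) (Fin n) ℂ), ρ.PosSemidef →
        ∃ B : Fin n → Fin n → ℂ, ρ = ∑ k, vecMulVec (B k) (star (B k)) := by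
      intro n ρ hρ
      obtain ⟨B, hB⟩ := hρ.exists_conjTranspose_mul_self
      refine ⟨fun k i => star (B k i), ?_⟩
      ext i j
      rw [hB, Matrix.sum_apply]
      simp [Matrix.mul_apply, vecMulVec_apply]
    obtain ⟨B, rfl⟩ := key σ hσ
    obtain ⟨B', rfl⟩ := key τ hτ
    have hsum : (∑ k, vecMulVec (B k) (star (B k))) ⊗ₖ (∑ l, vecMulVec (B' l) (star (B' l))) =
        ∑ k, ∑ l, vecMulVec (B k) (star (B k)) ⊗ₖ vecMulVec (B' l) (star (B' l)) := by
      ext p q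
      simp only [kroneckerMap_apply, Matrix.sum_apply, Finset.sum_mul_sum]
    rw [hsum, Finset.sum_mul, trace_sum]
    refine Finset.sum_nonneg fun k _ => ?_
    rw [Finset.sum_mul, trace_sum]
    refine Finset.sum_nonneg fun l _ => ?_
    rw [trace_kronecker_vecMulVec_mul, Complex.le_def]
    exact ⟨h _ _, (hC.im_star_dotProduct_mulVec_self _).symm⟩

end BlockForm

theorem isClosed_blockPositive (d s : ℕ) : IsClosed (BlockPositive d s) := by
  refine IsClosed.inter (s₁ := {C | C.IsHermitian}) (isClosed_eq (by fun_prop) continuous_id)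
    (s₂ := {C | ∀ (σ : Matrix (Fin d) (Fin d) ℂ) (τ : Matrix (Fin s) (Fin s) ℂ),
      σ.PosSemidef → τ.PosSemidef → 0 ≤ ((σ ⊗ₖ τ) * C).trace}) ?_
  simp only [Set.ofPred_forall]
  refine isClosed_iInter fun σ => isClosed_iInter fun τ => isClosed_iInter fun _ =>
    isClosed_iInter fun _ => isClosed_le continuous_const ?_
  fun_prop

theorem add_mem_blockPositive {d s : ℕ} {C D : Matrix (Fin d × Fin s) (Fin d × Fin s) ℂ}
    (hC : C ∈ BlockPositive d s) (hD : D ∈ BlockPositive d s) : C + D ∈ BlockPositive d s := by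
  refine ⟨hC.1.add hD.1, fun σ τ hσ hτ => ?_⟩
  rw [mul_add, trace_add]
  exact add_nonneg (hC.2 σ τ hσ hτ) (hD.2 σ τ hσ hτ)

theorem smul_mem_blockPositive {d s : ℕ} {C : Matrix (Fin d × Fin s) (Fin d × Fin s) ℂ} {c : ℝ}
    (hc : 0 ≤ c) (hC : C ∈ BlockPositive d s) : c • C ∈ BlockPositive d s := by
  refine ⟨?_, fun σ τ hσ hτ => ?_⟩
  · rw [IsHermitian, conjTranspose_smul, hC.1, star_trivial]
  · rw [Matrix.mul_smul, trace_smul]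
    exact smul_nonneg hc (hC.2 σ τ hσ hτ)

theorem convex_blockPositive (d s : ℕ) : Convex ℝ (BlockPositive d s) :=
  fun _ hC _ hD _ _ ha hb _ =>
    add_mem_blockPositive (smul_mem_blockPositive ha hC) (smul_mem_blockPositive hb hD)

section PolynomialFunctions

/-- A complex-valued function whose real and imaginary parts are polynomials. -/
def IsComplexPolynomial {κ : Type*} (f : (κ → ℝ) → ℂ) : Prop :=
  ∃ P Q : MvPolynomial κ ℝ, ∀ a, f a = ⟨MvPolynomial.eval a P, MvPolynomial.eval a Q⟩

namespace IsComplexPolynomial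

variable {κ : Type*} {f g : (κ → ℝ) → ℂ}

theorem mul (hf : IsComplexPolynomial f) (hg : IsComplexPolynomial g) :
    IsComplexPolynomial fun a => f a * g a := by
  obtain ⟨P, Q, h⟩ := hf
  obtain ⟨P', Q', h'⟩ := hg
  exact ⟨P * P' - Q * Q', P * Q' + Q * P', fun a => by simp [h, h', Complex.ext_iff]⟩

theorem star (hf : IsComplexPolynomial f) : IsComplexPolynomial fun a => star (f a) := by
  obtain ⟨P, Q, h⟩ := hf
  exact ⟨P, -Q, fun a => by simp [h, Complex.ext_iff]⟩

theorem sum {γ : Type*} (s : Finset γ) {f : γ → (κ → ℝ) → ℂ}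
    (hf : ∀ i ∈ s, IsComplexPolynomial (f i)) : IsComplexPolynomial fun a => ∑ i ∈ s, f i a := by
  choose! P Q h using hf
  refine ⟨∑ i ∈ s, P i, ∑ i ∈ s, Q i, fun a => ?_⟩
  have h' := Finset.sum_congr rfl fun i hi => h i hi a
  simp [Complex.ext_iff, h']

theorem coord (i j : κ) : IsComplexPolynomial fun a => ⟨a i, a j⟩ :=
  ⟨MvPolynomial.X i, MvPolynomial.X j, fun a => by simp⟩

theorem blockForm {α β : Type*} [Fintype α] [Fintype β]
    {C : (κ → ℝ) → Matrix (α × β) (α × β) ℂ} {v : (κ → ℝ) → α → ℂ} {w : (κ → ℝ) → β → ℂ}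
    (hC : ∀ p q, IsComplexPolynomial fun a => C a p q)
    (hv : ∀ i, IsComplexPolynomial fun a => v a i)
    (hw : ∀ i, IsComplexPolynomial fun a => w a i) :
    ∃ P : MvPolynomial κ ℝ, ∀ a, blockForm (C a) (v a) (w a) = MvPolynomial.eval a P := by
  obtain ⟨P, Q, h⟩ : IsComplexPolynomial fun a => ∑ p, Star.star (v a p.1 * w a p.2) *
      ∑ q, C a p q * (v a q.1 * w a q.2) :=
    sum _ fun p _ => (((hv _).mul (hw _)).star).mul (sum _ fun q _ => (hC p q).mul
      ((hv _).mul (hw _)))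
  refine ⟨P, fun a => ?_⟩
  have := congrArg Complex.re (h a)
  simpa [_root_.blockForm, dotProduct, mulVec] using this

end IsComplexPolynomial

/-- The matrix with given real coordinates. -/
noncomputable def matrixOfCoords {ι : Type*} (a : ι × ι × Bool → ℝ) : Matrix ι ι ℂ :=
  Matrix.of fun i j => ⟨a (i, j, true), a (i, j, false)⟩

theorem matrixOfCoords_matrixCoords {ι : Type*} (C : Matrix ι ι ℂ) :
    matrixOfCoords (matrixCoords C) = C := by
  ext i j
  simp [matrixOfCoords, matrixCoords]

theorem matrixCoords_matrixOfCoords {ι : Type*} (a : ι × ι × Bool → ℝ) :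
    matrixCoords (matrixOfCoords a) = a := by
  ext ⟨i, j, b⟩
  cases b <;> simp [matrixOfCoords, matrixCoords]

theorem isSemialgebraic_blockPositive (d s : ℕ) :
    IsSemialgebraic (matrixCoords '' BlockPositive d s) := by
  refine IsSignDetermined.isSemialgebraic ?_
  have hset : matrixCoords '' BlockPositive d s =
      (⋂ p : Fin d × Fin s, ⋂ q : Fin d × Fin s, {a | MvPolynomial.eval a
        (MvPolynomial.X (p, q, true) - MvPolynomial.X (q, p, true) : MvPolynomial _ ℝ) = 0} ∩
        {a | MvPolynomial.eval a
        (MvPolynomial.X (p, q, false) + MvPolynomial.X (q, p, false) : MvPolynomial _ ℝ) = 0}) ∩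
      {a | ∀ b : (Fin d × Bool) ⊕ (Fin s × Bool) → ℝ, Sum.elim a b ∈
        {c : ((Fin d × Fin s) × (Fin d × Fin s) × Bool) ⊕ ((Fin d × Bool) ⊕ (Fin s × Bool)) → ℝ |
          0 ≤ blockForm (matrixOfCoords (c ∘ Sum.inl))
            (fun i => ⟨c (Sum.inr (Sum.inl (i, true))), c (Sum.inr (Sum.inl (i, false)))⟩)
            (fun i => ⟨c (Sum.inr (Sum.inr (i, true))), c (Sum.inr (Sum.inr (i, false)))⟩)}} := by
    have hherm : ∀ a : (Fin d × Fin s) × (Fin d × Fin s) × Bool → ℝ,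
        (matrixOfCoords a).IsHermitian ↔ ∀ p q, a (p, q, true) - a (q, p, true) = 0 ∧
          a (p, q, false) + a (q, p, false) = 0 := by
      intro a
      rw [IsHermitian, ← Matrix.ext_iff]
      constructor
      · intro h p q
        have := h p q
        simp [matrixOfCoords, Complex.ext_iff] at this
        constructor <;> linarith
      · intro h p q
        have := h p q
        simp [matrixOfCoords, Complex.ext_iff]
        constructor <;> linarith
    ext a
    have h1 : a ∈ matrixCoords '' BlockPositive d s ↔ matrixOfCoords a ∈ BlockPositive d s :=
      ⟨fun ⟨C, hC, hCa⟩ => by rwa [← hCa, matrixOfCoords_matrixCoords],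
        fun h => ⟨_, h, matrixCoords_matrixOfCoords a⟩⟩
    rw [h1, mem_blockPositive_iff, hherm]
    simp only [Set.mem_inter_iff, Set.mem_iInter, Set.mem_ofPred_eq, map_sub, map_add,
      MvPolynomial.eval_X]
    refine and_congr_right fun _ => ⟨fun h b => h _ _, fun h v w => ?_⟩
    have := h (Sum.elim (fun i => if i.2 then (v i.1).re else (v i.1).im)
      (fun i => if i.2 then (w i.1).re else (w i.1).im))
    simpa using this
  rw [hset]
  refine .inter (.iInter fun p => .iInter fun q => .inter (.eval_eq_zero _) (.eval_eq_zero _))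
    (IsSignDetermined.forall_sum ?_)
  obtain ⟨P, hP⟩ := IsComplexPolynomial.blockForm (α := Fin d) (β := Fin s)
    (κ := ((Fin d × Fin s) × (Fin d × Fin s) × Bool) ⊕ ((Fin d × Bool) ⊕ (Fin s × Bool)))
    (C := fun c => matrixOfCoords (c ∘ Sum.inl))
    (v := fun c i => ⟨c (Sum.inr (Sum.inl (i, true))), c (Sum.inr (Sum.inl (i, false)))⟩)
    (w := fun c i => ⟨c (Sum.inr (Sum.inr (i, true))), c (Sum.inr (Sum.inr (i, false)))⟩)
    (fun p q => .coord _ _) (fun i => .coord _ _) (fun i => .coord _ _)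
  simp only [hP]
  exact .eval_nonneg P

end PolynomialFunctions

section AnalyticSelection

open Polynomial Topology

variable {E : Type*} [NormedAddCommGroup E] [NormedSpace ℝ E]

/-- A family of real polynomials of bounded degree whose coefficients are analytic on `V`. -/
structure AnalyticFamily (V : Set E) (p : E → ℝ[X]) : Prop where
  natDegree_le : ∃ N, ∀ ξ ∈ V, (p ξ).natDegree ≤ N
  coeff : ∀ i, AnalyticOnNhd ℝ (fun ξ => (p ξ).coeff i) V

namespace AnalyticFamily

variable {V V' : Set E} {p q : E → ℝ[X]}

theorem mono (hp : AnalyticFamily V p) (h : V' ⊆ V) : AnalyticFamily V' p :=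
  ⟨hp.1.imp fun _ hN ξ hξ => hN ξ (h hξ), fun i => (hp.2 i).mono h⟩

theorem congr (hp : AnalyticFamily V p) (hV : IsOpen V) (h : ∀ ξ ∈ V, p ξ = q ξ) :
    AnalyticFamily V q :=
  ⟨hp.1.imp fun N hN ξ hξ => h ξ hξ ▸ hN ξ hξ,
    fun i => (hp.2 i).congr hV fun ξ hξ => by simp only [h ξ hξ]⟩

theorem eval {E' : Type*} [NormedAddCommGroup E'] [NormedSpace ℝ E'] (hp : AnalyticFamily V p)
    (hV : IsOpen V) {a : E' → E} {y : E' → ℝ} {z : E'} (haz : a z ∈ V) (ha : AnalyticAt ℝ a z)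
    (hy : AnalyticAt ℝ y z) : AnalyticAt ℝ (fun z => (p (a z)).eval (y z)) z := by
  obtain ⟨N, hN⟩ := hp.1
  have h1 : AnalyticAt ℝ (fun z => ∑ i ∈ Finset.range (N + 1), (p (a z)).coeff i * y z ^ i) z := by
    refine Finset.analyticAt_fun_sum _ fun i _ => ?_
    exact ((hp.2 i _ haz).comp ha).mul (hy.pow i)
  refine h1.congr ?_
  filter_upwards [ha.continuousAt.preimage_mem_nhds (hV.mem_nhds haz)] with x hx
  rw [eval_eq_sum_range' (Nat.lt_succ_of_le (hN _ hx))]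

theorem derivative (hp : AnalyticFamily V p) :
    AnalyticFamily V fun ξ => Polynomial.derivative (p ξ) :=
  ⟨hp.1.imp fun N hN ξ hξ => (natDegree_derivative_le _).trans
      ((Nat.sub_le _ _).trans (hN ξ hξ)), fun i => by
    simp only [coeff_derivative]
    exact (hp.2 _).mul analyticOnNhd_const⟩

theorem const_smul (hp : AnalyticFamily V p) {c : E → ℝ} (hc : AnalyticOnNhd ℝ c V) :
    AnalyticFamily V fun ξ => C (c ξ) * p ξ :=
  ⟨hp.1.imp fun _ hN ξ hξ => (natDegree_C_mul_le _ _).trans (hN ξ hξ), fun i => by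
    simp only [coeff_C_mul]
    exact hc.mul (hp.2 i)⟩

theorem modByMonic (hp : AnalyticFamily V p) (hq : AnalyticFamily V q) (hV : IsOpen V) {n : ℕ}
    (hmonic : ∀ ξ ∈ V, (q ξ).Monic) (hn : ∀ ξ ∈ V, (q ξ).natDegree = n) :
    AnalyticFamily V fun ξ => p ξ %ₘ q ξ := by
  obtain ⟨N, hN⟩ := hp.1
  induction N generalizing p with
  | zero =>
    rcases n.eq_zero_or_pos with rfl | hn0
    · have h0 : AnalyticFamily V fun _ => (0 : ℝ[X]) :=
        ⟨⟨0, by simp⟩, fun i => by simpa using analyticOnNhd_const⟩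
      refine h0.congr hV fun ξ hξ => ?_
      rw [(hmonic ξ hξ).natDegree_eq_zero.1 (hn ξ hξ), modByMonic_one]
    · refine hp.congr hV fun ξ hξ => ?_
      rw [eq_comm, modByMonic_eq_self_iff (hmonic ξ hξ)]
      exact degree_lt_degree (by rw [hn ξ hξ]; exact (hN ξ hξ).trans_lt hn0)
  | succ N ih =>
    by_cases hlt : N + 1 < n
    · refine hp.congr hV fun ξ hξ => ?_
      rw [eq_comm, modByMonic_eq_self_iff (hmonic ξ hξ)]
      exact degree_lt_degree (by rw [hn ξ hξ]; exact (hN ξ hξ).trans_lt hlt)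
    push Not at hlt
    set p₁ : E → ℝ[X] := fun ξ => p ξ - C ((p ξ).coeff (N + 1)) * X ^ (N + 1 - n) * q ξ with hp₁
    have hdeg : ∀ ξ ∈ V, (p₁ ξ).natDegree ≤ N := by
      intro ξ hξ
      have h1 : (p₁ ξ).natDegree ≤ N + 1 := by
        refine (natDegree_sub_le _ _).trans (max_le (hN ξ hξ) (natDegree_mul_le.trans ?_))
        have := natDegree_C_mul_X_pow_le ((p ξ).coeff (N + 1)) (N + 1 - n)
        rw [hn ξ hξ]
        omega
      have h2 : (p₁ ξ).coeff (N + 1) = 0 := by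
        have h3 : (q ξ).coeff n = 1 := by rw [← hn ξ hξ]; exact hmonic ξ hξ
        rw [hp₁]
        dsimp only
        rw [coeff_sub, mul_assoc, coeff_C_mul, coeff_X_pow_mul', if_pos (Nat.sub_le _ _),
          Nat.sub_sub_self hlt, h3]
        ring
      rw [natDegree_le_iff_coeff_eq_zero]
      intro M hM
      rcases (Nat.succ_le_of_lt hM).eq_or_lt with h | h
      · rw [← h]; exact h2
      · exact coeff_eq_zero_of_natDegree_lt (h1.trans_lt h)
    have hp₁' : AnalyticFamily V p₁ := by
      refine ⟨⟨N, hdeg⟩, fun i => ?_⟩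
      simp only [hp₁, coeff_sub, mul_assoc, coeff_C_mul, coeff_X_pow_mul']
      refine (hp.2 i).sub ((hp.2 _).mul ?_)
      split_ifs
      · exact hq.2 _
      · exact analyticOnNhd_const
    refine (ih hp₁' hdeg).congr hV fun ξ hξ => ?_
    rw [hp₁]
    dsimp only
    rw [sub_modByMonic, (modByMonic_eq_zero_iff_dvd (hmonic ξ hξ)).2 (dvd_mul_left _ _), sub_zero]

theorem exists_natDegree_eq (hp : AnalyticFamily V p) (hV : IsOpen V) (hne : V.Nonempty) :
    ∃ V' ⊆ V, IsOpen V' ∧ V'.Nonempty ∧ ((∀ ξ ∈ V', p ξ = 0) ∨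
      ∃ n, ∀ ξ ∈ V', p ξ ≠ 0 ∧ (p ξ).natDegree = n) := by
  classical
  by_cases h0 : ∀ ξ ∈ V, p ξ = 0
  · exact ⟨V, subset_rfl, hV, hne, Or.inl h0⟩
  push Not at h0
  obtain ⟨N, hN⟩ := hp.1
  let P : ℕ → Prop := fun n => ∃ ξ ∈ V, p ξ ≠ 0 ∧ (p ξ).natDegree = n
  obtain ⟨ξ₁, hξ₁, h₁⟩ := h0
  have hP : P (Nat.findGreatest P N) :=
    Nat.findGreatest_spec (hN ξ₁ hξ₁) (show P _ from ⟨ξ₁, hξ₁, h₁, rfl⟩)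
  set n := Nat.findGreatest P N with hn
  have hmax : ∀ ξ ∈ V, (p ξ).natDegree ≤ n := fun ξ hξ => by
    by_cases h : p ξ = 0
    · simp [h]
    · exact Nat.le_findGreatest (hN ξ hξ) ⟨ξ, hξ, h, rfl⟩
  obtain ⟨ξ₀, hξ₀, h₀, hd₀⟩ := hP
  have hopen : IsOpen (V ∩ (fun ξ => (p ξ).coeff n) ⁻¹' {0}ᶜ) :=
    (hp.2 n).continuousOn.isOpen_inter_preimage hV isOpen_compl_singleton
  refine ⟨_, Set.inter_subset_left, hopen, ⟨ξ₀, hξ₀, ?_⟩, Or.inr ⟨n, fun ξ hξ => ?_⟩⟩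
  · simpa [← hd₀] using h₀
  · have hc : (p ξ).coeff n ≠ 0 := hξ.2
    exact ⟨fun h => by simp [h] at hc, le_antisymm (hmax ξ hξ.1) (le_natDegree_of_ne_zero hc)⟩

end AnalyticFamily

/-- `F` gives a nonempty fibre `{y | (ξ, y) ∈ F}` for each `ξ`; `q` has dense fibre roots if roots
of `q ξ` lying in the fibre exist for a dense set of `ξ ∈ V`. -/
def DenseFibreRoots (F : Set (E × ℝ)) (V : Set E) (q : E → ℝ[X]) : Prop :=
  ∀ U ⊆ V, IsOpen U → U.Nonempty → ∃ ξ ∈ U, ∃ y, (ξ, y) ∈ F ∧ (q ξ).eval y = 0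

/-- The degrees of monic analytic families on open subsets of `V` with dense fibre roots. -/
def IsFibreDegree (F : Set (E × ℝ)) (V : Set E) (n : ℕ) : Prop :=
  ∃ U ⊆ V, IsOpen U ∧ U.Nonempty ∧ ∃ q : E → ℝ[X], AnalyticFamily U q ∧
    (∀ ξ ∈ U, (q ξ).Monic ∧ (q ξ).natDegree = n) ∧ DenseFibreRoots F U q

theorem AnalyticFamily.exists_eq_zero_or_forall_ne {F : Set (E × ℝ)} {V U : Set E} {p : E → ℝ[X]}
    (hp : AnalyticFamily U p) (hUV : U ⊆ V) (hU : IsOpen U) (hne : U.Nonempty)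
    (hdeg : ∀ ξ ∈ U, ¬ IsFibreDegree F V (p ξ).natDegree) :
    ∃ U' ⊆ U, IsOpen U' ∧ U'.Nonempty ∧ ((∀ ξ ∈ U', p ξ = 0) ∨
      ∀ ξ ∈ U', ∀ y, (ξ, y) ∈ F → (p ξ).eval y ≠ 0) := by
  obtain ⟨U₁, hU₁, ho₁, hne₁, h | ⟨n, hn⟩⟩ := hp.exists_natDegree_eq hU hne
  · exact ⟨U₁, hU₁, ho₁, hne₁, Or.inl h⟩
  have hlc : ∀ ξ ∈ U₁, (p ξ).coeff n ≠ 0 := fun ξ hξ => by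
    rw [← (hn ξ hξ).2]
    simpa using (hn ξ hξ).1
  have hq : AnalyticFamily U₁ fun ξ => C ((p ξ).coeff n)⁻¹ * p ξ :=
    (hp.mono hU₁).const_smul (((hp.mono hU₁).2 n).inv hlc)
  by_cases hd : DenseFibreRoots F U₁ fun ξ => C ((p ξ).coeff n)⁻¹ * p ξ
  · obtain ⟨ξ, hξ⟩ := hne₁
    refine absurd ⟨U₁, hU₁.trans hUV, ho₁, ⟨ξ, hξ⟩, _, hq, fun ζ hζ => ⟨?_, ?_⟩, hd⟩
      (hdeg ξ (hU₁ hξ))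
    · rw [Monic, leadingCoeff_mul, leadingCoeff_C, leadingCoeff, (hn ζ hζ).2,
        inv_mul_cancel₀ (hlc ζ hζ)]
    · rw [natDegree_C_mul (inv_ne_zero (hlc ζ hζ)), (hn ζ hζ).2, (hn ξ hξ).2]
  · rw [DenseFibreRoots] at hd
    push Not at hd
    obtain ⟨U₂, hU₂, ho₂, hne₂, h⟩ := hd
    refine ⟨U₂, hU₂.trans hU₁, ho₂, hne₂, Or.inr fun ξ hξ y hy h0 => h ξ hξ y hy ?_⟩
    simp [h0]

theorem AnalyticFamily.exists_forall_eq_zero_or_forall_ne {F : Set (E × ℝ)} {V U : Set E}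
    {γ : Type*} (G : Finset γ) {p : γ → E → ℝ[X]}
    (hp : ∀ i ∈ G, AnalyticFamily U (p i)) (hUV : U ⊆ V) (hU : IsOpen U) (hne : U.Nonempty)
    (hdeg : ∀ i ∈ G, ∀ ξ ∈ U, ¬ IsFibreDegree F V (p i ξ).natDegree) :
    ∃ U' ⊆ U, IsOpen U' ∧ U'.Nonempty ∧ ∀ i ∈ G, ((∀ ξ ∈ U', p i ξ = 0) ∨
      ∀ ξ ∈ U', ∀ y, (ξ, y) ∈ F → (p i ξ).eval y ≠ 0) := by
  classical
  induction G using Finset.induction_on with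
  | empty => exact ⟨U, subset_rfl, hU, hne, by simp⟩
  | insert i G _ ih =>
    obtain ⟨U₁, hU₁, ho₁, hne₁, h₁⟩ := ih (fun j hj => hp j (Finset.mem_insert_of_mem hj))
      fun j hj => hdeg j (Finset.mem_insert_of_mem hj)
    obtain ⟨U₂, hU₂, ho₂, hne₂, h₂⟩ :=
      ((hp i (Finset.mem_insert_self _ _)).mono hU₁).exists_eq_zero_or_forall_ne
        (hU₁.trans hUV) ho₁ hne₁ fun ξ hξ => hdeg i (Finset.mem_insert_self _ _) ξ (hU₁ hξ)
    refine ⟨U₂, hU₂.trans hU₁, ho₂, hne₂, fun j hj => ?_⟩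
    rcases Finset.mem_insert.1 hj with rfl | hj
    · exact h₂
    · exact (h₁ j hj).imp (fun h ξ hξ => h ξ (hU₂ hξ)) fun h ξ hξ => h ξ (hU₂ hξ)

theorem sign_eventually_eq_of_analyticAt {f : E → ℝ} {x : E} (hf : AnalyticAt ℝ f x)
    (hx : f x ≠ 0) : ∀ᶠ z in 𝓝 x, SignType.sign (f z) = SignType.sign (f x) := by
  rcases lt_or_gt_of_ne hx with h | h
  · filter_upwards [hf.continuousAt.eventually_lt_const h] with z hz
    rw [sign_neg h, sign_neg hz]
  · filter_upwards [hf.continuousAt.eventually_const_lt h] with z hz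
    rw [sign_pos h, sign_pos hz]

/-- Analytic root through a simple root. -/
theorem AnalyticFamily.exists_root [CompleteSpace E] {V : Set E} {q : E → ℝ[X]}
    (hq : AnalyticFamily V q) (hV : IsOpen V) {ξ₀ : E} (hξ₀ : ξ₀ ∈ V) {y₀ : ℝ}
    (h0 : (q ξ₀).eval y₀ = 0) (h1 : (Polynomial.derivative (q ξ₀)).eval y₀ ≠ 0) :
    ∃ y : E → ℝ, AnalyticAt ℝ y ξ₀ ∧ y ξ₀ = y₀ ∧ ∀ᶠ ξ in 𝓝 ξ₀, (q ξ).eval (y ξ) = 0 := by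
  have han : AnalyticAt ℝ (fun z : E × ℝ => (q z.1).eval z.2) (ξ₀, y₀) :=
    hq.eval hV (a := Prod.fst) (y := Prod.snd) hξ₀ analyticAt_fst analyticAt_snd
  have cdf : ContDiffAt ℝ ⊤ (fun z : E × ℝ => (q z.1).eval z.2) (ξ₀, y₀) := han.contDiffAt
  set L := fderiv ℝ (fun z : E × ℝ => (q z.1).eval z.2) (ξ₀, y₀) ∘L .inr ℝ E ℝ with hL
  have hd : HasFDerivAt (fun y : ℝ => (q ξ₀).eval y) L y₀ := by
    have h2 := han.differentiableAt.hasFDerivAt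
    have h3 : HasFDerivAt (fun y : ℝ => (ξ₀, y)) (ContinuousLinearMap.inr ℝ E ℝ) y₀ :=
      hasFDerivAt_prodMk_right ξ₀ y₀
    exact HasFDerivAt.comp y₀ (f := fun y : ℝ => (ξ₀, y)) h2 h3
  have hL1 : L 1 = (Polynomial.derivative (q ξ₀)).eval y₀ :=
    hd.hasDerivAt.unique ((q ξ₀).hasDerivAt y₀)
  have hinv : L.IsInvertible := by
    refine ⟨ContinuousLinearEquiv.unitsEquivAut ℝ (Units.mk0 _ h1), ?_⟩
    ext
    simp [hL1]
  refine ⟨cdf.implicitFunction (by simp) hinv, ?_, cdf.implicitFunction_apply_self _ hinv, ?_⟩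
  · exact (cdf.contDiffAt_implicitFunction (by simp) hinv).analyticAt
  · filter_upwards [cdf.eventually_apply_implicitFunction (by simp) hinv] with ξ hξ
    simpa [h0] using hξ

/-- One-variable analytic selection from a set described by signs of an analytic family. -/
theorem exists_analytic_selection [CompleteSpace E] {γ : Type*} (G : Finset γ)
    {g : γ → E → ℝ[X]} {F : Set (E × ℝ)} {V : Set E} (hV : IsOpen V) (hne : V.Nonempty)
    (hg : ∀ i ∈ G, AnalyticFamily V (g i))
    (hF : ∀ ξ ∈ V, ∀ ζ ∈ V, ∀ y z, (∀ i ∈ G, SignType.sign ((g i ξ).eval y) =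
      SignType.sign ((g i ζ).eval z)) → (ξ, y) ∈ F → (ζ, z) ∈ F)
    (hfib : ∀ ξ ∈ V, ∃ y, (ξ, y) ∈ F) :
    ∃ U ⊆ V, IsOpen U ∧ U.Nonempty ∧ ∃ y : E → ℝ, AnalyticOnNhd ℝ y U ∧
      ∀ ξ ∈ U, (ξ, y ξ) ∈ F := by
  classical
  suffices h : ∃ ξ₀ ∈ V, ∃ y : E → ℝ, AnalyticAt ℝ y ξ₀ ∧ (ξ₀, y ξ₀) ∈ F ∧
      ∀ i ∈ G, ∀ᶠ ξ in 𝓝 ξ₀, SignType.sign ((g i ξ).eval (y ξ)) =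
        SignType.sign ((g i ξ₀).eval (y ξ₀)) by
    obtain ⟨ξ₀, hξ₀, y, hy, hyF, hev⟩ := h
    have h1 : ∀ᶠ ξ in 𝓝 ξ₀, (ξ ∈ V ∧ AnalyticAt ℝ y ξ) ∧ ∀ i ∈ G,
        SignType.sign ((g i ξ).eval (y ξ)) = SignType.sign ((g i ξ₀).eval (y ξ₀)) :=
      ((hV.eventually_mem hξ₀).and hy.eventually_analyticAt).and
        ((Filter.eventually_all_finset G).2 hev)
    obtain ⟨U, hU, hUo, hξU⟩ := eventually_nhds_iff.1 h1
    exact ⟨U, fun ξ hξ => (hU ξ hξ).1.1, hUo, ⟨ξ₀, hξU⟩, y, fun ξ hξ => (hU ξ hξ).1.2,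
      fun ξ hξ => hF ξ₀ hξ₀ ξ (hU ξ hξ).1.1 _ _ (fun i hi => ((hU ξ hξ).2 i hi).symm) hyF⟩
  by_cases hex : ∃ n, IsFibreDegree F V n
  · obtain ⟨U, hUV, hUo, hUne, q, hq, hqm, hqd⟩ := Nat.find_spec hex
    have hmin : ∀ m < Nat.find hex, ¬ IsFibreDegree F V m := fun m hm => Nat.find_min hex hm
    set n := Nat.find hex with hn
    have hn0 : 0 < n := by
      rw [Nat.pos_iff_ne_zero]
      intro h0
      obtain ⟨ξ, hξ, y, -, hy⟩ := hqd U subset_rfl hUo hUne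
      rw [(hqm ξ hξ).1.natDegree_eq_zero.1 ((hqm ξ hξ).2.trans h0)] at hy
      simp at hy
    obtain ⟨U₁, hU₁, ho₁, hne₁, hder⟩ := hq.derivative.exists_eq_zero_or_forall_ne (F := F) hUV hUo
      hUne fun ξ hξ => hmin _ (by
        rw [← (hqm ξ hξ).2]
        exact natDegree_derivative_lt (by rw [(hqm ξ hξ).2]; omega))
    have hmod : ∀ i ∈ G, AnalyticFamily U₁ fun ξ => g i ξ %ₘ q ξ := fun i hi =>
      ((hg i hi).mono (hU₁.trans hUV)).modByMonic (hq.mono hU₁) ho₁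
        (fun ξ hξ => (hqm ξ (hU₁ hξ)).1) fun ξ hξ => (hqm ξ (hU₁ hξ)).2
    obtain ⟨U₂, hU₂, ho₂, hne₂, hrem⟩ :=
      AnalyticFamily.exists_forall_eq_zero_or_forall_ne (F := F) G hmod (hU₁.trans hUV) ho₁ hne₁
      fun i hi ξ hξ => hmin _ (by
        have h1 := hqm ξ (hU₁ hξ)
        rw [← h1.2]
        refine natDegree_modByMonic_lt _ h1.1 ?_
        intro h
        rw [h] at h1
        simp at h1
        omega)
    obtain ⟨ξ₀, hξ₀, y₀, hF₀, hq₀⟩ := hqd U₂ (hU₂.trans hU₁) ho₂ hne₂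
    have hder' : (Polynomial.derivative (q ξ₀)).eval y₀ ≠ 0 := by
      rcases hder with h | h
      · have h1 := h ξ₀ (hU₂ hξ₀)
        have h2 := derivative_eq_zero.1 h1
        have h3 := (hqm ξ₀ (hU₁ (hU₂ hξ₀))).2
        omega
      · exact h ξ₀ (hU₂ hξ₀) y₀ hF₀
    obtain ⟨y, hy, hy₀, hyq⟩ := hq.exists_root hUo (hU₁ (hU₂ hξ₀)) hq₀ hder'
    have hξV := hUV (hU₁ (hU₂ hξ₀))
    refine ⟨ξ₀, hξV, y, hy, by rwa [hy₀], fun i hi => ?_⟩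
    have hdiv : ∀ ξ ∈ U₂, ∀ z, (q ξ).eval z = 0 → (g i ξ).eval z = (g i ξ %ₘ q ξ).eval z := by
      intro ξ hξ z hz
      conv_lhs => rw [← modByMonic_add_div (g i ξ) (q ξ)]
      simp [hz]
    rcases hrem i hi with h | h
    · filter_upwards [hyq, ho₂.mem_nhds hξ₀] with ξ h1 h2
      rw [hdiv ξ h2 _ h1, hdiv ξ₀ hξ₀ _ (by rwa [hy₀]), h ξ h2, h ξ₀ hξ₀]
      simp
    · refine sign_eventually_eq_of_analyticAt (f := fun ξ => (g i ξ).eval (y ξ))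
        ((hg i hi).eval hV (a := id) hξV analyticAt_id hy) ?_
      rw [hy₀, hdiv ξ₀ hξ₀ _ hq₀]
      exact h ξ₀ hξ₀ y₀ hF₀
  · push Not at hex
    obtain ⟨U, hUV, ho, ⟨ξ₀, hξ₀⟩, h⟩ :=
      AnalyticFamily.exists_forall_eq_zero_or_forall_ne (F := F) G hg subset_rfl hV hne
        fun i _ ξ _ => hex _
    obtain ⟨y₀, hy₀⟩ := hfib ξ₀ (hUV hξ₀)
    refine ⟨ξ₀, hUV hξ₀, fun _ => y₀, analyticAt_const, hy₀, fun i hi => ?_⟩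
    rcases h i hi with h | h
    · filter_upwards [ho.mem_nhds hξ₀] with ξ h1
      rw [h ξ h1, h ξ₀ hξ₀]
    · exact sign_eventually_eq_of_analyticAt (f := fun ξ => (g i ξ).eval y₀)
        ((hg i hi).eval hV (a := id) (hUV hξ₀) analyticAt_id analyticAt_const) (h ξ₀ hξ₀ y₀ hy₀)

end AnalyticSelection

section MultivariateSelection

open Polynomial Topology

theorem MvPolynomial.analyticOnNhd_eval {E σ : Type*} [NormedAddCommGroup E] [NormedSpace ℝ E]
    {V : Set E} (p : MvPolynomial σ ℝ) {w : E → σ → ℝ}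
    (hw : ∀ i, AnalyticOnNhd ℝ (fun ξ => w ξ i) V) :
    AnalyticOnNhd ℝ (fun ξ => MvPolynomial.eval (w ξ) p) V := by
  induction p using MvPolynomial.induction_on with
  | C r => simpa using analyticOnNhd_const
  | add p q hp hq =>
    simp only [map_add]
    exact hp.add hq
  | mul_X p i hp =>
    simp only [map_mul, MvPolynomial.eval_X]
    exact hp.mul (hw i)

theorem analyticFamily_map_eval {E σ : Type*} [NormedAddCommGroup E] [NormedSpace ℝ E]
    {V : Set E} (f : Polynomial (MvPolynomial σ ℝ)) {w : E → σ → ℝ}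
    (hw : ∀ i, AnalyticOnNhd ℝ (fun ξ => w ξ i) V) :
    AnalyticFamily V fun ξ => f.map (MvPolynomial.eval (w ξ)) :=
  ⟨⟨f.natDegree, fun _ _ => natDegree_map_le⟩, fun i => by
    simpa using (f.coeff i).analyticOnNhd_eval hw⟩

/-- A sign-determined set with nonempty fibres over a nonempty open set admits, over a smaller
nonempty open set, an analytic selection. -/
theorem IsSignDetermined.exists_analytic_selection {ι κ : Type*} [Fintype ι] [Finite κ]
    {F : Set (ι ⊕ κ → ℝ)} (hF : IsSignDetermined F) {V : Set (ι → ℝ)} (hV : IsOpen V)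
    (hne : V.Nonempty) (hfib : ∀ a ∈ V, ∃ b : κ → ℝ, Sum.elim a b ∈ F) :
    ∃ U ⊆ V, IsOpen U ∧ U.Nonempty ∧ ∃ b : (ι → ℝ) → κ → ℝ,
      (∀ k, AnalyticOnNhd ℝ (fun a => b a k) U) ∧ ∀ a ∈ U, Sum.elim a (b a) ∈ F := by
  classical
  induction κ using Finite.induction_empty_option with
  | @of_equiv κ κ' e ih =>
    have h : ∀ (a : ι → ℝ) (b : κ → ℝ),
        Sum.elim a b ∘ Sum.map id e.symm = Sum.elim a (b ∘ e.symm) := by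
      intro a b
      ext i
      cases i <;> simp
    obtain ⟨U, hUV, ho, hne, b, hb, hbF⟩ := ih (hF.comp_preimage (Sum.map id e.symm))
      fun a ha => by
        obtain ⟨b, hb⟩ := hfib a ha
        refine ⟨b ∘ e, ?_⟩
        rw [Set.mem_ofPred_eq, h]
        convert hb using 2
        ext i
        simp
    refine ⟨U, hUV, ho, hne, fun a => b a ∘ e.symm, fun k => hb (e.symm k), fun a ha => ?_⟩
    rw [← h]
    exact hbF a ha
  | h_empty => exact ⟨V, subset_rfl, hV, hne, fun _ => PEmpty.elim, fun k => k.elim, fun a ha => by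
      obtain ⟨b, hb⟩ := hfib a ha
      convert hb using 2
      ext i
      exact i.elim⟩
  | @h_option κ _ ih =>
    set e : ι ⊕ Option κ → Option (ι ⊕ κ) := Sum.elim (fun i => some (Sum.inl i))
      (fun o => o.elim none fun k => some (Sum.inr k)) with he
    have h : ∀ (a : ι → ℝ) (b : κ → ℝ) (y : ℝ),
        (fun o : Option (ι ⊕ κ) => o.elim y (Sum.elim a b)) ∘ e =
          Sum.elim a (fun o => o.elim y b) := by
      intro a b y
      ext i
      rcases i with i | _ | i <;> rfl
    have hF' := hF.comp_preimage e
    obtain ⟨U, hUV, ho, hne, b, hb, hbF⟩ := ih hF'.exists_option fun a ha => by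
      obtain ⟨b, hb⟩ := hfib a ha
      refine ⟨b ∘ some, b none, ?_⟩
      rw [Set.mem_ofPred_eq, h]
      convert hb using 2
      ext o
      cases o <;> rfl
    obtain ⟨Q, hQ⟩ := hF'
    have hw : ∀ i, AnalyticOnNhd ℝ (fun a => Sum.elim a (b a) i) U := by
      rintro (i | k)
      · exact (ContinuousLinearMap.proj (R := ℝ) (φ := fun _ : ι => ℝ) i).analyticOnNhd _
      · exact hb k
    obtain ⟨U', hU', ho', hne', y, hy, hyF⟩ := _root_.exists_analytic_selection Q
      (g := fun q a => (MvPolynomial.optionEquivLeft ℝ _ q).map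
        (MvPolynomial.eval (Sum.elim a (b a))))
      (F := {p | (fun o : Option (ι ⊕ κ) => o.elim p.2 (Sum.elim p.1 (b p.1))) ∈
        {a | a ∘ e ∈ F}}) ho hne
      (fun q _ => analyticFamily_map_eval _ hw)
      (fun ξ _ ζ _ y z hs hm => hQ _ _ (fun q hq => by
        rw [MvPolynomial.eval_optionElim, MvPolynomial.eval_optionElim]
        exact hs q hq) hm)
      (fun ξ hξ => hbF ξ hξ)
    refine ⟨U', hU'.trans hUV, ho', hne', fun a o => o.elim (y a) (b a), ?_, fun a ha => ?_⟩
    · rintro (_ | k)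
      · exact hy
      · exact (hb k).mono hU'
    · rw [← h]
      exact hyF a ha

end MultivariateSelection

section PositiveFunctionals


theorem exists_nonneg_extension {D E : Type*} [AddCommGroup D] [Module ℝ D] [AddCommGroup E]
    [Module ℝ E] (s : PointedCone ℝ E) (T : D →ₗ[ℝ] E) (f : D →ₗ[ℝ] ℝ)
    (nonneg : ∀ d, T d ∈ s → 0 ≤ f d) (dense : ∀ y, ∃ d, T d + y ∈ s) :
    ∃ g : E →ₗ[ℝ] ℝ, (∀ d, g (T d) = f d) ∧ ∀ y ∈ s, 0 ≤ g y := by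
  obtain ⟨h, hh⟩ := T.rangeRestrict.exists_rightInverse_of_surjective T.range_rangeRestrict
  have hT : ∀ x : T.range, T (h x) = x := fun x =>
    congrArg Subtype.val (LinearMap.congr_fun hh x)
  have hker : ∀ d, T d = 0 → f d = 0 := fun d hd => le_antisymm
    (by
      have := nonneg (-d) (by rw [map_neg, hd, neg_zero]; exact s.zero_mem)
      rw [map_neg] at this
      linarith) (nonneg d (by rw [hd]; exact s.zero_mem))
  obtain ⟨g, hg, hgs⟩ := riesz_extension s ⟨T.range, f ∘ₗ h⟩
    (fun x hx => nonneg _ (by rw [hT]; exact hx))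
    (fun y => (dense y).imp' (fun d => ⟨T d, d, rfl⟩) fun d hd => hd)
  refine ⟨g, fun d => ?_, hgs⟩
  have h1 := hg ⟨T d, d, rfl⟩
  have h2 := hker (h ⟨T d, d, rfl⟩ - d) (by rw [map_sub, hT, sub_self])
  rw [map_sub, sub_eq_zero] at h2
  exact h1.trans h2

theorem Matrix.exists_mul_mul_eq_self {m n : Type*} [Fintype m] [Fintype n] (B : Matrix m n ℝ) :
    ∃ C : Matrix n m ℝ, B * C * B = B := by
  classical
  obtain ⟨h, hh⟩ := (toLin' B).rangeRestrict.exists_rightInverse_of_surjective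
    (toLin' B).range_rangeRestrict
  obtain ⟨h', hh'⟩ := h.exists_extend
  refine ⟨LinearMap.toMatrix' h', ?_⟩
  apply toLin'.injective
  ext1 v
  ext1
  simp only [toLin'_mul, toLin'_toMatrix', LinearMap.comp_apply, LinearMap.coe_single]
  have h1 : h' (toLin' B (Pi.single v 1)) = h ⟨toLin' B (Pi.single v 1), _, rfl⟩ :=
    LinearMap.congr_fun hh' ⟨toLin' B (Pi.single v 1), _, rfl⟩
  rw [h1]
  exact congrArg Subtype.val (LinearMap.congr_fun hh ⟨toLin' B (Pi.single v 1), _, rfl⟩)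

theorem Matrix.neg_le_dotProduct_mulVec {n : Type*} [Fintype n] (M : Matrix n n ℝ) (u : n → ℝ) :
    -((∑ i, ∑ j, |M i j|) * (u ⬝ᵥ u)) ≤ u ⬝ᵥ M *ᵥ u := by
  have hu : ∀ i, u i * u i ≤ u ⬝ᵥ u := fun i =>
    Finset.single_le_sum (f := fun i => u i * u i) (fun i _ => mul_self_nonneg _)
      (Finset.mem_univ i)
  have h1 : u ⬝ᵥ M *ᵥ u = ∑ i, ∑ j, M i j * (u i * u j) := by
    simp only [dotProduct, mulVec, Finset.mul_sum]
    exact Finset.sum_congr rfl fun i _ => Finset.sum_congr rfl fun j _ => by ring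
  rw [h1]
  generalize u ⬝ᵥ u = S at hu
  rw [Finset.sum_mul, ← Finset.sum_neg_distrib]
  refine Finset.sum_le_sum fun i _ => ?_
  rw [Finset.sum_mul, ← Finset.sum_neg_distrib]
  refine Finset.sum_le_sum fun j _ => ?_
  have h1 : |u i * u j| ≤ S := by
    rw [abs_le]
    constructor <;> nlinarith [hu i, hu j, sq_nonneg (u i + u j), sq_nonneg (u i - u j)]
  have h2 := neg_abs_le (M i j * (u i * u j))
  rw [abs_mul] at h2
  nlinarith [mul_le_mul_of_nonneg_left h1 (abs_nonneg (M i j))]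

variable {τ W : Type*} [Fintype τ] [AddCommGroup W] [Module ℝ W] [FiniteDimensional ℝ W]

/-- A linear functional nonnegative on a spectrahedron is a sum of a positive functional of the
defining matrix and a nonnegative constant. No regularity of the pencil is assumed. -/
theorem exists_posSemidef_certificate (A : ℝ × W →ₗ[ℝ] Matrix τ τ ℝ)
    (f : ℝ × W →ₗ[ℝ] ℝ) (hA : ∀ d, (A d).IsHermitian)
    (hf : ∀ z, (A (1, z)).PosSemidef → 0 ≤ f (1, z)) :
    ∃ H : Matrix τ τ ℝ, H.PosSemidef ∧ ∃ c : ℝ, 0 ≤ c ∧ ∀ z, (A (1, z)).PosSemidef →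
      f (1, z) = ∑ s, ∑ t, H s t * A (1, z) s t + c := by
  classical
  by_cases hne : ∃ z, (A (1, z)).PosSemidef
  swap
  · push Not at hne
    exact ⟨0, PosSemidef.zero, 0, le_rfl, fun z hz => absurd hz (hne z)⟩
  obtain ⟨z₀, hz₀⟩ := hne
  set Z : Set (ℝ × W) := {d | d.1 = 1 ∧ (A d).PosSemidef} with hZ
  obtain ⟨b, hbZ, hb⟩ := (Submodule.fg_span_iff_fg_span_finset_subset Z).1
    (IsNoetherian.noetherian (Submodule.span ℝ Z))
  set D := Submodule.span ℝ Z with hD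
  set p : ℝ × W := (1, z₀) + ∑ d ∈ b, d with hp
  have hpD : p ∈ D := D.add_mem (Submodule.subset_span ⟨rfl, hz₀⟩)
    (D.sum_mem fun d hd => Submodule.subset_span (hbZ hd))
  have hp1 : 1 ≤ p.1 := by
    have : ∑ d ∈ b, d.1 = b.card := by
      rw [Finset.sum_congr rfl fun d hd => (hbZ hd).1]
      simp
    simp [hp, Prod.fst_sum, this]
  have hbs : (∑ d ∈ b, A d).PosSemidef := posSemidef_sum _ fun d hd => (hbZ hd).2
  have hP : (A p).PosSemidef := by
    rw [hp, map_add, map_sum]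
    exact hz₀.add hbs
  have hker : ∀ v, A p *ᵥ v = 0 → ∀ d ∈ D, A d *ᵥ v = 0 := by
    intro v hv d hd
    rw [hb] at hd
    induction hd using Submodule.span_induction with
    | mem d hd =>
      have hd' := (hbZ hd).2
      rw [← hd'.dotProduct_mulVec_zero_iff]
      have h1 : star v ⬝ᵥ A p *ᵥ v = 0 := by simp [hv]
      rw [hp, map_add, map_sum, ← Finset.add_sum_erase b _ hd, add_mulVec, add_mulVec,
        dotProduct_add, dotProduct_add] at h1
      have h2 := hz₀.dotProduct_mulVec_nonneg v
      have h3 := hd'.dotProduct_mulVec_nonneg v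
      have h4 := (posSemidef_sum (b.erase d) fun d hd =>
        (hbZ (Finset.mem_of_mem_erase hd)).2).dotProduct_mulVec_nonneg v
      linarith
    | zero => simp
    | add x y _ _ hx hy => rw [map_add, add_mulVec, hx, hy, add_zero]
    | smul c x _ hx => rw [map_smul, smul_mulVec, hx, smul_zero]
  obtain ⟨B, hB⟩ := hP.exists_conjTranspose_mul_self
  obtain ⟨C, hC⟩ := B.exists_mul_mul_eq_self
  rw [conjTranspose_eq_transpose_of_trivial] at hB
  have hright : ∀ d ∈ D, A d * (C * B) = A d := by
    intro d hd
    rw [← sub_eq_zero]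
    apply toLin'.injective
    apply LinearMap.ext
    intro v
    have h1 := hker ((C * B) *ᵥ v - v) (by
      rw [hB, mulVec_sub, mulVec_mulVec, Matrix.mul_assoc, ← Matrix.mul_assoc B C B, hC, sub_self])
      d hd
    rw [mulVec_sub, mulVec_mulVec] at h1
    simpa [sub_mulVec] using h1
  have hleft : ∀ d ∈ D, (C * B)ᵀ * A d * (C * B) = A d := by
    intro d hd
    rw [Matrix.mul_assoc, hright d hd]
    have h1 := congrArg transpose (hright d hd)
    have h2 : (A d)ᵀ = A d := by
      rw [← conjTranspose_eq_transpose_of_trivial]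
      exact hA d
    rwa [transpose_mul, h2] at h1
  let s : PointedCone ℝ (Matrix τ τ ℝ × ℝ) :=
    { carrier := {y | 0 ≤ y.2 ∧ ∀ u, 0 ≤ u ⬝ᵥ ((C * B)ᵀ * y.1 * (C * B)) *ᵥ u}
      zero_mem' := by simp
      add_mem' := fun {x y} hx hy => ⟨add_nonneg hx.1 hy.1, fun u => by
        rw [Prod.fst_add, Matrix.mul_add, Matrix.add_mul, add_mulVec, dotProduct_add]
        exact add_nonneg (hx.2 u) (hy.2 u)⟩
      smul_mem' := fun c x hx => ⟨mul_nonneg c.2 hx.1, fun u => by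
        have h1 := mul_nonneg c.2 (hx.2 u)
        change 0 ≤ u ⬝ᵥ ((C * B)ᵀ * ((c : ℝ) • x.1) * (C * B)) *ᵥ u
        rwa [Matrix.mul_smul, Matrix.smul_mul, smul_mulVec, dotProduct_smul]⟩ }
  let T : D →ₗ[ℝ] Matrix τ τ ℝ × ℝ := (A.prod (LinearMap.fst ℝ ℝ W)).comp D.subtype
  have hT : ∀ d : D, T d = (A d, (d : ℝ × W).1) := fun _ => rfl
  obtain ⟨g, hg, hgs⟩ := exists_nonneg_extension s T (f.comp D.subtype)
    (by
      rintro ⟨d, hd⟩ ⟨h0, h1⟩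
      simp only [LinearMap.comp_apply, Submodule.subtype_apply, hT, hleft d hd] at h0 h1 ⊢
      have hdP : (A d).PosSemidef := .of_dotProduct_mulVec_nonneg (hA d) h1
      rcases h0.eq_or_lt with h0 | h0
      · have h2 : ∀ t : ℝ, 0 ≤ t → 0 ≤ f (1, z₀) + t * f d := by
          intro t ht
          have h3 : ((1 : ℝ), z₀) + t • d = (1, z₀ + t • d.2) := by
            ext
            · simp [← h0]
            · simp
          have h4 := hf (z₀ + t • d.2) (by
            rw [← h3, map_add, map_smul]
            exact hz₀.add (hdP.smul ht))
          rwa [← h3, map_add, map_smul] at h4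
        by_contra! hneg
        have h3 := h2 ((f (1, z₀) + 1) / (- f d))
          (div_nonneg (by linarith [hf z₀ hz₀]) (by linarith))
        have h4 : (f (1, z₀) + 1) / (- f d) * f d = - (f (1, z₀) + 1) := by
          have := hneg.ne
          field_simp
        linarith
      · have h3 : d = d.1 • ((1 : ℝ), d.1⁻¹ • d.2) := by
          ext
          · simp
          · simp [smul_smul, mul_inv_cancel₀ h0.ne']
        have h4 : d.1⁻¹ • d = ((1 : ℝ), d.1⁻¹ • d.2) := by
          ext
          · simp [h0.ne']
          · simp
        rw [h3, map_smul]
        refine mul_nonneg h0.le (hf _ ?_)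
        rw [← h4, map_smul]
        exact hdP.smul (inv_nonneg.2 h0.le))
    (by
      rintro ⟨M, r⟩
      set l := (∑ i, ∑ j, |(Cᵀ * M * C) i j|) + |r| with hl
      have hl0 : 0 ≤ ∑ i, ∑ j, |(Cᵀ * M * C) i j| :=
        Finset.sum_nonneg fun i _ => Finset.sum_nonneg fun j _ => abs_nonneg _
      refine ⟨⟨l • p, D.smul_mem _ hpD⟩, ?_, fun u => ?_⟩
      · simp only [hT, Prod.snd_add, Prod.smul_fst, smul_eq_mul]
        nlinarith [neg_abs_le r, abs_nonneg r]
      · simp only [hT, Prod.fst_add]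
        have h1 : (C * B)ᵀ * (A (l • p) + M) * (C * B) = l • (Bᵀ * B) + Bᵀ * (Cᵀ * M * C) * B := by
          rw [Matrix.mul_add, Matrix.add_mul, hleft _ (D.smul_mem _ hpD), map_smul, hB,
            transpose_mul]
          simp only [Matrix.mul_assoc]
        have h2 := (Cᵀ * M * C).neg_le_dotProduct_mulVec (B *ᵥ u)
        have h3 : u ⬝ᵥ (Bᵀ * (Cᵀ * M * C) * B) *ᵥ u =
            (B *ᵥ u) ⬝ᵥ (Cᵀ * M * C) *ᵥ (B *ᵥ u) := by
          rw [← mulVec_mulVec, ← mulVec_mulVec, dotProduct_mulVec u Bᵀ, vecMul_transpose]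
        have h4 : u ⬝ᵥ (Bᵀ * B) *ᵥ u = (B *ᵥ u) ⬝ᵥ (B *ᵥ u) := by
          rw [← mulVec_mulVec, dotProduct_mulVec u Bᵀ, vecMul_transpose]
        have h5 : 0 ≤ (B *ᵥ u) ⬝ᵥ (B *ᵥ u) := Finset.sum_nonneg fun i _ => mul_self_nonneg _
        rw [h1, add_mulVec, dotProduct_add, smul_mulVec, dotProduct_smul, h3, h4, smul_eq_mul]
        nlinarith [abs_nonneg r, mul_nonneg (abs_nonneg r) h5])
  have hpsd : ∀ u : τ → ℝ, 0 ≤ g (vecMulVec u u, 0) := fun u => hgs _ ⟨le_rfl, fun v => by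
    rw [mul_vecMulVec, vecMulVec_mul, vecMulVec_mulVec, mulVec_transpose, ← dotProduct_mulVec,
      op_smul_eq_smul, dotProduct_smul, dotProduct_comm v, ← dotProduct_mulVec, smul_eq_mul]
    exact mul_self_nonneg _⟩
  have hsum : ∀ M : Matrix τ τ ℝ, g (M, 0) = ∑ s, ∑ t, M s t * g (single s t 1, 0) := by
    intro M
    have h1 := congrArg (fun N => g.comp (LinearMap.inl ℝ (Matrix τ τ ℝ) ℝ) N)
      (matrix_eq_sum_single M)
    simp only [LinearMap.comp_apply, LinearMap.inl_apply, map_sum] at h1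
    rw [h1]
    refine Finset.sum_congr rfl fun s _ => Finset.sum_congr rfl fun t _ => ?_
    have h2 : (single s t (M s t), (0 : ℝ)) = M s t • (single s t (1 : ℝ), (0 : ℝ)) := by
      ext <;> simp
    rw [h2, map_smul, smul_eq_mul]
  have hsymm : ∀ M : Matrix τ τ ℝ, (∀ s t, M s t = M t s) → g (M, 0) =
      ∑ s, ∑ t, (g (single s t 1, 0) + g (single t s 1, 0)) / 2 * M s t := by
    intro M hM
    have h1 : g (M, 0) = ∑ s, ∑ t, M s t * g (single t s 1, 0) := by
      rw [hsum, Finset.sum_comm]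
      exact Finset.sum_congr rfl fun s _ => Finset.sum_congr rfl fun t _ => by rw [hM]
    have h2 : g (M, 0) = (g (M, 0) + g (M, 0)) / 2 := by ring
    rw [h2]
    nth_rewrite 1 [hsum]
    rw [h1, ← Finset.sum_add_distrib, Finset.sum_div]
    refine Finset.sum_congr rfl fun s _ => ?_
    rw [← Finset.sum_add_distrib, Finset.sum_div]
    exact Finset.sum_congr rfl fun t _ => by ring
  refine ⟨of fun s t => (g (single s t 1, 0) + g (single t s 1, 0)) / 2,
    .of_dotProduct_mulVec_nonneg ?_ fun u => ?_, g (0, 1), hgs _ ⟨zero_le_one, by simp⟩,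
    fun z hz => ?_⟩
  · ext s t
    simp [add_comm]
  · refine (hpsd u).trans_eq ?_
    rw [hsymm _ fun s t => by simp [vecMulVec_apply, mul_comm]]
    simp only [dotProduct, mulVec, Finset.mul_sum, vecMulVec_apply, star_trivial, of_apply]
    exact Finset.sum_congr rfl fun s _ => Finset.sum_congr rfl fun t _ => by ring
  · have h1 := hg ⟨(1, z), Submodule.subset_span ⟨rfl, hz⟩⟩
    simp only [LinearMap.comp_apply, Submodule.subtype_apply, hT] at h1
    have h2 : (A (1, z), (1 : ℝ)) = (A (1, z), 0) + (0, 1) := by simp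
    rw [← h1, h2, map_add, hsymm _ fun s t => by
      have := (hA (1, z)).apply s t
      simpa using this.symm]
    simp

end PositiveFunctionals

section AnalyticCertificates

open scoped ComplexOrder

/-- The real matrix, of twice the size, of the Hermitian form of a complex matrix. -/
def Matrix.realify (m : Type*) : Matrix m m ℂ →ₗ[ℝ] Matrix (m ⊕ m) (m ⊕ m) ℝ where
  toFun M := fromBlocks (M.map Complex.re) (-M.map Complex.im) (M.map Complex.im)
    (M.map Complex.re)
  map_add' M N := by
    ext (i | i) (j | j) <;> simp [add_comm]
  map_smul' c M := by
    ext (i | i) (j | j) <;> simp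

theorem Matrix.IsHermitian.realify {m : Type*} {M : Matrix m m ℂ} (hM : M.IsHermitian) :
    (M.realify m).IsHermitian := by
  ext i j
  rcases i with i | i <;> rcases j with j | j <;>
    simp [Matrix.realify, ← hM.apply i j]

theorem Matrix.re_star_dotProduct_mulVec {m : Type*} [Fintype m] (M : Matrix m m ℂ)
    (u : m ⊕ m → ℝ) :
    (star (fun i => (⟨u (Sum.inl i), u (Sum.inr i)⟩ : ℂ)) ⬝ᵥ
      M *ᵥ fun i => (⟨u (Sum.inl i), u (Sum.inr i)⟩ : ℂ)).re = u ⬝ᵥ (M.realify m) *ᵥ u := by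
  simp only [dotProduct, mulVec, Fintype.sum_sum_type, Finset.mul_sum, Complex.re_sum,
    Matrix.realify, LinearMap.coe_mk, AddHom.coe_mk, fromBlocks_apply₁₁, fromBlocks_apply₁₂,
    fromBlocks_apply₂₁, fromBlocks_apply₂₂, ← Finset.sum_add_distrib]
  refine Finset.sum_congr rfl fun i _ => Finset.sum_congr rfl fun j _ => ?_
  simp
  ring

theorem Matrix.IsHermitian.posSemidef_realify_iff {m : Type*} [Fintype m] {M : Matrix m m ℂ}
    (hM : M.IsHermitian) : (M.realify m).PosSemidef ↔ M.PosSemidef := by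
  simp only [posSemidef_iff_dotProduct_mulVec, hM, hM.realify, true_and]
  constructor
  · intro h v
    rw [Complex.nonneg_iff]
    refine ⟨?_, (hM.im_star_dotProduct_mulVec_self v).symm⟩
    have h1 := M.re_star_dotProduct_mulVec (Sum.elim (fun i => (v i).re) (fun i => (v i).im))
    simp only [Sum.elim_inl, Sum.elim_inr, Complex.eta] at h1
    rw [h1]
    exact h _
  · intro h u
    rw [star_trivial, ← M.re_star_dotProduct_mulVec]
    exact (Complex.nonneg_iff.1 (h _)).1

/-- The coefficients expressing the pairing of two Gram matrices as a sum of squares. -/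
def gramCertificate {τ : Type*} [DecidableEq τ] (B : Matrix τ τ ℝ) :
    Option (τ × τ) → τ × τ ⊕ Unit → ℝ :=
  fun k j => k.elim (j.elim (fun _ => 0) fun _ => 1) fun q =>
    j.elim (fun r => if r.1 = q.1 then B q.2 r.2 else 0) fun _ => 0

theorem sum_gramCertificate {τ : Type*} [Fintype τ] [DecidableEq τ] (B : Matrix τ τ ℝ)
    (y : τ × τ ⊕ Unit → ℝ) :
    ∑ k, (∑ j, gramCertificate B k j * y j) ^ 2 =
      ∑ s, ∑ t, (∑ r, y (Sum.inl (r, s)) * y (Sum.inl (r, t))) * (Bᴴ * B) s t +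
        y (Sum.inr ()) ^ 2 := by
  have h1 : ∀ q : τ × τ, ∑ j, gramCertificate B (some q) j * y j =
      ∑ s, B q.2 s * y (Sum.inl (q.1, s)) := fun q => by
    simp [gramCertificate, Fintype.sum_prod_type_right]
  have h2 : ∑ j, gramCertificate B none j * y j = y (Sum.inr ()) := by
    simp [gramCertificate]
  rw [Fintype.sum_option, h2, add_comm]
  congr 1
  simp only [h1, pow_two, Finset.sum_mul_sum, mul_apply, conjTranspose_apply, star_trivial,
    Fintype.sum_prod_type]
  calc _ = ∑ s, ∑ r, ∑ q, ∑ t, B q s * y (Sum.inl (r, s)) * (B q t * y (Sum.inl (r, t))) := by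
        rw [Finset.sum_comm_cycle]
    _ = _ := by
        refine Finset.sum_congr rfl fun s _ => ?_
        rw [Finset.sum_comm_cycle]
        refine Finset.sum_congr rfl fun t _ => Finset.sum_congr rfl fun r _ =>
          Finset.sum_congr rfl fun q _ => ?_
        ring

/-- Polynomial functionals which are nonnegative on a spectrahedral shadow are, over some
nonempty open set of parameters, sums of squares of linear combinations of a fixed finite family of
analytic functions. -/
theorem IsSpectrahedralShadow.exists_analytic_certificate {V : Type*} [AddCommGroup V]
    [Module ℝ V] {S : Set V} (hS : IsSpectrahedralShadow S) {ι : Type*} [Fintype ι]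
    (ev : (ι → ℝ) → V →ₗ[ℝ] ℝ)
    (hpoly : ∀ C, ∃ p : MvPolynomial ι ℝ, ∀ x, ev x C = MvPolynomial.eval x p)
    (hnn : ∀ C ∈ S, ∀ x, 0 ≤ ev x C) :
    ∃ (J K : Type) (_ : Fintype J) (_ : Fintype K) (U : Set (ι → ℝ)), IsOpen U ∧ U.Nonempty ∧
      ∃ f : J → (ι → ℝ) → ℝ, (∀ j, AnalyticOnNhd ℝ (f j) U) ∧
        ∀ C ∈ S, ∃ c : K → J → ℝ, ∀ x ∈ U, ev x C = ∑ k, (∑ j, c k j * f j x) ^ 2 := by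
  classical
  obtain ⟨n, m, A₀, A, L, hA₀, hA, rfl⟩ := hS
  choose p hp using hpoly
  let A' : ℝ × (Fin n → ℝ) →ₗ[ℝ] Matrix (Fin m) (Fin m) ℂ :=
    (LinearMap.fst ℝ ℝ (Fin n → ℝ)).smulRight A₀ +
      ∑ i, ((LinearMap.proj i).comp (LinearMap.snd ℝ ℝ (Fin n → ℝ))).smulRight (A i)
  have hA' : ∀ d, A' d = d.1 • A₀ + ∑ i, d.2 i • A i := fun d => by simp [A']
  have hA'h : ∀ d, (A' d).IsHermitian := fun d => by
    rw [hA']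
    refine IsHermitian.add ?_ ?_
    · rw [IsHermitian, conjTranspose_smul, hA₀.eq, star_trivial]
    · rw [IsHermitian, conjTranspose_sum]
      exact Finset.sum_congr rfl fun i _ => by rw [conjTranspose_smul, (hA i).eq, star_trivial]
  let R : ℝ × (Fin n → ℝ) →ₗ[ℝ] Matrix (Fin m ⊕ Fin m) (Fin m ⊕ Fin m) ℝ :=
    (Matrix.realify (Fin m)).comp A'
  have hR : ∀ d, (R d).PosSemidef ↔ (A' d).PosSemidef := fun d => (hA'h d).posSemidef_realify_iff
  have hRz : ∀ z, (R (1, z)).PosSemidef ↔ (A₀ + ∑ i, z i • A i).PosSemidef := fun z => by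
    rw [hR, hA', one_smul]
  set Z : Set (ℝ × (Fin n → ℝ)) := {d | d.1 = 1 ∧ (R d).PosSemidef} with hZ
  obtain ⟨b, hbZ, hb⟩ := (Submodule.fg_span_iff_fg_span_finset_subset Z).1
    (IsNoetherian.noetherian (Submodule.span ℝ Z))
  let P : ℝ × (Fin n → ℝ) →
      MvPolynomial (ι ⊕ ((Fin m ⊕ Fin m) × (Fin m ⊕ Fin m) ⊕ Unit)) ℝ := fun d =>
    MvPolynomial.rename Sum.inl (p (L d.2)) -
      (∑ s, ∑ t, (∑ r, MvPolynomial.X (Sum.inr (Sum.inl (r, s))) *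
        MvPolynomial.X (Sum.inr (Sum.inl (r, t)))) * MvPolynomial.C (R d s t) +
        MvPolynomial.X (Sum.inr (Sum.inr ())) ^ 2)
  have hP : ∀ d x y, MvPolynomial.eval (Sum.elim x y) (P d) = ev x (L d.2) -
      (∑ s, ∑ t, (∑ r, y (Sum.inl (r, s)) * y (Sum.inl (r, t))) * R d s t +
        y (Sum.inr ()) ^ 2) := by
    intro d x y
    simp [P, MvPolynomial.eval_rename, hp, -Fintype.sum_sum_type]
  have hF : IsSignDetermined (⋂ d : b, {a | MvPolynomial.eval a (P d) = 0}) :=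
    .iInter fun d => .eval_eq_zero _
  obtain ⟨U, -, hU, hUne, y, hy, hyF⟩ := hF.exists_analytic_selection isOpen_univ
    Set.univ_nonempty fun x _ => by
      obtain ⟨H, hH, c, hc, h⟩ := exists_posSemidef_certificate R
        (((ev x).comp L).comp (LinearMap.snd ℝ ℝ (Fin n → ℝ))) (fun d => (hA'h d).realify)
        fun z hz => hnn _ ⟨z, (hRz z).1 hz, rfl⟩ x
      obtain ⟨B, hB⟩ := hH.exists_conjTranspose_mul_self
      refine ⟨Sum.elim (fun q => B q.1 q.2) fun _ => √c, Set.mem_iInter.2 ?_⟩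
      rintro ⟨⟨d₁, d₂⟩, hd⟩
      obtain ⟨rfl : d₁ = 1, hd⟩ := hbZ hd
      have h1 := h d₂ hd
      simp only [LinearMap.comp_apply, LinearMap.snd_apply] at h1
      rw [Set.mem_ofPred_eq, hP, h1, hB, sub_eq_zero]
      simp [mul_apply, Real.sq_sqrt hc, -Fintype.sum_sum_type]
  refine ⟨(Fin m ⊕ Fin m) × (Fin m ⊕ Fin m) ⊕ Unit,
    Option ((Fin m ⊕ Fin m) × (Fin m ⊕ Fin m)), inferInstance, inferInstance, U, hU, hUne,
    fun j x => y x j, hy, ?_⟩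
  rintro _ ⟨z, hz, rfl⟩
  have hz' := (hRz z).2 hz
  have key : ∀ x ∈ U, ∀ d ∈ Submodule.span ℝ Z, ev x (L d.2) =
      ∑ s, ∑ t, (∑ r, y x (Sum.inl (r, s)) * y x (Sum.inl (r, t))) * R d s t +
        y x (Sum.inr ()) ^ 2 * d.1 := by
    intro x hx d hd
    rw [hb] at hd
    induction hd using Submodule.span_induction with
    | mem d hd =>
      have h1 := Set.mem_iInter.1 (hyF x hx) ⟨d, hd⟩
      rw [Set.mem_ofPred_eq, hP, sub_eq_zero] at h1
      rw [h1, (hbZ hd).1, mul_one]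
    | zero => simp
    | add d e _ _ hd he =>
      simp only [Prod.snd_add, Prod.fst_add, map_add, hd, he, Matrix.add_apply, mul_add,
        Finset.sum_add_distrib]
      ring
    | smul c d _ hd =>
      simp only [Prod.smul_snd, Prod.smul_fst, map_smul, hd, Matrix.smul_apply, smul_eq_mul, mul_add,
        Finset.mul_sum]
      congr 1
      · refine Finset.sum_congr rfl fun s _ => Finset.sum_congr rfl fun t _ => ?_
        ring
      · ring
  obtain ⟨B, hB⟩ := hz'.exists_conjTranspose_mul_self
  refine ⟨gramCertificate B, fun x hx => ?_⟩
  have h1 := key x hx (1, z) (Submodule.subset_span ⟨rfl, hz'⟩)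
  rw [h1, hB, sum_gramCertificate, mul_one]

end AnalyticCertificates

section Zoom

open Filter Topology

/-- A sequence of linear maps into the homogeneous polynomials of degree `n = 0, 1, 2, …` admits
a system of vectors, generating modulo the common kernel, whose leading forms are linearly
independent. -/
theorem exists_linearIndependent_leadingForms {V ι : Type*} [AddCommGroup V] [Module ℝ V]
    [FiniteDimensional ℝ V] (Λ : ℕ → V →ₗ[ℝ] MvPolynomial ι ℝ)
    (hΛ : ∀ n v, (Λ n v).IsHomogeneous n) (W : Submodule ℝ V) :
    ∃ (I : Type) (_ : Fintype I) (b : I → V) (d : I → ℕ),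
      (∀ i, b i ∈ W) ∧ (∀ i, ∀ m < d i, Λ m (b i) = 0) ∧
      LinearIndependent ℝ (fun i => Λ (d i) (b i)) ∧
      ∀ w ∈ W, ∃ a : I → ℝ, ∀ n, Λ n (w - ∑ i, a i • b i) = 0 := by
  induction hr : Module.finrank ℝ W using Nat.strong_induction_on generalizing W with
  | _ r ih =>
  classical
  by_cases hW : ∃ n, ∃ w ∈ W, Λ n w ≠ 0
  swap
  · push Not at hW
    exact ⟨Empty, inferInstance, Empty.elim, Empty.elim, by simp, by simp,
      linearIndependent_empty_type, fun w hw => ⟨Empty.elim, fun n => by simpa using hW n w hw⟩⟩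
  obtain ⟨w₀, hw₀, hne⟩ := Nat.find_spec hW
  have hmin : ∀ m < Nat.find hW, ∀ w ∈ W, Λ m w = 0 := fun m hm => by
    simpa using Nat.find_min hW hm
  set n := Nat.find hW
  have hlt : Module.finrank ℝ ↥(W ⊓ LinearMap.ker (Λ n)) < r := by
    rw [← hr]
    refine Submodule.finrank_lt_finrank_of_lt (lt_of_le_of_ne inf_le_left fun h => hne ?_)
    rw [← h] at hw₀
    exact hw₀.2
  obtain ⟨I, _, b, d, hbW, hb, hli, hspan⟩ := ih _ hlt _ rfl
  have hd : ∀ i, n < d i := by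
    intro i
    by_contra! h
    refine hli.ne_zero i ?_
    rcases h.lt_or_eq with h | h
    · exact hmin _ h _ (hbW i).1
    · simp only [h]
      exact (hbW i).2
  let B := Module.finBasis ℝ (W.map (Λ n))
  choose b' hb'W hb' using fun k => Submodule.mem_map.1 (B k).2
  have hli' : LinearIndependent ℝ (fun k => Λ n (b' k)) := by
    simp only [hb']
    exact B.linearIndependent.map' (Submodule.subtype _) (Submodule.ker_subtype _)
  refine ⟨Fin _ ⊕ I, inferInstance, Sum.elim b' b, Sum.elim (fun _ => n) d, ?_, ?_, ?_, ?_⟩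
  · rintro (k | i)
    · exact hb'W k
    · exact (hbW i).1
  · rintro (k | i) m hm
    · exact hmin m hm _ (hb'W k)
    · exact hb i m hm
  · have : (fun i => Λ (Sum.elim (fun _ => n) d i) (Sum.elim b' b i)) =
        Sum.elim (fun k => Λ n (b' k)) (fun i => Λ (d i) (b i)) := by
      ext1 (k | i) <;> rfl
    rw [this]
    refine hli'.sum_type hli ?_
    have h1 : Submodule.span ℝ (Set.range fun k => Λ n (b' k)) ≤
        MvPolynomial.homogeneousSubmodule ι ℝ n := by
      rw [Submodule.span_le]
      rintro _ ⟨k, rfl⟩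
      exact hΛ _ _
    have h2 : Submodule.span ℝ (Set.range fun i => Λ (d i) (b i)) ≤
        LinearMap.ker (MvPolynomial.homogeneousComponent n) := by
      rw [Submodule.span_le]
      rintro _ ⟨i, rfl⟩
      exact (MvPolynomial.homogeneousComponent_of_mem (hΛ _ _)).trans (if_neg (hd i).ne)
    rw [Submodule.disjoint_def]
    intro x hx1 hx2
    rw [← LinearMap.mem_ker.1 (h2 hx2)]
    exact ((MvPolynomial.homogeneousComponent_of_mem (h1 hx1)).trans (if_pos rfl)).symm
  · intro w hw
    have h1 := congrArg Subtype.val (B.sum_repr ⟨Λ n w, Submodule.mem_map_of_mem hw⟩)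
    set a' := B.repr ⟨Λ n w, Submodule.mem_map_of_mem hw⟩
    simp only [Submodule.coe_sum, Submodule.coe_smul, ← hb'] at h1
    obtain ⟨a, ha⟩ := hspan (w - ∑ k, a' k • b' k)
      ⟨W.sub_mem hw (W.sum_mem fun k _ => W.smul_mem _ (hb'W k)), by
        simp [h1]⟩
    refine ⟨Sum.elim a' a, fun n => ?_⟩
    simpa [sub_sub] using ha n

/-- The terms of the power series of an analytic function on `ℝ^ι` are homogeneous polynomials. -/
theorem AnalyticAt.exists_homogeneous_expansion {ι : Type*} [Fintype ι] {f : (ι → ℝ) → ℝ}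
    {x : ι → ℝ} (hf : AnalyticAt ℝ f x) :
    ∃ a : ℕ → MvPolynomial ι ℝ, (∀ n, (a n).IsHomogeneous n) ∧
      (∀ y, ∀ᶠ t : ℝ in 𝓝 0, HasSum (fun n => t ^ n * MvPolynomial.eval y (a n)) (f (x + t • y))) ∧
      ∀ y n, (fun t : ℝ => f (x + t • y) -
        ∑ m ∈ Finset.range n, t ^ m * MvPolynomial.eval y (a m)) =O[𝓝 0] fun t => t ^ n := by
  classical
  obtain ⟨P, hP⟩ := hf
  let a : ℕ → MvPolynomial ι ℝ := fun n => ∑ r : Fin n → ι,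
    MvPolynomial.C (P n fun i => Pi.single (r i) 1) * ∏ i, MvPolynomial.X (r i)
  have ha : ∀ n y (t : ℝ), P n (fun _ => t • y) = t ^ n * MvPolynomial.eval y (a n) := by
    intro n y t
    rw [(P n).map_smul_univ (fun _ => t) (fun _ => y)]
    simp only [Finset.prod_const, Finset.card_univ, Fintype.card_fin, smul_eq_mul]
    congr 1
    have hy : (fun _ : Fin n => y) =
        fun _ => ∑ j, y j • (Pi.single j (1 : ℝ) : ι → ℝ) := by
      ext _ k
      simp [Finset.sum_apply, Pi.single_apply]
    rw [hy, (P n).map_sum]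
    simp only [a, map_sum, map_mul, MvPolynomial.eval_C, map_prod, MvPolynomial.eval_X]
    refine Finset.sum_congr rfl fun r _ => ?_
    rw [(P n).map_smul_univ, smul_eq_mul, mul_comm]
  have hcont : ∀ y : ι → ℝ, Tendsto (fun t : ℝ => t • y) (𝓝 0) (𝓝 0) := by
    intro y
    have h : Continuous fun t : ℝ => t • y := by fun_prop
    simpa using h.tendsto 0
  refine ⟨a, fun n => ?_, fun y => ?_, fun y n => ?_⟩
  · refine MvPolynomial.IsHomogeneous.sum _ _ _ fun r _ => ?_
    have h := (MvPolynomial.isHomogeneous_C ι (P n fun i => Pi.single (r i) (1 : ℝ))).mul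
      (MvPolynomial.IsHomogeneous.prod Finset.univ (fun i => MvPolynomial.X (R := ℝ) (r i))
        (fun _ => 1) fun i _ => MvPolynomial.isHomogeneous_X _ _)
    simpa using h
  · filter_upwards [(hcont y).eventually hP.eventually_hasSum] with t ht
    simpa only [ha] using ht
  · have h := (hP.isBigO_sub_partialSum_pow n).comp_tendsto (hcont y)
    refine Asymptotics.IsBigO.trans (?_ : _ =O[𝓝 0] fun t : ℝ => ‖t • y‖ ^ n) ?_
    · simpa only [Function.comp_def, FormalMultilinearSeries.partialSum, ha] using h
    · refine Asymptotics.IsBigO.of_bound (‖y‖ ^ n) (Eventually.of_forall fun t => ?_)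
      simp [norm_smul, mul_pow, mul_comm]

/-- If arbitrarily fine rescalings `p ((x - x₀) / ε)` of a polynomial are sums of squares from a
fixed finite dimensional space of analytic functions, then `p` is a sum of squares of
polynomials. -/
theorem MvPolynomial.exists_sum_sq_of_rescaled {ι J K : Type*} [Fintype ι] [Fintype J] [Fintype K]
    {U : Set (ι → ℝ)} (hU : IsOpen U) {x₀ : ι → ℝ} (hx₀ : x₀ ∈ U) {f : J → (ι → ℝ) → ℝ}
    (hf : ∀ j, AnalyticAt ℝ (f j) x₀) (p : MvPolynomial ι ℝ)
    (h : ∀ m : ℕ, ∃ c : K → J → ℝ, ∀ x ∈ U,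
      MvPolynomial.eval (((m : ℝ) + 1) • (x - x₀)) p = ∑ k, (∑ j, c k j * f j x) ^ 2) :
    ∃ Q : K → MvPolynomial ι ℝ, p = ∑ k, Q k ^ 2 := by
  choose a hahom hasum hataylor using fun j => (hf j).exists_homogeneous_expansion
  let Λ : ℕ → (J → ℝ) →ₗ[ℝ] MvPolynomial ι ℝ := fun n =>
    Fintype.linearCombination ℝ (fun j => a j n)
  have hΛ : ∀ n c, Λ n c = ∑ j, c j • a j n := fun n c => Fintype.linearCombination_apply _ _ _
  obtain ⟨I, _, b, d, -, hb, hli, hspan⟩ := exists_linearIndependent_leadingForms Λ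
    (fun n c => by
      rw [hΛ]
      exact Submodule.sum_mem (MvPolynomial.homogeneousSubmodule ι ℝ n) fun j _ =>
        Submodule.smul_mem _ _ (hahom j n)) ⊤
  let q : I → MvPolynomial ι ℝ := fun i => Λ (d i) (b i)
  let ε : ℕ → ℝ := fun m => 1 / ((m : ℝ) + 1)
  have hε : Tendsto ε atTop (𝓝[≠] 0) :=
    tendsto_nhdsWithin_iff.2 ⟨tendsto_one_div_add_atTop_nhds_zero_nat,
      Eventually.of_forall fun m => one_div_ne_zero m.cast_add_one_ne_zero⟩
  have hε0 : ∀ m, ε m ≠ 0 := fun m => one_div_ne_zero m.cast_add_one_ne_zero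
  -- the rescaled basis functions converge to their leading forms
  let φ : I → (ι → ℝ) → ℝ → ℝ := fun i y t => t⁻¹ ^ d i * ∑ j, b i j * f j (x₀ + t • y)
  have hφ : ∀ i y, Tendsto (φ i y) (𝓝[≠] 0) (𝓝 (MvPolynomial.eval y (q i))) := by
    intro i y
    have h1 : (fun t : ℝ => ∑ j, b i j * (f j (x₀ + t • y) -
        ∑ m ∈ Finset.range (d i + 1), t ^ m * MvPolynomial.eval y (a j m))) =O[𝓝 0]
          fun t => t ^ (d i + 1) :=
      .fun_sum fun j _ => (hataylor j y _).const_mul_left _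
    have h2 : ∀ t : ℝ, ∑ j, b i j * (f j (x₀ + t • y) -
        ∑ m ∈ Finset.range (d i + 1), t ^ m * MvPolynomial.eval y (a j m)) =
          ∑ j, b i j * f j (x₀ + t • y) - t ^ d i * MvPolynomial.eval y (q i) := by
      intro t
      simp only [mul_sub, Finset.sum_sub_distrib, Finset.mul_sum]
      congr 1
      rw [Finset.sum_comm, Finset.sum_range_succ, Finset.sum_eq_zero, zero_add]
      · simp only [q, hΛ, map_sum, MvPolynomial.smul_eval, Finset.mul_sum]
        exact Finset.sum_congr rfl fun j _ => by ring
      · intro m hm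
        have h3 := congrArg (MvPolynomial.eval y) (hb i m (Finset.mem_range.1 hm))
        simp only [hΛ, map_sum, MvPolynomial.smul_eval, map_zero] at h3
        rw [← mul_zero (t ^ m), ← h3, Finset.mul_sum]
        exact Finset.sum_congr rfl fun j _ => by ring
    simp only [h2] at h1
    have h4 : (fun t => φ i y t - MvPolynomial.eval y (q i)) =O[𝓝[≠] 0] fun t : ℝ => t := by
      refine (((Asymptotics.isBigO_refl (fun t : ℝ => t⁻¹ ^ d i) _).mul
        (h1.mono nhdsWithin_le_nhds)).congr' ?_ ?_)
      · filter_upwards [self_mem_nhdsWithin] with t ht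
        have : t⁻¹ ^ d i * t ^ d i = 1 := by rw [← mul_pow, inv_mul_cancel₀ ht, one_pow]
        simp only [φ, mul_sub, ← mul_assoc, this, one_mul]
      · filter_upwards [self_mem_nhdsWithin] with t ht
        have : t⁻¹ ^ d i * t ^ d i = 1 := by rw [← mul_pow, inv_mul_cancel₀ ht, one_pow]
        rw [pow_succ, ← mul_assoc, this, one_mul]
    have h5 := h4.trans_tendsto (tendsto_id.mono_left nhdsWithin_le_nhds)
    simpa using h5.add_const (MvPolynomial.eval y (q i))
  -- coordinates of the certificates with respect to the rescaled basis
  choose c hc using h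
  choose s hs using fun m k => hspan (c m k) trivial
  have hrep : ∀ y, ∀ᶠ m in atTop, MvPolynomial.eval y p =
      ∑ k, (∑ i, (ε m ^ d i * s m k i) * φ i y (ε m)) ^ 2 := by
    intro y
    have hUy : ∀ᶠ t : ℝ in 𝓝 0, x₀ + t • y ∈ U := by
      have : Tendsto (fun t : ℝ => x₀ + t • y) (𝓝 0) (𝓝 (x₀ + (0 : ℝ) • y)) :=
        (continuous_const.add (continuous_id.smul continuous_const)).tendsto _
      rw [zero_smul, add_zero] at this
      exact this.eventually (hU.mem_nhds hx₀)
    filter_upwards [(hε.mono_right nhdsWithin_le_nhds).eventually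
      (hUy.and (eventually_all.2 fun j => hasum j y))] with m hm
    have h1 := hc m _ hm.1
    rw [add_sub_cancel_left, smul_smul] at h1
    have h2 : ((m : ℝ) + 1) * ε m = 1 := by
      simp only [ε]
      field_simp
    rw [h2, one_smul] at h1
    rw [h1]
    refine Finset.sum_congr rfl fun k _ => ?_
    congr 1
    have h3 : ∑ j, (c m k - ∑ i, s m k i • b i) j * f j (x₀ + ε m • y) = 0 := by
      have h4 : HasSum (fun n => ∑ j, (c m k - ∑ i, s m k i • b i) j *
          (ε m ^ n * MvPolynomial.eval y (a j n)))
            (∑ j, (c m k - ∑ i, s m k i • b i) j * f j (x₀ + ε m • y)) :=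
        hasSum_sum fun j _ => (hm.2 j).mul_left _
      refine h4.unique ?_
      convert hasSum_zero with n
      have h5 := congrArg (MvPolynomial.eval y) (hs m k n)
      rw [hΛ] at h5
      simp only [map_sum, MvPolynomial.smul_eval, map_zero] at h5
      rw [← mul_zero (ε m ^ n), ← h5, Finset.mul_sum]
      exact Finset.sum_congr rfl fun j _ => by ring
    simp only [Pi.sub_apply, Finset.sum_apply, Pi.smul_apply, smul_eq_mul, sub_mul,
      Finset.sum_sub_distrib, sub_eq_zero, Finset.sum_mul] at h3
    rw [h3, Finset.sum_comm]
    refine Finset.sum_congr rfl fun i _ => ?_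
    simp only [φ]
    rw [show ε m ^ d i * s m k i * ((ε m)⁻¹ ^ d i * ∑ j, b i j * f j (x₀ + ε m • y)) =
      (ε m * (ε m)⁻¹) ^ d i * (s m k i * ∑ j, b i j * f j (x₀ + ε m • y)) by
        rw [mul_pow]; ring, mul_inv_cancel₀ (hε0 m), one_pow, one_mul, Finset.mul_sum]
    exact Finset.sum_congr rfl fun j _ => by ring
  -- normalise, and pass to a convergent subsequence
  let σ : ℕ → (K → I → ℝ) × ℝ := fun m => (fun k i => ε m ^ d i * s m k i, 1)
  have hσ : ∀ m, ‖σ m‖ ≠ 0 := fun m => norm_ne_zero_iff.2 fun h0 =>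
    one_ne_zero (congrArg Prod.snd h0)
  obtain ⟨τ, hτ, ψ, hψ, hlim⟩ := (isCompact_sphere (0 : (K → I → ℝ) × ℝ) 1).tendsto_subseq
    (x := fun m => ‖σ m‖⁻¹ • σ m) fun m => by
      rw [mem_sphere_zero_iff_norm, norm_smul, norm_inv, norm_norm, inv_mul_cancel₀ (hσ m)]
  have hlim1 : ∀ k i, Tendsto (fun m => ‖σ (ψ m)‖⁻¹ * (ε (ψ m) ^ d i * s (ψ m) k i)) atTop
      (𝓝 (τ.1 k i)) := fun k i => by
    have h1 : Continuous fun z : (K → I → ℝ) × ℝ => z.1 k i := by fun_prop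
    exact (h1.tendsto τ).comp hlim
  have hlim2 : Tendsto (fun m => ‖σ (ψ m)‖⁻¹ * 1) atTop (𝓝 τ.2) :=
    (continuous_snd.tendsto τ).comp hlim
  have hεψ := hε.comp hψ.tendsto_atTop
  have key : C (τ.2 ^ 2) * p = ∑ k, (∑ i, C (τ.1 k i) * q i) ^ 2 := by
    refine MvPolynomial.funext fun y => ?_
    simp only [map_mul, map_sum, map_pow, eval_C]
    refine tendsto_nhds_unique ((hlim2.pow 2).mul_const (eval y p)) ?_
    refine Tendsto.congr' ?_ (tendsto_finsetSum Finset.univ fun k _ => (tendsto_finsetSum Finset.univ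
      fun i _ => (hlim1 k i).mul ((hφ i y).comp hεψ)).pow 2)
    filter_upwards [hψ.tendsto_atTop.eventually (hrep y)] with m hm
    rw [hm, Finset.mul_sum]
    refine Finset.sum_congr rfl fun k _ => ?_
    rw [← mul_pow, Finset.mul_sum]
    congr 1
    exact Finset.sum_congr rfl fun i _ => by simp only [Function.comp_apply]; ring
  have hτ2 : τ.2 ≠ 0 := by
    intro h0
    refine one_ne_zero ((mem_sphere_zero_iff_norm.1 hτ).symm.trans ?_)
    rw [norm_eq_zero]
    refine Prod.ext (_root_.funext fun k => _root_.funext fun i => ?_) h0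
    have hz : ∑ i, C (τ.1 k i) * q i = 0 := by
      refine MvPolynomial.funext fun y => ?_
      have h1 := congrArg (eval y) key
      rw [h0] at h1
      simp only [map_mul, map_sum, map_pow, eval_C, zero_pow two_ne_zero, zero_mul] at h1
      have := (Finset.sum_eq_zero_iff_of_nonneg fun k _ => sq_nonneg _).1 h1.symm k
        (Finset.mem_univ k)
      simpa using this
    simp only [← smul_eq_C_mul] at hz
    exact Fintype.linearIndependent_iff.1 hli _ hz i
  refine ⟨fun k => C τ.2⁻¹ * ∑ i, C (τ.1 k i) * q i, ?_⟩
  simp only [mul_pow, ← Finset.mul_sum, ← key]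
  rw [← mul_assoc, ← C_pow, ← C_mul, ← mul_pow, inv_mul_cancel₀ hτ2, one_pow, C_1, one_mul]

end Zoom

/-- If a cone of nonnegative polynomials is a spectrahedral shadow and contains all translates
and dilates of a polynomial `p`, then `p` is a sum of squares. -/
theorem IsSpectrahedralShadow.exists_eq_sum_sq {V : Type*} [AddCommGroup V] [Module ℝ V]
    {S : Set V} (hS : IsSpectrahedralShadow S) {ι : Type*} [Fintype ι]
    (ev : (ι → ℝ) → V →ₗ[ℝ] ℝ) (hpoly : ∀ C, ∃ p : MvPolynomial ι ℝ, ∀ x, ev x C = p.eval x)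
    (hnn : ∀ C ∈ S, ∀ x, 0 ≤ ev x C) {p : MvPolynomial ι ℝ}
    (hp : ∀ (x₀ : ι → ℝ) (c : ℝ), ∃ C ∈ S, ∀ x, ev x C = p.eval (c • (x - x₀))) :
    ∃ (K : Type) (_ : Fintype K) (Q : K → MvPolynomial ι ℝ), p = ∑ k, Q k ^ 2 := by
  obtain ⟨J, K, _, _, U, hU, ⟨x₀, hx₀⟩, f, hf, h⟩ := hS.exists_analytic_certificate ev hpoly hnn
  refine ⟨K, inferInstance, MvPolynomial.exists_sum_sq_of_rescaled hU hx₀ (f := f)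
    (fun j => hf j x₀ hx₀) p fun m => ?_⟩
  obtain ⟨C, hC, hCp⟩ := hp x₀ (m + 1)
  obtain ⟨c, hc⟩ := h C hC
  exact ⟨c, fun x hx => by rw [← hCp, hc x hx]⟩

section Compression

variable {α β α' β' : Type*} [Fintype α] [Fintype β] [Fintype α'] [Fintype β']

theorem blockForm_compression (C : Matrix (α × β) (α × β) ℂ) (G : Matrix α α' ℂ)
    (H : Matrix β β' ℂ) (v : α' → ℂ) (w : β' → ℂ) :
    blockForm ((G ⊗ₖ H)ᴴ * C * (G ⊗ₖ H)) v w = blockForm C (G *ᵥ v) (H *ᵥ w) := by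
  have h : (G ⊗ₖ H) *ᵥ (fun p : α' × β' => v p.1 * w p.2) =
      fun p : α × β => (G *ᵥ v) p.1 * (H *ᵥ w) p.2 := by
    ext p
    simp only [mulVec, dotProduct, kroneckerMap_apply, Fintype.sum_prod_type, Finset.sum_mul_sum]
    exact Finset.sum_congr rfl fun i _ => Finset.sum_congr rfl fun j _ => by ring
  rw [blockForm, blockForm, ← h, star_mulVec, ← mulVec_mulVec, ← mulVec_mulVec,
    ← dotProduct_mulVec]

theorem compression_mem_blockPositive {d s d' s' : ℕ}
    {C : Matrix (Fin d × Fin s) (Fin d × Fin s) ℂ} (hC : C ∈ BlockPositive d s)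
    (G : Matrix (Fin d) (Fin d') ℂ) (H : Matrix (Fin s) (Fin s') ℂ) :
    (G ⊗ₖ H)ᴴ * C * (G ⊗ₖ H) ∈ BlockPositive d' s' := by
  rw [mem_blockPositive_iff] at hC ⊢
  exact ⟨isHermitian_conjTranspose_mul_mul _ hC.1, fun v w => by
    rw [blockForm_compression]
    exact hC.2 _ _⟩

theorem blockForm_swap (C : Matrix (α × β) (α × β) ℂ) (v : α → ℂ) (w : β → ℂ) :
    blockForm (C.submatrix Prod.swap Prod.swap) w v = blockForm C v w := by
  simp only [blockForm, dotProduct, mulVec, submatrix_apply, Fintype.sum_prod_type_right (α₁ := α),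
    Fintype.sum_prod_type (α₁ := β), Prod.swap_prod_mk, Pi.star_apply, mul_comm (w _)]

theorem swap_mem_blockPositive {d s : ℕ} {C : Matrix (Fin d × Fin s) (Fin d × Fin s) ℂ}
    (hC : C ∈ BlockPositive d s) : C.submatrix Prod.swap Prod.swap ∈ BlockPositive s d := by
  rw [mem_blockPositive_iff] at hC ⊢
  exact ⟨hC.1.submatrix _, fun v w => by
    rw [blockForm_swap]
    exact hC.2 _ _⟩

end Compression

/-- A block positive matrix whose form, restricted to suitable families of product vectors, is a
polynomial that is not a sum of squares obstructs representations of all larger cones. -/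
theorem not_isSpectrahedralShadow_blockPositive {d₀ s₀ d s : ℕ} (hd : d₀ ≤ d) (hs : s₀ ≤ s)
    {C₀ : Matrix (Fin d₀ × Fin s₀) (Fin d₀ × Fin s₀) ℂ} (hC₀ : C₀ ∈ BlockPositive d₀ s₀)
    {ι : Type*} [Fintype ι] {v : (ι → ℝ) → Fin d₀ → ℂ} {w : (ι → ℝ) → Fin s₀ → ℂ}
    (hv : ∀ i, IsComplexPolynomial fun x => v x i) (hw : ∀ i, IsComplexPolynomial fun x => w x i)
    (hv' : ∀ (x₀ : ι → ℝ) (c : ℝ), ∃ G : Matrix (Fin d₀) (Fin d₀) ℂ,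
      ∀ x, G *ᵥ v x = v (c • (x - x₀)))
    (hw' : ∀ (x₀ : ι → ℝ) (c : ℝ), ∃ H : Matrix (Fin s₀) (Fin s₀) ℂ,
      ∀ x, H *ᵥ w x = w (c • (x - x₀)))
    {p : MvPolynomial ι ℝ} (hp : ∀ x, blockForm C₀ (v x) (w x) = p.eval x)
    (hsos : ∀ (K : Type) [Fintype K] (Q : K → MvPolynomial ι ℝ), p ≠ ∑ k, Q k ^ 2) :
    ¬ IsSpectrahedralShadow (BlockPositive d s) := by
  intro hS
  have pad : ∀ {m n : ℕ} (h : m ≤ n), ∃ P : Matrix (Fin m) (Fin n) ℂ, P * Pᵀ = 1 := by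
    intro m n h
    refine ⟨(1 : Matrix (Fin n) (Fin n) ℂ).submatrix (Fin.castLE h) id, ?_⟩
    rw [transpose_submatrix, transpose_one,
      ← submatrix_mul _ _ _ _ _ Function.bijective_id, mul_one,
      submatrix_one _ (Fin.castLE_injective h)]
  obtain ⟨P, hP⟩ := pad hd
  obtain ⟨R, hR⟩ := pad hs
  let ev : (ι → ℝ) → Matrix (Fin d × Fin s) (Fin d × Fin s) ℂ →ₗ[ℝ] ℝ := fun x =>
    { toFun := fun C => blockForm C (Pᵀ *ᵥ v x) (Rᵀ *ᵥ w x)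
      map_add' := fun C D => by simp [blockForm, add_mulVec]
      map_smul' := fun c C => by simp [blockForm, smul_mulVec] }
  have hconst : ∀ z : ℂ, IsComplexPolynomial fun _ : ι → ℝ => z := fun z =>
    ⟨MvPolynomial.C z.re, MvPolynomial.C z.im, fun a => by simp⟩
  have hmulVec : ∀ {m n : ℕ} (M : Matrix (Fin n) (Fin m) ℂ) {u : (ι → ℝ) → Fin m → ℂ},
      (∀ i, IsComplexPolynomial fun x => u x i) →
        ∀ i, IsComplexPolynomial fun x => (M *ᵥ u x) i := fun M u hu i =>
    .sum (f := fun j x => M i j * u x j) Finset.univ fun j _ => (hconst _).mul (hu j)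
  obtain ⟨K, _, Q, hQ⟩ := hS.exists_eq_sum_sq (p := p) ev
    (fun C => IsComplexPolynomial.blockForm (fun p q => hconst _)
      (hmulVec Pᵀ hv) (hmulVec Rᵀ hw))
    (fun C hC x => (mem_blockPositive_iff.1 hC).2 _ _)
    fun x₀ c => by
      obtain ⟨G, hG⟩ := hv' x₀ c
      obtain ⟨H, hH⟩ := hw' x₀ c
      refine ⟨_, compression_mem_blockPositive hC₀ (G * P) (H * R), fun x => ?_⟩
      change blockForm _ (Pᵀ *ᵥ v x) (Rᵀ *ᵥ w x) = _
      rw [blockForm_compression, mulVec_mulVec, mulVec_mulVec, Matrix.mul_assoc,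
        Matrix.mul_assoc, hP, hR,
        Matrix.mul_one, Matrix.mul_one, hG, hH, hp]
  exact hsos K Q hQ

section Biquadratic

open Filter Topology

theorem Polynomial.natDegree_le_one_of_sq_le {P : Polynomial ℝ} {M : ℝ}
    (h : ∀ t, P.eval t ^ 2 ≤ M * (1 + t ^ 2)) : P.natDegree ≤ 1 := by
  by_contra! hP
  have h2 : (1 + X ^ 2 : Polynomial ℝ).degree = 2 := by compute_degree!
  have hdeg : (1 + X ^ 2 : Polynomial ℝ).degree < (P ^ 2).degree := by
    have h0 : P ≠ 0 := fun h0 => by simp [h0] at hP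
    rw [h2, degree_eq_natDegree (pow_ne_zero 2 h0), natDegree_pow]
    exact_mod_cast (by lia : 2 < 2 * P.natDegree)
  have hlim := abs_div_tendsto_atTop_atTop_of_degree_gt (P ^ 2) (1 + X ^ 2) hdeg
    (fun h0 => by simp [h0] at h2)
  obtain ⟨t, ht⟩ := (hlim.eventually (eventually_gt_atTop M)).exists
  have hpos : 0 < 1 + t ^ 2 := by positivity
  simp only [eval_pow, eval_add, eval_one, eval_X] at ht
  rw [abs_of_nonneg (by positivity), lt_div_iff₀ hpos] at ht
  exact absurd (h t) (not_le.2 ht)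

theorem MvPolynomial.eval_add_smul_of_sq_le {ι : Type*} (Q : MvPolynomial ι ℝ) {z u : ι → ℝ}
    {M : ℝ} (h : ∀ t : ℝ, eval (z + t • u) Q ^ 2 ≤ M * (1 + t ^ 2)) (t : ℝ) :
    eval (z + t • u) Q = eval z Q + t * (eval (z + u) Q - eval z Q) := by
  let P : Polynomial ℝ := aeval (fun i => .C (z i) + .X * .C (u i)) Q
  have hP : ∀ t : ℝ, P.eval t = eval (z + t • u) Q := by
    intro t
    rw [← Polynomial.coe_aeval_eq_eval, ← coe_aeval_eq_eval]
    simp only [P, comp_aeval_apply]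
    have h : (fun i => Polynomial.aeval t (.C (z i) + .X * .C (u i) : Polynomial ℝ)) =
        z + t • u := by
      ext i
      simp
      exact mul_comm _ _
    rw [h]
    rfl
  have hdeg : P.natDegree ≤ 1 := Polynomial.natDegree_le_one_of_sq_le (M := M) fun t => by
    rw [hP]
    exact h t
  obtain ⟨a, b, hab⟩ := Polynomial.exists_eq_X_add_C_of_natDegree_le_one hdeg
  have h0 := hP 0
  have h1 := hP 1
  simp only [zero_smul, add_zero, one_smul] at h0 h1
  rw [← h0, ← h1, ← hP, hab]
  simp
  ring

/-- The coefficients, with respect to the coordinates `1, x₀, …, xₙ₋₁`, of an affine function. -/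
def affineCoeff {n : ℕ} (f : (Fin n → ℝ) → ℝ) : Fin (n + 1) → ℝ :=
  Fin.cons (f 0) fun i => f (Pi.single i 1) - f 0

theorem eq_sum_affineCoeff {n : ℕ} {f : (Fin n → ℝ) → ℝ}
    (hf : ∀ x u (t : ℝ), f (x + t • u) = f x + t * (f (x + u) - f x)) (x : Fin n → ℝ) :
    f x = ∑ i, affineCoeff f i * (Fin.cons 1 x : Fin (n + 1) → ℝ) i := by
  have hsmul : ∀ u (t : ℝ), f (t • u) - f 0 = t * (f u - f 0) := by
    intro u t
    have := hf 0 u t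
    simp only [zero_add] at this
    linarith
  let g : (Fin n → ℝ) →ₗ[ℝ] ℝ :=
    { toFun := fun x => f x - f 0
      map_add' := fun x y => by
        have h1 := hf x (y - x) 2⁻¹
        have h2 := hsmul (x + y) 2⁻¹
        have h3 : x + (2⁻¹ : ℝ) • (y - x) = (2⁻¹ : ℝ) • (x + y) := by module
        rw [h3, add_sub_cancel] at h1
        linarith
      map_smul' := fun t u => hsmul u t }
  have h := LinearMap.pi_apply_eq_sum_univ g x
  simp only [g, LinearMap.coe_mk, AddHom.coe_mk, smul_eq_mul] at h
  simp only [Fin.sum_univ_succ, affineCoeff, Fin.cons_zero, Fin.cons_succ, mul_one]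
  have h2 : ∀ i : Fin n, (fun j => if i = j then (1 : ℝ) else 0) = Pi.single i 1 := by
    intro i
    ext j
    simp [Pi.single_apply, eq_comm]
  simp only [h2] at h
  rw [← sub_eq_iff_eq_add', h]
  exact Finset.sum_congr rfl fun i _ => mul_comm _ _

/-- A sum of squares representation of the dehomogenization of a biquadratic form is a
representation of the form as a sum of squares of bilinear forms. -/
theorem exists_bilinear_of_eq_sum_sq {a b : ℕ} {B : (Fin (a + 1) → ℝ) → (Fin (b + 1) → ℝ) → ℝ}
    (hcont : Continuous fun z : (Fin (a + 1) → ℝ) × (Fin (b + 1) → ℝ) => B z.1 z.2)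
    (hleft : ∀ (c : ℝ) v w, B (c • v) w = c ^ 2 * B v w)
    (hright : ∀ (c : ℝ) v w, B v (c • w) = c ^ 2 * B v w)
    {K : Type*} [Fintype K] (Q : K → MvPolynomial (Fin a ⊕ Fin b) ℝ)
    (hQ : ∀ x y, B (Fin.cons 1 x) (Fin.cons 1 y) =
      ∑ k, MvPolynomial.eval (Sum.elim x y) (Q k) ^ 2) :
    ∃ e : K → Fin (a + 1) → Fin (b + 1) → ℝ, ∀ v w,
      B v w = ∑ k, (∑ i, ∑ j, e k i j * v i * w j) ^ 2 := by
  have hle : ∀ k x y, MvPolynomial.eval (Sum.elim x y) (Q k) ^ 2 ≤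
      B (Fin.cons 1 x) (Fin.cons 1 y) := fun k x y => by
    rw [hQ]
    exact Finset.single_le_sum (f := fun k => MvPolynomial.eval (Sum.elim x y) (Q k) ^ 2)
      (fun k _ => sq_nonneg _) (Finset.mem_univ k)
  have hgrowth : ∀ φ : ℝ × ℝ → ℝ, Continuous φ → (∀ (c : ℝ) z, φ (c • z) = c ^ 2 * φ z) →
      ∃ M, ∀ t, φ (1, t) ≤ M * (1 + t ^ 2) := by
    intro φ hφ hhom
    obtain ⟨M, hM⟩ := (isCompact_closedBall (0 : ℝ × ℝ) 1).bddAbove_image hφ.continuousOn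
    refine ⟨M, fun t => ?_⟩
    have hpos : 0 < 1 + t ^ 2 := by positivity
    have hs : √(1 + t ^ 2) ≠ 0 := (Real.sqrt_pos.2 hpos).ne'
    have h1 : φ ((√(1 + t ^ 2))⁻¹ • (1, t)) ≤ M := by
      refine hM ⟨_, ?_, rfl⟩
      have hle1 : 1 ≤ √(1 + t ^ 2) := Real.one_le_sqrt.2 (by nlinarith [sq_nonneg t])
      have hle2 : |t| ≤ √(1 + t ^ 2) := Real.abs_le_sqrt (by linarith)
      rw [mem_closedBall_zero_iff, norm_smul, norm_inv, Real.norm_of_nonneg (Real.sqrt_nonneg _)]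
      refine inv_mul_le_one_of_le₀ ?_ (Real.sqrt_nonneg _)
      rw [Prod.norm_def, norm_one]
      exact max_le hle1 hle2
    have h2 := hhom (√(1 + t ^ 2)) ((√(1 + t ^ 2))⁻¹ • (1, t))
    rw [smul_inv_smul₀ hs, Real.sq_sqrt hpos.le] at h2
    rw [h2, mul_comm]
    exact mul_le_mul_of_nonneg_right h1 hpos.le
  have hcons : ∀ {n : ℕ} (x u : Fin n → ℝ) (t : ℝ), (Fin.cons 1 (x + t • u) : Fin (n + 1) → ℝ) =
      (1 : ℝ) • (Fin.cons 1 x : Fin (n + 1) → ℝ) + t • (Fin.cons 0 u : Fin (n + 1) → ℝ) := by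
    intro n x u t
    ext i
    refine Fin.cases ?_ (fun i => ?_) i <;> simp
  have hx : ∀ k y x u (t : ℝ), MvPolynomial.eval (Sum.elim (x + t • u) y) (Q k) =
      MvPolynomial.eval (Sum.elim x y) (Q k) + t * (MvPolynomial.eval (Sum.elim (x + u) y) (Q k) -
        MvPolynomial.eval (Sum.elim x y) (Q k)) := by
    intro k y x u t
    obtain ⟨M, hM⟩ := hgrowth (fun z => B (z.1 • (Fin.cons 1 x : Fin (a + 1) → ℝ) +
        z.2 • (Fin.cons 0 u : Fin (a + 1) → ℝ)) (Fin.cons 1 y))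
      (hcont.comp (f := fun z : ℝ × ℝ => (z.1 • (Fin.cons 1 x : Fin (a + 1) → ℝ) +
        z.2 • (Fin.cons 0 u : Fin (a + 1) → ℝ), (Fin.cons 1 y : Fin (b + 1) → ℝ))) (by fun_prop))
      fun c z => by
        rw [← hleft, Prod.smul_fst, Prod.smul_snd, smul_add, smul_smul, smul_smul]
        rfl
    have helim : ∀ t : ℝ, Sum.elim (x + t • u) y =
        Sum.elim x y + t • Sum.elim u (0 : Fin b → ℝ) := by
      intro t
      ext (i | j) <;> simp
    have h1 := (Q k).eval_add_smul_of_sq_le (z := Sum.elim x y) (u := Sum.elim u 0) (M := M)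
      (fun t => by
        rw [← helim]
        refine (hle k _ _).trans ?_
        rw [hcons]
        exact hM t) t
    have h2 := helim 1
    rw [one_smul, one_smul] at h2
    rwa [← helim, ← h2] at h1
  have hy : ∀ k x y u (t : ℝ), MvPolynomial.eval (Sum.elim x (y + t • u)) (Q k) =
      MvPolynomial.eval (Sum.elim x y) (Q k) + t * (MvPolynomial.eval (Sum.elim x (y + u)) (Q k) -
        MvPolynomial.eval (Sum.elim x y) (Q k)) := by
    intro k x y u t
    obtain ⟨M, hM⟩ := hgrowth (fun z => B (Fin.cons 1 x) (z.1 • (Fin.cons 1 y : Fin (b + 1) → ℝ) +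
        z.2 • (Fin.cons 0 u : Fin (b + 1) → ℝ)))
      (hcont.comp (f := fun z : ℝ × ℝ => ((Fin.cons 1 x : Fin (a + 1) → ℝ),
        z.1 • (Fin.cons 1 y : Fin (b + 1) → ℝ) + z.2 • (Fin.cons 0 u : Fin (b + 1) → ℝ)))
        (by fun_prop))
      fun c z => by
        rw [← hright, Prod.smul_fst, Prod.smul_snd, smul_add, smul_smul, smul_smul]
        rfl
    have helim : ∀ t : ℝ, Sum.elim x (y + t • u) =
        Sum.elim x y + t • Sum.elim (0 : Fin a → ℝ) u := by
      intro t
      ext (i | j) <;> simp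
    have h1 := (Q k).eval_add_smul_of_sq_le (z := Sum.elim x y) (u := Sum.elim 0 u) (M := M)
      (fun t => by
        rw [← helim]
        refine (hle k _ _).trans ?_
        rw [hcons]
        exact hM t) t
    have h2 := helim 1
    rw [one_smul, one_smul] at h2
    rwa [← helim, ← h2] at h1
  let e : K → Fin (a + 1) → Fin (b + 1) → ℝ := fun k i => affineCoeff fun y =>
    affineCoeff (fun x => MvPolynomial.eval (Sum.elim x y) (Q k)) i
  have he : ∀ k x y, MvPolynomial.eval (Sum.elim x y) (Q k) =
      ∑ i, ∑ j, e k i j * (Fin.cons 1 x : Fin (a + 1) → ℝ) i *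
        (Fin.cons 1 y : Fin (b + 1) → ℝ) j := by
    intro k x y
    rw [eq_sum_affineCoeff (f := fun x => MvPolynomial.eval (Sum.elim x y) (Q k)) (hx k y) x]
    refine Finset.sum_congr rfl fun i _ => ?_
    rw [eq_sum_affineCoeff (f := fun y =>
      affineCoeff (fun x => MvPolynomial.eval (Sum.elim x y) (Q k)) i) (fun y u t => by
        refine Fin.cases ?_ (fun i => ?_) i
        · exact hy k 0 y u t
        · simp only [affineCoeff, Fin.cons_succ, hy k _ y u t]
          ring) y, Finset.sum_mul]
    exact Finset.sum_congr rfl fun j _ => by ring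
  refine ⟨e, ?_⟩
  let S : (Fin (a + 1) → ℝ) → (Fin (b + 1) → ℝ) → ℝ := fun v w =>
    ∑ k, (∑ i, ∑ j, e k i j * v i * w j) ^ 2
  have hSleft : ∀ (c : ℝ) v w, S (c • v) w = c ^ 2 * S v w := by
    intro c v w
    simp only [S, Finset.mul_sum, ← mul_pow]
    refine Finset.sum_congr rfl fun k _ => congrArg (· ^ 2) ?_
    refine Finset.sum_congr rfl fun i _ => Finset.sum_congr rfl fun j _ => ?_
    simp only [Pi.smul_apply, smul_eq_mul]
    ring
  have hSright : ∀ (c : ℝ) v w, S v (c • w) = c ^ 2 * S v w := by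
    intro c v w
    simp only [S, Finset.mul_sum, ← mul_pow]
    refine Finset.sum_congr rfl fun k _ => congrArg (· ^ 2) ?_
    refine Finset.sum_congr rfl fun i _ => Finset.sum_congr rfl fun j _ => ?_
    simp only [Pi.smul_apply, smul_eq_mul]
    ring
  have hdehom : ∀ {n : ℕ} (v : Fin (n + 1) → ℝ), v 0 ≠ 0 →
      v = v 0 • (Fin.cons 1 fun i => (v 0)⁻¹ * v i.succ : Fin (n + 1) → ℝ) := by
    intro n v hv
    ext i
    refine Fin.cases ?_ (fun i => ?_) i <;> simp [hv]
  have hBS : ∀ v w, v 0 ≠ 0 → w 0 ≠ 0 → B v w = S v w := by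
    intro v w hv hw
    rw [hdehom v hv, hdehom w hw, hleft, hright, hSleft, hSright, hQ]
    simp only [he, S]
  intro v w
  have hshift : ∀ {n : ℕ} (v : Fin (n + 1) → ℝ),
      Tendsto (fun t : ℝ => v + t • Pi.single 0 1) (𝓝[≠] 0) (𝓝 v) ∧
        ∀ᶠ t : ℝ in 𝓝[≠] 0, (v + t • Pi.single 0 1 : Fin (n + 1) → ℝ) 0 ≠ 0 := by
    intro n v
    constructor
    · have h : Continuous fun t : ℝ => v + t • (Pi.single 0 1 : Fin (n + 1) → ℝ) := by fun_prop
      simpa using (h.tendsto 0).mono_left nhdsWithin_le_nhds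
    · simp only [Pi.add_apply, Pi.smul_apply, Pi.single_eq_same, smul_eq_mul, mul_one]
      by_cases hv : v 0 = 0
      · filter_upwards [self_mem_nhdsWithin] with t ht
        simpa [hv] using ht
      · have h : Continuous fun t : ℝ => v 0 + t := by fun_prop
        exact nhdsWithin_le_nhds (h.continuousAt.eventually_ne (by simpa using hv))
  have hlim := (hshift v).1.prodMk_nhds (hshift w).1
  have hS : Continuous fun z : (Fin (a + 1) → ℝ) × (Fin (b + 1) → ℝ) => S z.1 z.2 := by
    simp only [S]
    fun_prop
  refine tendsto_nhds_unique ((hcont.tendsto (v, w)).comp hlim)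
    (((hS.tendsto (v, w)).comp hlim).congr' ?_)
  filter_upwards [(hshift v).2, (hshift w).2] with t hv hw
  exact (hBS _ _ hv hw).symm

end Biquadratic

theorem blockForm_smul_left {α β : Type*} [Fintype α] [Fintype β] (C : Matrix (α × β) (α × β) ℂ)
    (c : ℝ) (v : α → ℂ) (w : β → ℂ) : blockForm C (c • v) w = c ^ 2 * blockForm C v w := by
  have h : (fun p : α × β => (c • v) p.1 * w p.2) = (c : ℂ) • fun p : α × β => v p.1 * w p.2 := by
    ext p
    simp [mul_assoc]
  rw [blockForm, blockForm, h, star_smul, mulVec_smul, smul_dotProduct, dotProduct_smul,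
    smul_smul, RCLike.star_def, Complex.conj_ofReal, smul_eq_mul, ← Complex.ofReal_mul,
    Complex.re_ofReal_mul, sq]

theorem blockForm_smul_right {α β : Type*} [Fintype α] [Fintype β] (C : Matrix (α × β) (α × β) ℂ)
    (c : ℝ) (v : α → ℂ) (w : β → ℂ) : blockForm C v (c • w) = c ^ 2 * blockForm C v w := by
  rw [← blockForm_swap, blockForm_smul_left, blockForm_swap]

/-- A block positive matrix whose form, restricted to real subspaces of product vectors, is not a
sum of squares of bilinear forms obstructs representations of all larger cones. -/
theorem not_isSpectrahedralShadow_blockPositive_of_bilinear {d₀ s₀ d s a b : ℕ} (hd : d₀ ≤ d)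
    (hs : s₀ ≤ s) {C₀ : Matrix (Fin d₀ × Fin s₀) (Fin d₀ × Fin s₀) ℂ}
    (hC₀ : C₀ ∈ BlockPositive d₀ s₀)
    (φ : (Fin (a + 1) → ℝ) →ₗ[ℝ] (Fin d₀ → ℂ)) (ψ : (Fin (b + 1) → ℝ) →ₗ[ℝ] (Fin s₀ → ℂ))
    (hφ : ∀ (x₀ : Fin a → ℝ) (c : ℝ), ∃ G : Matrix (Fin d₀) (Fin d₀) ℂ,
      ∀ x, G *ᵥ φ (Fin.cons 1 x) = φ (Fin.cons 1 (c • (x - x₀))))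
    (hψ : ∀ (x₀ : Fin b → ℝ) (c : ℝ), ∃ H : Matrix (Fin s₀) (Fin s₀) ℂ,
      ∀ x, H *ᵥ ψ (Fin.cons 1 x) = ψ (Fin.cons 1 (c • (x - x₀))))
    (h : ∀ (K : Type) [Fintype K] (e : K → Fin (a + 1) → Fin (b + 1) → ℝ),
      ¬ ∀ v w, blockForm C₀ (φ v) (ψ w) = ∑ k, (∑ i, ∑ j, e k i j * v i * w j) ^ 2) :
    ¬ IsSpectrahedralShadow (BlockPositive d s) := by
  have hpoly : ∀ {n m : ℕ} (χ : (Fin (n + 1) → ℝ) →ₗ[ℝ] (Fin m → ℂ)) {ι : Type} (g : Fin n → ι)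
      (i : Fin m), IsComplexPolynomial fun z : ι → ℝ => χ (Fin.cons 1 (z ∘ g)) i := by
    intro n m χ ι g i
    let P : Fin (n + 1) → MvPolynomial ι ℝ := Fin.cons 1 fun j => MvPolynomial.X (g j)
    have hP : ∀ (z : ι → ℝ) j, (Fin.cons 1 (z ∘ g) : Fin (n + 1) → ℝ) j =
        MvPolynomial.eval z (P j) := by
      intro z j
      refine Fin.cases ?_ (fun j => ?_) j <;> simp [P]
    refine ⟨∑ j, P j * MvPolynomial.C (χ (fun k => if j = k then 1 else 0) i).re,
      ∑ j, P j * MvPolynomial.C (χ (fun k => if j = k then 1 else 0) i).im, fun z => ?_⟩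
    beta_reduce
    rw [LinearMap.pi_apply_eq_sum_univ χ]
    simp [Complex.ext_iff, hP]
  obtain ⟨p, hp⟩ := IsComplexPolynomial.blockForm (κ := Fin a ⊕ Fin b) (C := fun _ => C₀)
    (fun p q => ⟨MvPolynomial.C (C₀ p q).re, MvPolynomial.C (C₀ p q).im, fun a => by simp⟩)
    (hpoly φ Sum.inl) (hpoly ψ Sum.inr)
  refine not_isSpectrahedralShadow_blockPositive hd hs hC₀ (hpoly φ Sum.inl) (hpoly ψ Sum.inr)
    (fun x₀ c => ?_) (fun x₀ c => ?_) hp fun K _ Q hQ => ?_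
  · obtain ⟨G, hG⟩ := hφ (x₀ ∘ Sum.inl) c
    exact ⟨G, fun x => hG (x ∘ Sum.inl)⟩
  · obtain ⟨H, hH⟩ := hψ (x₀ ∘ Sum.inr) c
    exact ⟨H, fun x => hH (x ∘ Sum.inr)⟩
  · have hφc := φ.continuous_of_finiteDimensional
    have hψc := ψ.continuous_of_finiteDimensional
    obtain ⟨e, he⟩ := exists_bilinear_of_eq_sum_sq (B := fun v w => blockForm C₀ (φ v) (ψ w))
      (by
        simp only [blockForm, dotProduct, mulVec]
        fun_prop)
      (fun c v w => by rw [map_smul, blockForm_smul_left])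
      (fun c v w => by rw [map_smul, blockForm_smul_right]) Q
      (fun x y => by
        have := hp (Sum.elim x y)
        rw [hQ] at this
        simpa using this)
    exact h K e he

theorem not_isSpectrahedralShadow_blockPositive_swap {d₀ s₀ d s a b : ℕ} (hd : d₀ ≤ d)
    (hs : s₀ ≤ s) {C₀ : Matrix (Fin d₀ × Fin s₀) (Fin d₀ × Fin s₀) ℂ}
    (hC₀ : C₀ ∈ BlockPositive d₀ s₀)
    (φ : (Fin (a + 1) → ℝ) →ₗ[ℝ] (Fin d₀ → ℂ)) (ψ : (Fin (b + 1) → ℝ) →ₗ[ℝ] (Fin s₀ → ℂ))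
    (hφ : ∀ (x₀ : Fin a → ℝ) (c : ℝ), ∃ G : Matrix (Fin d₀) (Fin d₀) ℂ,
      ∀ x, G *ᵥ φ (Fin.cons 1 x) = φ (Fin.cons 1 (c • (x - x₀))))
    (hψ : ∀ (x₀ : Fin b → ℝ) (c : ℝ), ∃ H : Matrix (Fin s₀) (Fin s₀) ℂ,
      ∀ x, H *ᵥ ψ (Fin.cons 1 x) = ψ (Fin.cons 1 (c • (x - x₀))))
    (h : ∀ (K : Type) [Fintype K] (e : K → Fin (a + 1) → Fin (b + 1) → ℝ),
      ¬ ∀ v w, blockForm C₀ (φ v) (ψ w) = ∑ k, (∑ i, ∑ j, e k i j * v i * w j) ^ 2) :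
    ¬ IsSpectrahedralShadow (BlockPositive s d) := by
  refine not_isSpectrahedralShadow_blockPositive_of_bilinear hs hd (swap_mem_blockPositive hC₀)
    ψ φ hψ hφ fun K _ e he => h K (fun k i j => e k j i) fun v w => ?_
  rw [← blockForm_swap, he]
  refine Finset.sum_congr rfl fun k _ => congrArg (· ^ 2) ?_
  rw [Finset.sum_comm]
  exact Finset.sum_congr rfl fun i _ => Finset.sum_congr rfl fun j _ => by ring

/-- The inclusion of real vectors into complex vectors. -/
def complexification (n : ℕ) : (Fin n → ℝ) →ₗ[ℝ] (Fin n → ℂ) where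
  toFun v i := v i
  map_add' v w := by
    ext
    simp
  map_smul' c v := by
    ext
    simp

theorem exists_mulVec_complexification_cons {n : ℕ} (x₀ : Fin n → ℝ) (c : ℝ) :
    ∃ G : Matrix (Fin (n + 1)) (Fin (n + 1)) ℂ, ∀ x : Fin n → ℝ,
      G *ᵥ complexification (n + 1) (Fin.cons 1 x) =
        complexification (n + 1) (Fin.cons 1 (c • (x - x₀))) := by
  refine ⟨of (Fin.cons (Pi.single 0 1) fun i => Fin.cons (-(c * x₀ i) : ℂ) (Pi.single i (c : ℂ))),
    fun x => ?_⟩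
  ext i
  refine Fin.cases ?_ (fun i => ?_) i
  · simp [complexification, mulVec, dotProduct, Fin.sum_univ_succ]
  · simp [complexification, mulVec, dotProduct, Fin.sum_univ_succ, Pi.single_apply]
    ring

theorem sum_mul_mul_eq_polarization {a b : ℕ} {K : Type*} [Fintype K]
    {e : K → Fin a → Fin b → ℝ} {F : (Fin a → ℝ) → (Fin b → ℝ) → ℝ}
    (h : ∀ v w, F v w = ∑ k, (∑ i, ∑ j, e k i j * v i * w j) ^ 2) (i i' : Fin a) (j j' : Fin b) :
    ∑ k, e k i j * e k i' j' + ∑ k, e k i j' * e k i' j =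
      (F (Pi.single i 1 + Pi.single i' 1) (Pi.single j 1 + Pi.single j' 1) -
        F (Pi.single i 1 - Pi.single i' 1) (Pi.single j 1 + Pi.single j' 1) -
        F (Pi.single i 1 + Pi.single i' 1) (Pi.single j 1 - Pi.single j' 1) +
        F (Pi.single i 1 - Pi.single i' 1) (Pi.single j 1 - Pi.single j' 1)) / 8 := by
  simp only [h, ← Finset.sum_add_distrib, ← Finset.sum_sub_distrib, Finset.sum_div]
  refine Finset.sum_congr rfl fun k _ => ?_
  simp [mul_add, mul_sub, Finset.sum_add_distrib, Pi.single_apply]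
  ring

theorem eq_zero_of_sum_mul_self_eq_zero {K : Type*} [Fintype K] {f : K → ℝ}
    (h : ∑ k, f k * f k = 0) (k : K) : f k = 0 :=
  mul_self_eq_zero.1 ((Finset.sum_eq_zero_iff_of_nonneg fun _ _ => mul_self_nonneg _).1 h k
    (Finset.mem_univ k))

section ThreeThree

/-- A block positive matrix on `ℂ³ ⊗ ℂ³` of Choi type. -/
def choiMatrix : Matrix (Fin 3 × Fin 3) (Fin 3 × Fin 3) ℂ :=
  diagonal (fun p => if p.2 = p.1 ∨ p.2 = p.1 + 1 then 2 else 0) -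
    of fun p q => if p.1 = p.2 ∧ q.1 = q.2 then 1 else 0

theorem blockForm_choiMatrix (v w : Fin 3 → ℂ) :
    blockForm choiMatrix v w =
      ∑ i, (2 * Complex.normSq (v i) * Complex.normSq (w i) +
        2 * Complex.normSq (v i) * Complex.normSq (w (i + 1))) -
        Complex.normSq (∑ i, v i * w i) := by
  simp [blockForm, choiMatrix, dotProduct, mulVec,
    Fintype.sum_prod_type, Fin.sum_univ_three, diagonal_apply, Complex.normSq_apply, Prod.ext_iff]
  ring

theorem choiMatrix_mem_blockPositive : choiMatrix ∈ BlockPositive 3 3 := by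
  rw [mem_blockPositive_iff]
  constructor
  · refine (isHermitian_diagonal_iff.2 fun p => ?_).sub ?_
    · by_cases hp : p.2 = p.1 ∨ p.2 = p.1 + 1 <;> simp [hp, isSelfAdjoint_iff]
    · ext p q
      simp [and_comm, apply_ite]
  intro v w
  rw [blockForm_choiMatrix, sub_nonneg]
  have hdiv : ∀ x y z : ℝ, 0 ≤ x → 0 ≤ y → 0 ≤ z → x / (2 * x + 2 * z) ≤
      (x + y) / (2 * (x + y + z)) := by
    intro x y z hx hy hz
    rcases hx.eq_or_lt with rfl | hx
    · rw [zero_div]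
      positivity
    rw [div_le_div_iff₀ (by positivity) (by positivity)]
    nlinarith [mul_nonneg hx.le hz, mul_nonneg hy hz]
  have ha : ∀ i, 0 ≤ Complex.normSq (v i) := fun i => Complex.normSq_nonneg _
  have hb : ∀ i, 0 ≤ Complex.normSq (w i) := fun i => Complex.normSq_nonneg _
  have hsum : ∑ i, Complex.normSq (v i) /
      (2 * Complex.normSq (v i) + 2 * Complex.normSq (v (i - 1))) ≤ 1 := by
    have h0 := hdiv _ _ _ (ha 0) (ha 1) (ha 2)
    have h1 := hdiv _ _ _ (ha 1) (ha 2) (ha 0)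
    have h2 := hdiv _ _ _ (ha 2) (ha 0) (ha 1)
    have e0 : (0 : Fin 3) - 1 = 2 := rfl
    have e1 : (2 : Fin 3) - 1 = 1 := rfl
    rw [Fin.sum_univ_three, e0, sub_self, e1]
    refine (add_le_add (add_le_add h0 h1) h2).trans ?_
    rw [show Complex.normSq (v 1) + Complex.normSq (v 2) + Complex.normSq (v 0) =
      Complex.normSq (v 0) + Complex.normSq (v 1) + Complex.normSq (v 2) by ring,
      show Complex.normSq (v 2) + Complex.normSq (v 0) + Complex.normSq (v 1) =
      Complex.normSq (v 0) + Complex.normSq (v 1) + Complex.normSq (v 2) by ring,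
      ← add_div, ← add_div]
    refine div_le_one_of_le₀ (le_of_eq (by ring)) ?_
    linarith [ha 0, ha 1, ha 2]
  have hcs := Finset.sum_sq_le_sum_mul_sum_of_sq_le_mul Finset.univ
    (r := fun i => ‖v i‖ * ‖w i‖)
    (f := fun i => Complex.normSq (v i) /
      (2 * Complex.normSq (v i) + 2 * Complex.normSq (v (i - 1))))
    (g := fun i => (2 * Complex.normSq (v i) + 2 * Complex.normSq (v (i - 1))) *
      Complex.normSq (w i))
    (fun i _ => div_nonneg (ha i) (by linarith [ha i, ha (i - 1)]))
    (fun i _ => mul_nonneg (by linarith [ha i, ha (i - 1)]) (hb i))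
    (fun i _ => Eq.le <| by
      rw [mul_pow, ← Complex.normSq_eq_norm_sq, ← Complex.normSq_eq_norm_sq, ← mul_assoc]
      congr 1
      by_cases h0 : 2 * Complex.normSq (v i) + 2 * Complex.normSq (v (i - 1)) = 0
      · have : Complex.normSq (v i) = 0 := by linarith [ha i, ha (i - 1)]
        simp [this]
      · rw [div_mul_cancel₀ _ h0])
  calc Complex.normSq (∑ i, v i * w i) ≤ (∑ i, ‖v i‖ * ‖w i‖) ^ 2 := by
        rw [Complex.normSq_eq_norm_sq]
        refine pow_le_pow_left₀ (norm_nonneg _) ((norm_sum_le _ _).trans (le_of_eq ?_)) 2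
        simp only [norm_mul]
    _ ≤ 1 * ∑ i, (2 * Complex.normSq (v i) + 2 * Complex.normSq (v (i - 1))) *
          Complex.normSq (w i) := hcs.trans (mul_le_mul_of_nonneg_right hsum
            (Finset.sum_nonneg fun i _ => mul_nonneg (by linarith [ha i, ha (i - 1)]) (hb i)))
    _ = _ := by
        have e0 : (0 : Fin 3) - 1 = 2 := rfl
        have e1 : (2 : Fin 3) - 1 = 1 := rfl
        have e2 : (2 : Fin 3) + 1 = 0 := rfl
        have e3 : (1 : Fin 3) + 1 = 2 := rfl
        rw [Fin.sum_univ_three, Fin.sum_univ_three, e0, sub_self, e1, zero_add, e2, e3]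
        ring

theorem not_sum_sq_choiMatrix (K : Type) [Fintype K] (e : K → Fin 3 → Fin 3 → ℝ) :
    ¬ ∀ v w, blockForm choiMatrix (complexification 3 v) (complexification 3 w) =
      ∑ k, (∑ i, ∑ j, e k i j * v i * w j) ^ 2 := by
  intro h
  have hF : ∀ v w : Fin 3 → ℝ,
      2 * v 0 ^ 2 * (w 0 ^ 2 + w 1 ^ 2) + 2 * v 1 ^ 2 * (w 1 ^ 2 + w 2 ^ 2) +
      2 * v 2 ^ 2 * (w 2 ^ 2 + w 0 ^ 2) - (v 0 * w 0 + v 1 * w 1 + v 2 * w 2) ^ 2 =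
      ∑ k, (∑ i, ∑ j, e k i j * v i * w j) ^ 2 := by
    intro v w
    have e2 : (2 : Fin 3) + 1 = 0 := rfl
    have e3 : (1 : Fin 3) + 1 = 2 := rfl
    rw [← h, blockForm_choiMatrix]
    simp only [complexification, LinearMap.coe_mk, AddHom.coe_mk, Fin.sum_univ_three, e2, e3,
      zero_add, ← Complex.ofReal_mul, ← Complex.ofReal_add, Complex.normSq_ofReal]
    ring
  have hpol := sum_mul_mul_eq_polarization (F := fun v w : Fin 3 → ℝ => 2 * v 0 ^ 2 *
    (w 0 ^ 2 + w 1 ^ 2) + 2 * v 1 ^ 2 * (w 1 ^ 2 + w 2 ^ 2) +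
      2 * v 2 ^ 2 * (w 2 ^ 2 + w 0 ^ 2) - (v 0 * w 0 + v 1 * w 1 + v 2 * w 2) ^ 2) hF
  have z02 : ∑ k, e k 0 2 * e k 0 2 = 0 := by
    have := hpol 0 0 2 2
    norm_num +decide [Pi.single_apply] at this
    linarith
  have z10 : ∑ k, e k 1 0 * e k 1 0 = 0 := by
    have := hpol 1 1 0 0
    norm_num +decide [Pi.single_apply] at this
    linarith
  have z21 : ∑ k, e k 2 1 * e k 2 1 = 0 := by
    have := hpol 2 2 1 1
    norm_num +decide [Pi.single_apply] at this
    linarith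
  have h00 := hpol 0 0 0 0
  have h11 := hpol 1 1 1 1
  have h22 := hpol 2 2 2 2
  have h01 := hpol 0 1 0 1
  have h12 := hpol 1 2 1 2
  have h20 := hpol 2 0 2 0
  norm_num +decide [Pi.single_apply, eq_zero_of_sum_mul_self_eq_zero z02,
    eq_zero_of_sum_mul_self_eq_zero z10, eq_zero_of_sum_mul_self_eq_zero z21]
    at h00 h11 h22 h01 h12 h20
  have hpos : 0 ≤ ∑ k, (e k 0 0 + e k 1 1 + e k 2 2) ^ 2 := Finset.sum_nonneg fun k _ => sq_nonneg _
  have hexp : ∑ k, (e k 0 0 + e k 1 1 + e k 2 2) ^ 2 = ∑ k, e k 0 0 * e k 0 0 +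
      ∑ k, e k 1 1 * e k 1 1 + ∑ k, e k 2 2 * e k 2 2 + 2 * ∑ k, e k 0 0 * e k 1 1 +
      2 * ∑ k, e k 1 1 * e k 2 2 + 2 * ∑ k, e k 2 2 * e k 0 0 := by
    simp only [Finset.mul_sum, ← Finset.sum_add_distrib]
    exact Finset.sum_congr rfl fun k _ => by ring
  linarith

end ThreeThree

section TwoFour

/-- A family of quaternary quadratic forms, nonnegative whenever `P, R ≥ 0` and
`x ^ 2 + y ^ 2 = P * R`. -/
noncomputable def coneForm (P R x y : ℝ) (w : Fin 4 → ℝ) : ℝ :=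
  P * (w 0 ^ 2 + 2 * w 1 ^ 2 + 2 * w 2 ^ 2) + R * (2 * w 1 ^ 2 + 2 * w 2 ^ 2 + w 3 ^ 2) -
    2 * w 0 * (x * w 1 - y * w 2) - 2 * w 3 * (x * w 2 + y * w 1) -
    5 / 2 * (x * (w 1 ^ 2 - w 2 ^ 2) + 2 * y * (w 1 * w 2))

theorem coneForm_nonneg_of_le {P R x y : ℝ} (hR : 0 ≤ R) (hPR : R ≤ P)
    (hxy : x ^ 2 + y ^ 2 = P * R) (w : Fin 4 → ℝ) : 0 ≤ coneForm P R x y w := by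
  rcases hR.eq_or_lt with rfl | hR
  · have hx : x = 0 := by nlinarith [sq_nonneg x, sq_nonneg y]
    have hy : y = 0 := by nlinarith [sq_nonneg x, sq_nonneg y]
    subst hx hy
    simp only [coneForm]
    have : 0 ≤ P * (w 0 ^ 2 + 2 * w 1 ^ 2 + 2 * w 2 ^ 2) := by positivity
    linarith
  have hP : 0 < P := hR.trans_le hPR
  have hmid : 0 ≤ (P + 2 * R) * (w 1 ^ 2 + w 2 ^ 2) -
      5 / 2 * (x * (w 1 ^ 2 - w 2 ^ 2) + 2 * y * (w 1 * w 2)) := by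
    rw [sub_nonneg]
    refine le_of_abs_le (abs_le_of_sq_le_sq ?_ (by positivity))
    have hcs : (x * (w 1 ^ 2 - w 2 ^ 2) + 2 * y * (w 1 * w 2)) ^ 2 ≤
        P * R * (w 1 ^ 2 + w 2 ^ 2) ^ 2 := by
      rw [← hxy, ← sub_nonneg]
      linarith [sq_nonneg (y * (w 1 ^ 2 - w 2 ^ 2) - 2 * x * (w 1 * w 2))]
    have hPR' : 25 / 4 * (P * R) ≤ (P + 2 * R) ^ 2 := by
      nlinarith [sq_nonneg (P - 2 * R), mul_pos hP hR]
    have := mul_le_mul_of_nonneg_right hPR' (sq_nonneg (w 1 ^ 2 + w 2 ^ 2))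
    rw [mul_pow, mul_pow]
    linarith
  have hid : R * coneForm P R x y w = R * (P - R) * w 0 ^ 2 +
      (R * w 0 - (x * w 1 - y * w 2)) ^ 2 + (R * w 3 - (x * w 2 + y * w 1)) ^ 2 +
      R * ((P + 2 * R) * (w 1 ^ 2 + w 2 ^ 2) -
        5 / 2 * (x * (w 1 ^ 2 - w 2 ^ 2) + 2 * y * (w 1 * w 2))) := by
    simp only [coneForm]
    linear_combination (-(w 1 ^ 2 + w 2 ^ 2)) * hxy
  refine nonneg_of_mul_nonneg_right (a := R) ?_ hR
  rw [hid]
  have := mul_nonneg (mul_nonneg hR.le (sub_nonneg.2 hPR)) (sq_nonneg (w 0))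
  have := mul_nonneg hR.le hmid
  positivity

theorem coneForm_nonneg {P R x y : ℝ} (hP : 0 ≤ P) (hR : 0 ≤ R)
    (hxy : x ^ 2 + y ^ 2 = P * R) (w : Fin 4 → ℝ) : 0 ≤ coneForm P R x y w := by
  rcases le_total R P with h | h
  · exact coneForm_nonneg_of_le hR h hxy w
  · have := coneForm_nonneg_of_le (x := -x) (y := y) hP h (by rw [neg_sq, hxy, mul_comm])
      ![w 3, -w 2, -w 1, w 0]
    simp [coneForm] at this ⊢
    linarith

/-- A block positive matrix on `ℂ² ⊗ ℂ⁴`. -/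
noncomputable def coneMatrix : Matrix (Fin 2 × Fin 4) (Fin 2 × Fin 4) ℂ :=
  !![1, 0; 0, 0] ⊗ₖ diagonal ![1, 2, 2, 0] + !![0, 0; 0, 1] ⊗ₖ diagonal ![0, 2, 2, 1] +
    !![0, 1 / 2; 1 / 2, 0] ⊗ₖ
      !![0, -1, 0, 0; -1, -5 / 2, 0, 0; 0, 0, 5 / 2, -1; 0, 0, -1, 0] +
    !![0, -Complex.I / 2; Complex.I / 2, 0] ⊗ₖ
      !![0, 0, 1, 0; 0, 0, -5 / 2, -1; 1, -5 / 2, 0, 0; 0, -1, 0, 0]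

theorem blockForm_coneMatrix (v : Fin 2 → ℂ) (w : Fin 4 → ℂ) :
    blockForm coneMatrix v w =
      coneForm (Complex.normSq (v 0)) (Complex.normSq (v 1)) (star (v 0) * v 1).re
        (star (v 0) * v 1).im (fun i => (w i).re) +
      coneForm (Complex.normSq (v 0)) (Complex.normSq (v 1)) (star (v 0) * v 1).re
        (star (v 0) * v 1).im (fun i => (w i).im) := by
  simp [blockForm, coneMatrix, coneForm, dotProduct, mulVec, Fintype.sum_prod_type,
    Fin.sum_univ_succ, diagonal_apply, Complex.normSq_apply]
  ring

theorem coneMatrix_mem_blockPositive : coneMatrix ∈ BlockPositive 2 4 := by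
  rw [mem_blockPositive_iff]
  constructor
  · refine IsHermitian.ext fun i j => ?_
    obtain ⟨i, i'⟩ := i
    obtain ⟨j, j'⟩ := j
    fin_cases i <;> fin_cases j <;> fin_cases i' <;> fin_cases j' <;>
      simp [coneMatrix]
  · intro v w
    have h : (star (v 0) * v 1).re ^ 2 + (star (v 0) * v 1).im ^ 2 =
        Complex.normSq (v 0) * Complex.normSq (v 1) := by
      simp [Complex.normSq_apply]
      ring
    rw [blockForm_coneMatrix]
    exact add_nonneg
      (coneForm_nonneg (Complex.normSq_nonneg _) (Complex.normSq_nonneg _) h _)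
      (coneForm_nonneg (Complex.normSq_nonneg _) (Complex.normSq_nonneg _) h _)

/-- The real subspace `{(r, z) | r ∈ ℝ, z ∈ ℂ}` of `ℂ²`. -/
def realLineSum : (Fin 3 → ℝ) →ₗ[ℝ] (Fin 2 → ℂ) where
  toFun v := ![v 0, ⟨v 1, v 2⟩]
  map_add' v w := by
    ext i
    fin_cases i <;> simp [Complex.ext_iff]
  map_smul' c v := by
    ext i
    fin_cases i <;> simp [Complex.ext_iff]

theorem exists_mulVec_realLineSum_cons (x₀ : Fin 2 → ℝ) (c : ℝ) :
    ∃ G : Matrix (Fin 2) (Fin 2) ℂ, ∀ x : Fin 2 → ℝ,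
      G *ᵥ realLineSum (Fin.cons 1 x) = realLineSum (Fin.cons 1 (c • (x - x₀))) := by
  refine ⟨!![1, 0; -c * ⟨x₀ 0, x₀ 1⟩, c], fun x => ?_⟩
  have h1 : ∀ z : Fin 2 → ℝ, (Fin.cons 1 z : Fin 3 → ℝ) 1 = z 0 := fun z => rfl
  have h2 : ∀ z : Fin 2 → ℝ, (Fin.cons 1 z : Fin 3 → ℝ) 2 = z 1 := fun z => rfl
  ext i
  fin_cases i
  · simp [realLineSum, mulVec, dotProduct]
  · simp only [realLineSum, LinearMap.coe_mk, AddHom.coe_mk, h1, h2]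
    simp [mulVec, dotProduct, Complex.ext_iff]
    constructor <;> ring

theorem not_sum_sq_coneMatrix (K : Type) [Fintype K] (e : K → Fin 3 → Fin 4 → ℝ) :
    ¬ ∀ v w, blockForm coneMatrix (realLineSum v) (complexification 4 w) =
      ∑ k, (∑ i, ∑ j, e k i j * v i * w j) ^ 2 := by
  intro h
  have hF : ∀ (v : Fin 3 → ℝ) (w : Fin 4 → ℝ),
      coneForm (v 0 ^ 2) (v 1 ^ 2 + v 2 ^ 2) (v 0 * v 1) (v 0 * v 2) w =
      ∑ k, (∑ i, ∑ j, e k i j * v i * w j) ^ 2 := by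
    intro v w
    rw [← h, blockForm_coneMatrix]
    simp [complexification, realLineSum, coneForm, Complex.normSq_apply, sq]
  have hpol := sum_mul_mul_eq_polarization (F := fun (v : Fin 3 → ℝ) (w : Fin 4 → ℝ) =>
    coneForm (v 0 ^ 2) (v 1 ^ 2 + v 2 ^ 2) (v 0 * v 1) (v 0 * v 2) w) hF
  simp only [coneForm] at hpol
  have z10 : ∑ k, e k 1 0 * e k 1 0 = 0 := by
    have := hpol 1 1 0 0
    norm_num +decide [Pi.single_apply] at this
    linarith
  have z20 : ∑ k, e k 2 0 * e k 2 0 = 0 := by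
    have := hpol 2 2 0 0
    norm_num +decide [Pi.single_apply] at this
    linarith
  have z03 : ∑ k, e k 0 3 * e k 0 3 = 0 := by
    have := hpol 0 0 3 3
    norm_num +decide [Pi.single_apply] at this
    linarith
  have q01 := hpol 0 0 1 1
  have q23 := hpol 2 2 3 3
  have q11 := hpol 1 1 1 1
  have q22 := hpol 2 2 2 2
  have q02 := hpol 0 0 2 2
  have q13 := hpol 1 1 3 3
  have q21 := hpol 2 2 1 1
  have q12 := hpol 1 1 2 2
  have q00 := hpol 0 0 0 0
  have p0213 := hpol 0 2 1 3
  have p0111 := hpol 0 1 1 1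
  have p0212 := hpol 0 2 1 2
  have p2131 := hpol 2 1 3 1
  have p2232 := hpol 2 2 3 2
  have p1212 := hpol 1 2 1 2
  have p0123 := hpol 0 1 2 3
  have p0122 := hpol 0 1 2 2
  have p1132 := hpol 1 1 3 2
  have p0101 := hpol 0 1 0 1
  have p0202 := hpol 0 2 0 2
  norm_num +decide [Pi.single_apply, eq_zero_of_sum_mul_self_eq_zero z10,
    eq_zero_of_sum_mul_self_eq_zero z20, eq_zero_of_sum_mul_self_eq_zero z03]
    at q01 q23 q11 q22 q02 q13 q21 q12 q00
      p0213 p0111 p0212 p2131 p2232 p1212 p0123 p0122 p1132 p0101 p0202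
  simp only [mul_comm (e _ 1 2) (e _ 1 3), mul_comm (e _ 2 2) (e _ 2 3)] at p1132 p2232
  have hpos : 0 ≤ ∑ k, ((e k 0 1 + e k 2 3 + 1 / 2 * (e k 1 1 + e k 2 2)) ^ 2 +
      (e k 0 2 + e k 1 3 + 1 / 2 * (e k 2 1 - e k 1 2)) ^ 2 +
      2 * (e k 0 0 + 1 / 2 * (e k 1 1 - e k 2 2)) ^ 2) :=
    Finset.sum_nonneg fun k _ => by positivity
  have hexp : ∑ k, ((e k 0 1 + e k 2 3 + 1 / 2 * (e k 1 1 + e k 2 2)) ^ 2 +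
      (e k 0 2 + e k 1 3 + 1 / 2 * (e k 2 1 - e k 1 2)) ^ 2 +
      2 * (e k 0 0 + 1 / 2 * (e k 1 1 - e k 2 2)) ^ 2) =
      (∑ k, e k 0 1 * e k 0 1) + (∑ k, e k 2 3 * e k 2 3) + (∑ k, e k 0 2 * e k 0 2) +
        (∑ k, e k 1 3 * e k 1 3) + 3 / 4 * (∑ k, e k 1 1 * e k 1 1) +
        3 / 4 * (∑ k, e k 2 2 * e k 2 2) + 1 / 4 * (∑ k, e k 2 1 * e k 2 1) +
        1 / 4 * (∑ k, e k 1 2 * e k 1 2) + 2 * (∑ k, e k 0 0 * e k 0 0) +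
        2 * (∑ k, e k 0 1 * e k 2 3) + (∑ k, e k 0 1 * e k 1 1) + (∑ k, e k 0 1 * e k 2 2) +
        (∑ k, e k 0 2 * e k 2 1) + (∑ k, e k 2 3 * e k 1 1) + (∑ k, e k 2 1 * e k 1 3) +
        (∑ k, e k 2 3 * e k 2 2) + 2 * (∑ k, e k 0 2 * e k 1 3) + 2 * (∑ k, e k 0 0 * e k 1 1) -
        1 / 2 * (∑ k, e k 1 1 * e k 2 2) - 1 / 2 * (∑ k, e k 1 2 * e k 2 1) -
        (∑ k, e k 0 2 * e k 1 2) - (∑ k, e k 1 3 * e k 1 2) - 2 * (∑ k, e k 0 0 * e k 2 2) := by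
    simp only [Finset.mul_sum, ← Finset.sum_add_distrib, ← Finset.sum_sub_distrib]
    exact Finset.sum_congr rfl fun k _ => by ring
  linarith

end TwoFour

/-- For `d, s ≥ 2` with `d + s > 5`, the cone of block positive matrices
(equivalently, of positive maps `Mat_d → Mat_s`) is not a spectrahedral shadow,
although it is a closed convex semialgebraic cone. -/
theorem block_positive_not_spectrahedral_shadow (d s : ℕ) (hd : 2 ≤ d) (hs : 2 ≤ s)
    (hds : 5 < d + s) :
    ¬ IsSpectrahedralShadow (BlockPositive d s) ∧
    IsClosed (BlockPositive d s) ∧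
    Convex ℝ (BlockPositive d s) ∧
    (∀ c : ℝ, 0 ≤ c → ∀ x ∈ BlockPositive d s, c • x ∈ BlockPositive d s) ∧
    IsSemialgebraic (matrixCoords '' BlockPositive d s) := by
  refine ⟨?_, isClosed_blockPositive d s, convex_blockPositive d s,
    fun c hc x hx => smul_mem_blockPositive hc hx, isSemialgebraic_blockPositive d s⟩
  rcases hd.eq_or_lt with rfl | hd
  · exact not_isSpectrahedralShadow_blockPositive_of_bilinear le_rfl (by omega)
      coneMatrix_mem_blockPositive realLineSum (complexification 4)
      exists_mulVec_realLineSum_cons exists_mulVec_complexification_cons not_sum_sq_coneMatrix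
  rcases hs.eq_or_lt with rfl | hs
  · exact not_isSpectrahedralShadow_blockPositive_swap le_rfl (by omega)
      coneMatrix_mem_blockPositive realLineSum (complexification 4)
      exists_mulVec_realLineSum_cons exists_mulVec_complexification_cons not_sum_sq_coneMatrix
  · exact not_isSpectrahedralShadow_blockPositive_of_bilinear hd hs
      choiMatrix_mem_blockPositive (complexification 3) (complexification 3)
      exists_mulVec_complexification_cons exists_mulVec_complexification_cons
      not_sum_sq_choiMatrix
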